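/- Let h be a Brouwer homeomorphism. Define, for distinct points x, y ∈ ℝ², d_h(x,y) to be the smallest integer k such that there exist translation domains O₁,…,O_k whose union is connected and contains both x and y, and set d_h(x,x)=0. Then d_h is a distance (metric) on ℝ². -/

import Mathlib

open Set Filter Topology

/-- The plane. -/
abbrev Plane : Type := ℝ × ℝ

/-- A homeomorphism of the plane preserves orientation iff it is isotopic to the identity. -/
def IsotopicToId (h : Plane ≃ₜ Plane) : Prop :=
  ∃ H : ℝ → Plane ≃ₜ Plane,
    Continuous (fun p : ℝ × Plane => H p.1 p.2) ∧
    H 0 = Homeomorph.refl Plane ∧ H 1 = h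

/-- A Brouwer homeomorphism: an orientation-preserving (i.e. isotopic to the identity),
fixed-point-free homeomorphism of the plane. -/
structure BrouwerHomeo where
  toHomeomorph : Plane ≃ₜ Plane
  orientationPreserving : IsotopicToId toHomeomorph
  fixedPointFree : ∀ x : Plane, toHomeomorph x ≠ x

/-- The integer iterate `h^n`. -/
def BrouwerHomeo.iter (h : BrouwerHomeo) (n : ℤ) : Plane → Plane :=
  ⇑(h.toHomeomorph.toEquiv ^ n)

/-- A set is free if it is disjoint from its image under `h`. -/
def IsFree (h : BrouwerHomeo) (E : Set Plane) : Prop :=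
  Disjoint (h.toHomeomorph '' E) E

/-- A closed topological disk: a subset of the plane homeomorphic to the closed unit disk. -/
def IsClosedDisk (D : Set Plane) : Prop :=
  Nonempty (D ≃ₜ (Metric.closedBall (0 : Plane) 1 : Set Plane))
/-- A translation domain for `h`: an open, connected, simply connected, invariant subset
of the plane on which `h` is conjugate to the translation `(x, y) ↦ (x + 1, y)`. -/
def IsTranslationDomain (h : BrouwerHomeo) (O : Set Plane) : Prop :=
  IsOpen O ∧ IsConnected O ∧ SimplyConnectedSpace O ∧
  h.toHomeomorph '' O = O ∧
  ∃ Φ : O ≃ₜ Plane, ∀ (x : Plane) (hx : x ∈ O) (hx' : h.toHomeomorph x ∈ O),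
    Φ ⟨h.toHomeomorph x, hx'⟩ = ((Φ ⟨x, hx⟩).1 + 1, (Φ ⟨x, hx⟩).2)

/-- `x` and `y` are contained in the connected union of `k` translation domains. -/
def ConnectsBy (h : BrouwerHomeo) (x y : Plane) (k : ℕ) : Prop :=
  ∃ O : Fin k → Set Plane, (∀ i, IsTranslationDomain h (O i)) ∧
    IsConnected (⋃ i, O i) ∧ x ∈ ⋃ i, O i ∧ y ∈ ⋃ i, O i

open Classical in
/-- The translation distance of `h`: the minimal number of translation domains whose
union is connected and contains both points. -/
noncomputable def transDist (h : BrouwerHomeo) (x y : Plane) : ℕ :=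
  if x = y then 0 else sInf {k : ℕ | ConnectsBy h x y k}

/-- `x` and `y` lie in the same orbit of `h`. -/
def SameOrbit (h : BrouwerHomeo) (x y : Plane) : Prop :=
  ∃ n : ℤ, h.iter n x = y

open Metric in
lemma exists_tendstoLocallyUniformlyOn_of_mapsTo_ball {U : Set ℂ} (hU : IsOpen U)
    {F : ℕ → ℂ → ℂ} (hd : ∀ n, DifferentiableOn ℂ (F n) U)
    (hm : ∀ n, MapsTo (F n) U (ball 0 1)) (𝒰 : Ultrafilter ℕ) :
    ∃ g : ℂ → ℂ, TendstoLocallyUniformlyOn F g 𝒰 U := by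
  have hlim : ∀ z, ∃ w, z ∈ U → Tendsto (fun n => F n z) 𝒰 (𝓝 w) := by
    intro z
    by_cases hz : z ∈ U
    · obtain ⟨w, -, hw⟩ := (isCompact_closedBall (0 : ℂ) 1).ultrafilter_le_nhds
        (𝒰.map (fun n => F n z)) (by
          rw [le_principal_iff]
          change (fun n => F n z) ⁻¹' closedBall 0 1 ∈ 𝒰
          exact univ_mem' fun n => ball_subset_closedBall (hm n hz))
      exact ⟨w, fun _ => hw⟩
    · exact ⟨0, fun h => absurd h hz⟩
  choose g hg using hlim
  refine ⟨g, ?_⟩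
  rw [Metric.tendstoLocallyUniformlyOn_iff]
  intro ε hε x hx
  obtain ⟨r, hr, hrU⟩ := Metric.isOpen_iff.1 hU x hx
  have hlip : ∀ n, ∀ y ∈ ball x r, dist (F n y) (F n x) ≤ 2 / r * dist y x := by
    intro n y hy
    refine Complex.dist_le_div_mul_dist_of_mapsTo_ball ((hd n).mono hrU) ?_ hy
    intro w hw
    have h1 := hm n (hrU hw)
    have h2 := hm n hx
    rw [mem_closedBall]
    rw [mem_ball] at h1 h2
    linarith [dist_triangle_right (F n w) (F n x) 0]
  have hlipg : ∀ y ∈ ball x r, dist (g y) (g x) ≤ 2 / r * dist y x := fun y hy =>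
    le_of_tendsto ((hg y (hrU hy)).dist (hg x hx)) (Eventually.of_forall fun n => hlip n y hy)
  set δ := min r (ε * r / 8) with hδ
  have hδ0 : 0 < δ := lt_min hr (by positivity)
  refine ⟨ball x δ, mem_nhdsWithin_of_mem_nhds (ball_mem_nhds x hδ0), ?_⟩
  filter_upwards [(Metric.tendsto_nhds.1 (hg x hx)) (ε / 4) (by positivity)] with n hn y hy
  have hyr : y ∈ ball x r := ball_subset_ball (min_le_left _ _) hy
  have hb : 2 / r * dist y x ≤ ε / 4 := by
    have : dist y x ≤ ε * r / 8 := (mem_ball.1 hy).le.trans (min_le_right _ _)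
    calc 2 / r * dist y x ≤ 2 / r * (ε * r / 8) := by gcongr
      _ = ε / 4 := by field_simp; norm_num
  have h1 := hlip n y hyr
  have h2 := hlipg y hyr
  have h3 := dist_triangle4 (g y) (g x) (F n x) (F n y)
  rw [dist_comm (g x)] at h3
  rw [dist_comm (F n x) (F n y)] at h3
  linarith

open Metric in
/-- Hurwitz: a nonconstant locally uniform limit of injective holomorphic functions is injective. -/
lemma TendstoLocallyUniformlyOn.injOn_of_injOn {U : Set ℂ} (hU : IsOpen U)
    (hUc : IsPreconnected U) {F : ℕ → ℂ → ℂ} {g : ℂ → ℂ} {φ : Filter ℕ} [φ.NeBot]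
    (hd : ∀ n, DifferentiableOn ℂ (F n) U) (hi : ∀ n, InjOn (F n) U)
    (h : TendstoLocallyUniformlyOn F g φ U) {u v : ℂ} (hu : u ∈ U) (hv : v ∈ U)
    (huv : g u ≠ g v) : InjOn g U := by
  have hgd : DifferentiableOn ℂ g U := h.differentiableOn (Eventually.of_forall hd) hU
  intro a ha b hb hab
  by_contra hne
  have hga : AnalyticOnNhd ℂ g U := hgd.analyticOnNhd hU
  have hiso : ∀ᶠ z in 𝓝[≠] b, g z ≠ g b := by
    have := (hga b hb).eventually_eq_or_eventually_ne (analyticAt_const (v := g b))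
    rcases this with h1 | h1
    · exfalso
      have := hga.eqOn_of_preconnected_of_eventuallyEq (analyticOnNhd_const (v := g b)) hUc hb h1
      exact huv ((this hu).trans (this hv).symm)
    · exact h1
  rw [eventually_nhdsWithin_iff, Metric.eventually_nhds_iff_ball] at hiso
  obtain ⟨r₁, hr₁, hiso⟩ := hiso
  obtain ⟨r₂, hr₂, hrU⟩ := Metric.isOpen_iff.1 hU b hb
  have hab' : 0 < dist a b := dist_pos.2 hne
  set r := min (min r₁ r₂) (dist a b) / 2 with hr
  have hr0 : 0 < r := by positivity
  have hrlt : r < min (min r₁ r₂) (dist a b) := half_lt_self (by positivity)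
  have hr1 : r < r₁ := hrlt.trans_le ((min_le_left _ _).trans (min_le_left _ _))
  have hr2 : r < r₂ := hrlt.trans_le ((min_le_left _ _).trans (min_le_right _ _))
  have hr3 : r < dist a b := hrlt.trans_le (min_le_right _ _)
  have hcb : closedBall b r ⊆ U := (closedBall_subset_ball hr2).trans hrU
  obtain ⟨m, hm0, hm⟩ : ∃ m > 0, ∀ z ∈ sphere b r, m ≤ ‖g z - g b‖ := by
    have hc : IsCompact (sphere b r) := isCompact_sphere b r
    have hcont : ContinuousOn (fun z => ‖g z - g b‖) (sphere b r) :=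
      ((hgd.continuousOn.mono (sphere_subset_closedBall.trans hcb)).sub continuousOn_const).norm
    have hne : (sphere b r).Nonempty := NormedSpace.sphere_nonempty.2 hr0.le
    obtain ⟨z, hz, hmin⟩ := hc.exists_isMinOn hne hcont
    refine ⟨‖g z - g b‖, ?_, fun w hw => hmin hw⟩
    refine norm_pos_iff.2 (sub_ne_zero.2 (hiso z ?_ ?_))
    · rw [mem_ball, mem_sphere.1 hz]; exact hr1
    · rintro rfl
      simp at hz; exact hr0.ne hz
  have hunif : TendstoUniformlyOn F g φ (closedBall b r) := by
    rw [← tendstoLocallyUniformlyOn_iff_tendstoUniformlyOn_of_compact (isCompact_closedBall b r)]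
    exact h.mono hcb
  have e1 := (Metric.tendstoUniformlyOn_iff.1 hunif) (m / 8) (by positivity)
  have e2 := (Metric.tendsto_nhds.1 (h.tendsto_at ha)) (m / 8) (by positivity)
  obtain ⟨n, hn1, hn2⟩ := (e1.and e2).exists
  have hbc : b ∈ closedBall b r := mem_closedBall_self hr0.le
  have hnb := hn1 b hbc
  have key : ∀ z ∈ sphere b r, m / 2 ≤ ‖F n z - F n b‖ := by
    intro z hz
    have h1 := hm z hz
    have h2 := hn1 z (sphere_subset_closedBall hz)
    rw [← dist_eq_norm] at h1 ⊢
    have := dist_triangle4 (g z) (F n z) (F n b) (g b)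
    rw [dist_comm (F n b) (g b)] at this
    linarith
  have hball := DiffContOnCl.ball_subset_image_closedBall (f := F n) (z₀ := b) (r := r)
    (ε := m / 2) (((hd n).mono hcb).diffContOnCl_ball subset_rfl) hr0 key (by
      apply Filter.Eventually.frequently (f := 𝓝[≠] b) _ |>.filter_mono nhdsWithin_le_nhds
      have : ∀ᶠ z in 𝓝[≠] b, z ∈ U ∧ z ≠ b :=
        (eventually_nhdsWithin_of_eventually_nhds (hU.mem_nhds hb)).and self_mem_nhdsWithin
      filter_upwards [this] with z hz heq
      exact hz.2 (hi n hz.1 hb heq))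
  have : F n a ∈ ball (F n b) (m / 2 / 2) := by
    rw [mem_ball]
    have := dist_triangle4 (F n a) (g a) (g b) (F n b)
    rw [hab, dist_self] at this
    rw [hab] at hn2
    linarith
  obtain ⟨z, hz, hza⟩ := hball this
  have := hi n (hcb hz) ha hza
  rw [this, mem_closedBall] at hz
  linarith

open Metric ComplexConjugate in
lemma norm_sub_lt_norm_one_sub_conj_mul {a z : ℂ} (ha : ‖a‖ < 1) (hz : ‖z‖ < 1) :
    ‖z - a‖ < ‖1 - conj a * z‖ := by
  have key : ‖1 - conj a * z‖ ^ 2 - ‖z - a‖ ^ 2 = (1 - ‖a‖ ^ 2) * (1 - ‖z‖ ^ 2) := by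
    simp only [← Complex.normSq_eq_norm_sq, Complex.normSq_apply, Complex.sub_re, Complex.sub_im,
      Complex.mul_re, Complex.mul_im, Complex.conj_re, Complex.conj_im, Complex.one_re,
      Complex.one_im]
    ring
  have : 0 < (1 - ‖a‖ ^ 2) * (1 - ‖z‖ ^ 2) := by
    apply mul_pos <;> nlinarith [norm_nonneg a, norm_nonneg z]
  exact lt_of_pow_lt_pow_left₀ 2 (norm_nonneg _) (by linarith)

open ComplexConjugate in
lemma one_sub_conj_mul_ne_zero {a z : ℂ} (ha : ‖a‖ < 1) (hz : ‖z‖ < 1) :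
    1 - conj a * z ≠ 0 :=
  norm_pos_iff.1 ((norm_nonneg _).trans_lt (norm_sub_lt_norm_one_sub_conj_mul ha hz))

open ComplexConjugate in
lemma norm_mobius_lt_one {a z : ℂ} (ha : ‖a‖ < 1) (hz : ‖z‖ < 1) :
    ‖(z - a) / (1 - conj a * z)‖ < 1 := by
  rw [norm_div, div_lt_one (norm_pos_iff.2 (one_sub_conj_mul_ne_zero ha hz))]
  exact norm_sub_lt_norm_one_sub_conj_mul ha hz

open ComplexConjugate in
lemma mobius_injective {a z w : ℂ} (ha : ‖a‖ < 1) (hz : ‖z‖ < 1) (hw : ‖w‖ < 1)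
    (h : (z - a) / (1 - conj a * z) = (w - a) / (1 - conj a * w)) : z = w := by
  rw [div_eq_div_iff (one_sub_conj_mul_ne_zero ha hz) (one_sub_conj_mul_ne_zero ha hw)] at h
  have h0 : (1 : ℂ) - conj a * a ≠ 0 := one_sub_conj_mul_ne_zero ha ha
  have : (1 - conj a * a) * (z - w) = 0 := by linear_combination h
  exact sub_eq_zero.1 ((mul_eq_zero.1 this).resolve_left h0)

lemma DifferentiableOn.of_continuousOn_sq {U : Set ℂ} (hU : IsOpen U) {q F : ℂ → ℂ}
    (hq : ContinuousOn q U) (hF : DifferentiableOn ℂ F U) (h : ∀ z ∈ U, q z ^ 2 = F z)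
    (h0 : ∀ z ∈ U, F z ≠ 0) : DifferentiableOn ℂ q U := by
  intro z hz
  refine DifferentiableAt.differentiableWithinAt ?_
  have hq0 : q z ≠ 0 := fun hh => h0 z hz (by rw [← h z hz, hh]; simp)
  have hqa : ContinuousAt q z := hq.continuousAt (hU.mem_nhds hz)
  have hFd := ((hF z hz).differentiableAt (hU.mem_nhds hz)).hasDerivAt
  refine HasDerivAt.differentiableAt (f' := _root_.deriv F z / (q z + q z)) ?_
  rw [hasDerivAt_iff_tendsto_slope] at hFd ⊢
  have hsum : Tendsto (fun w => q w + q z) (𝓝[≠] z) (𝓝 (q z + q z)) :=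
    (hqa.tendsto.mono_left nhdsWithin_le_nhds).add_const _
  have hne : q z + q z ≠ 0 := by
    rw [← two_mul]; exact mul_ne_zero two_ne_zero hq0
  refine (hFd.div hsum hne).congr' ?_
  have e1 : ∀ᶠ w in 𝓝[≠] z, w ∈ U := eventually_nhdsWithin_of_eventually_nhds (hU.mem_nhds hz)
  have e2 : ∀ᶠ w in 𝓝[≠] z, q w + q z ≠ 0 := hsum.eventually_ne hne
  filter_upwards [e1, e2] with w hw hw2
  change slope F z w / (q w + q z) = slope q z w
  rw [slope_def_field, slope_def_field, ← h w hw, ← h z hz, div_eq_iff hw2]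
  ring

open Metric ComplexConjugate in
theorem exists_biholomorphic_unitBall {U : Set ℂ} (hUo : IsOpen U) (hUc : IsSimplyConnected U)
    (hUb : Bornology.IsBounded U) :
    ∃ f φ : ℂ → ℂ, DifferentiableOn ℂ f (ball 0 1) ∧ DifferentiableOn ℂ φ U ∧
      MapsTo f (ball 0 1) U ∧ MapsTo φ U (ball 0 1) ∧ LeftInvOn f φ U ∧
      LeftInvOn φ f (ball 0 1) := by
  have hpc : IsPreconnected U := hUc.isPathConnected.isConnected.isPreconnected
  obtain ⟨u₀, hu₀⟩ := hUc.nonempty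
  obtain ⟨u₁, hu₁, hne⟩ : ∃ u₁ ∈ U, u₁ ≠ u₀ := by
    have : ∀ᶠ z in 𝓝[≠] u₀, z ∈ U ∧ z ≠ u₀ :=
      (eventually_nhdsWithin_of_eventually_nhds (hUo.mem_nhds hu₀)).and self_mem_nhdsWithin
    exact this.exists
  set 𝓕 : Set (ℂ → ℂ) := {F | DifferentiableOn ℂ F U ∧ MapsTo F U (ball 0 1) ∧ InjOn F U ∧
    F u₀ = 0} with h𝓕
  set S : Set ℝ := (fun F : ℂ → ℂ => ‖F u₁‖) '' 𝓕 with hS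
  have hSb : BddAbove S := by
    refine ⟨1, ?_⟩
    rintro _ ⟨F, hF, rfl⟩
    exact (mem_ball_zero_iff.1 (hF.2.1 hu₁)).le
  obtain ⟨F₀, hF₀⟩ : ∃ F, F ∈ 𝓕 := by
    obtain ⟨R, hR0, hR⟩ := hUb.subset_ball_lt 0 u₀
    refine ⟨fun z => (z - u₀) / R, ?_, ?_, ?_, ?_⟩
    · fun_prop
    · intro z hz
      have := mem_ball_iff_norm.1 (hR hz)
      rw [mem_ball_zero_iff, norm_div, Complex.norm_real, Real.norm_of_nonneg hR0.le,
        div_lt_one hR0]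
      exact this
    · intro z _ w _ hzw
      have : (R : ℂ) ≠ 0 := by exact_mod_cast hR0.ne'
      simpa [this] using hzw
    · simp
  have hSne : S.Nonempty := ⟨_, F₀, hF₀, rfl⟩
  have hspos : 0 < sSup S := by
    refine lt_of_lt_of_le ?_ (le_csSup hSb ⟨F₀, hF₀, rfl⟩)
    refine norm_pos_iff.2 fun h => hne ?_
    exact hF₀.2.2.1 hu₁ hu₀ (h.trans hF₀.2.2.2.symm)
  obtain ⟨s, -, hs, hsS⟩ := exists_seq_tendsto_sSup hSne hSb
  choose F hF hFs using hsS
  obtain ⟨g, hg⟩ := exists_tendstoLocallyUniformlyOn_of_mapsTo_ball hUo (fun n => (hF n).1)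
    (fun n => (hF n).2.1) (hyperfilter ℕ)
  have hgd : DifferentiableOn ℂ g U := hg.differentiableOn (Eventually.of_forall fun n => (hF n).1) hUo
  have hgu₀ : g u₀ = 0 := by
    refine tendsto_nhds_unique (hg.tendsto_at hu₀) ?_
    simp only [(hF _).2.2.2]; exact tendsto_const_nhds
  have hgu₁ : ‖g u₁‖ = sSup S := by
    refine tendsto_nhds_unique (hg.tendsto_at hu₁).norm ?_
    have := hs.mono_left (Nat.hyperfilter_le_atTop)
    exact this.congr fun n => (hFs n).symm
  have hgne : g u₀ ≠ g u₁ := by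
    intro h
    rw [← h, hgu₀, norm_zero] at hgu₁
    exact hspos.ne hgu₁
  have hginj : InjOn g U := TendstoLocallyUniformlyOn.injOn_of_injOn hUo hpc (fun n => (hF n).1)
    (fun n => (hF n).2.2.1) hg hu₀ hu₁ hgne
  have hopen : ∀ s ⊆ U, IsOpen s → IsOpen (g '' s) := by
    rcases (hgd.analyticOnNhd hUo).is_constant_or_isOpen hpc with ⟨w, hw⟩ | h
    · exact absurd ((hw _ hu₀).trans (hw _ hu₁).symm) hgne
    · exact h
  have hgm : MapsTo g U (ball 0 1) := by
    have h1 : g '' U ⊆ closedBall 0 1 := by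
      rintro _ ⟨z, hz, rfl⟩
      rw [mem_closedBall_zero_iff]
      exact le_of_tendsto (hg.tendsto_at hz).norm
        (Eventually.of_forall fun n => (mem_ball_zero_iff.1 ((hF n).2.1 hz)).le)
    have h2 := (hopen U subset_rfl hUo).subset_interior_iff.2 h1
    rw [interior_closedBall _ one_ne_zero] at h2
    exact fun z hz => h2 ⟨z, hz, rfl⟩
  have hsurj : SurjOn g U (ball 0 1) := by
    intro a ha
    by_contra hna
    rw [mem_ball_zero_iff] at ha
    have hgm' : ∀ z ∈ U, ‖g z‖ < 1 := fun z hz => mem_ball_zero_iff.1 (hgm hz)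
    set F₁ : ℂ → ℂ := fun z => (g z - a) / (1 - conj a * g z) with hF₁
    have hF₁d : DifferentiableOn ℂ F₁ U := by
      refine (hgd.sub_const a).div ((differentiableOn_const _).sub (hgd.const_mul _)) ?_
      exact fun z hz => one_sub_conj_mul_ne_zero ha (hgm' z hz)
    have hF₁0 : ∀ z ∈ U, F₁ z ≠ 0 := by
      intro z hz
      refine div_ne_zero (sub_ne_zero.2 fun h => hna ⟨z, hz, h⟩)
        (one_sub_conj_mul_ne_zero ha (hgm' z hz))
    obtain ⟨q, hqc, hq⟩ := Complex.exists_continuousOn_pow_eq hUc hUo hF₁d.continuousOn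
      (by rintro ⟨z, hz, h⟩; exact hF₁0 z hz h) two_ne_zero
    have hqd : DifferentiableOn ℂ q U :=
      DifferentiableOn.of_continuousOn_sq hUo hqc hF₁d (fun z _ => hq z) hF₁0
    have hq1 : ∀ z ∈ U, ‖q z‖ < 1 := by
      intro z hz
      have h1 := norm_mobius_lt_one ha (hgm' z hz)
      have h2 : ‖q z‖ ^ 2 < 1 := by rw [← norm_pow, hq z]; exact h1
      nlinarith [norm_nonneg (q z)]
    set c := q u₀ with hc
    have hc1 : ‖c‖ < 1 := hq1 u₀ hu₀
    have hca : c ^ 2 = -a := by rw [hc, hq, hF₁]; simp [hgu₀]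
    set G : ℂ → ℂ := fun z => (q z - c) / (1 - conj c * q z) with hG
    have hGmem : G ∈ 𝓕 := by
      refine ⟨?_, ?_, ?_, ?_⟩
      · refine (hqd.sub_const c).div ((differentiableOn_const _).sub (hqd.const_mul _)) ?_
        exact fun z hz => one_sub_conj_mul_ne_zero hc1 (hq1 z hz)
      · exact fun z hz => mem_ball_zero_iff.2 (norm_mobius_lt_one hc1 (hq1 z hz))
      · intro z hz w hw hzw
        have h1 : q z = q w := mobius_injective hc1 (hq1 z hz) (hq1 w hw) hzw
        have h2 : F₁ z = F₁ w := by rw [← hq, ← hq, h1]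
        exact hginj hz hw (mobius_injective ha (hgm' z hz) (hgm' w hw) h2)
      · simp [hG, hc]
    have hGpos : 0 < ‖G u₁‖ := norm_pos_iff.2 fun h => hne
      (hGmem.2.2.1 hu₁ hu₀ (h.trans hGmem.2.2.2.symm))
    have hle : ‖G u₁‖ ≤ sSup S := le_csSup hSb ⟨G, hGmem, rfl⟩
    have hp1 := one_sub_conj_mul_ne_zero hc1 (hq1 u₁ hu₁)
    have hp2 : 1 + conj c * q u₁ ≠ 0 := by
      have := one_sub_conj_mul_ne_zero (a := -c) (by simpa using hc1) (hq1 u₁ hu₁)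
      simpa using this
    have hfac : g u₁ = G u₁ * ((q u₁ + c) / (1 + conj c * q u₁)) := by
      have h3 := one_sub_conj_mul_ne_zero ha (hgm' u₁ hu₁)
      have h4 : q u₁ ^ 2 * (1 - conj a * g u₁) = g u₁ - a := by
        rw [hq]; exact div_mul_cancel₀ _ h3
      have ha' : a = -c ^ 2 := by rw [hca]; ring
      rw [ha'] at h4
      simp only [map_neg, map_pow] at h4
      simp only [hG]
      rw [div_mul_div_comm, eq_div_iff (mul_ne_zero hp1 hp2)]
      linear_combination -h4
    have hlt : ‖(q u₁ + c) / (1 + conj c * q u₁)‖ < 1 := by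
      have := norm_mobius_lt_one (a := -c) (by simpa using hc1) (hq1 u₁ hu₁)
      simpa using this
    have : ‖g u₁‖ < ‖G u₁‖ := by
      rw [hfac, norm_mul]
      exact mul_lt_of_lt_one_right hGpos hlt
    linarith
  -- the inverse
  set f := Function.invFunOn g U with hf
  have hleft : LeftInvOn f g U := hginj.leftInvOn_invFunOn
  have hright : RightInvOn f g (ball 0 1) := hsurj.rightInvOn_invFunOn
  have hfm : MapsTo f (ball 0 1) U := hsurj.mapsTo_invFunOn
  have hfc : ContinuousOn f (ball 0 1) := by
    intro w hw
    refine ContinuousAt.continuousWithinAt ?_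
    rw [ContinuousAt, tendsto_def]
    intro V hV
    obtain ⟨W, hWV, hWo, hfW⟩ := _root_.mem_nhds_iff.1 hV
    refine mem_of_superset ((hopen (W ∩ U) inter_subset_right (hWo.inter hUo)).mem_nhds
      ⟨f w, ⟨hfW, hfm hw⟩, hright hw⟩) ?_
    rintro _ ⟨z, ⟨hzW, hzU⟩, rfl⟩
    rw [mem_preimage, hleft hzU]
    exact hWV hzW
  have hder : ∀ w ∈ ball (0 : ℂ) 1, deriv g (f w) ≠ 0 → DifferentiableAt ℂ f w := by
    intro w hw hd
    have h1 := ((hgd _ (hfm hw)).differentiableAt (hUo.mem_nhds (hfm hw))).hasDerivAt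
    refine (HasDerivAt.of_local_left_inverse (hfc.continuousAt (isOpen_ball.mem_nhds hw)) h1 hd
      ?_).differentiableAt
    filter_upwards [isOpen_ball.mem_nhds hw] with y hy using hright hy
  refine ⟨f, g, ?_, hgd, hfm, hgm, hleft, hright⟩
  intro w hw
  refine DifferentiableAt.differentiableWithinAt ?_
  have hda : AnalyticAt ℂ (deriv g) (f w) := (hgd.analyticOnNhd hUo).deriv _ (hfm hw)
  have hev : ∀ᶠ z in 𝓝[≠] (f w), deriv g z ≠ 0 := by
    rcases hda.eventually_eq_zero_or_eventually_ne_zero with h | h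
    · exfalso
      have h0 := (hgd.analyticOnNhd hUo).deriv.eqOn_zero_of_preconnected_of_eventuallyEq_zero hpc
        (hfm hw) h
      have := hUo.is_const_of_deriv_eq_zero hpc hgd h0 hu₀ hu₁
      exact hgne this
    · exact h
  have hfw : Tendsto f (𝓝[≠] w) (𝓝[≠] (f w)) := by
    refine tendsto_nhdsWithin_iff.2 ⟨((hfc.continuousAt (isOpen_ball.mem_nhds hw)).tendsto).mono_left
      nhdsWithin_le_nhds, ?_⟩
    filter_upwards [self_mem_nhdsWithin, mem_nhdsWithin_of_mem_nhds (isOpen_ball.mem_nhds hw)]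
      with z hz hzb h
    exact hz (by rw [← hright hzb, h, hright hw]; rfl)
  have hev2 : ∀ᶠ z in 𝓝[≠] w, DifferentiableAt ℂ f z := by
    filter_upwards [hfw.eventually hev, mem_nhdsWithin_of_mem_nhds (isOpen_ball.mem_nhds hw)]
      with z h1 h2 using hder z h2 h1
  exact (Complex.analyticAt_of_differentiable_on_punctured_nhds_of_continuousAt hev2
    (hfc.continuousAt (isOpen_ball.mem_nhds hw))).differentiableAt

open MeasureTheory Metric in
lemma lintegral_enorm_deriv_sq_lt_top {f : ℂ → ℂ} {M : ℝ} {V : Set ℂ} (hV : IsOpen V)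
    (hf : DifferentiableOn ℂ f V) (hinj : InjOn f V) (hM : ∀ z ∈ V, ‖f z‖ ≤ M) :
    ∫⁻ z in V, ‖deriv f z‖ₑ ^ 2 < ⊤ := by
  have hd : ∀ z ∈ V, HasFDerivWithinAt f ((fderiv ℂ f z).restrictScalars ℝ) V z := fun z hz =>
    ((hf.differentiableAt (hV.mem_nhds hz)).hasFDerivAt.restrictScalars ℝ).hasFDerivWithinAt
  have h := lintegral_abs_det_fderiv_eq_addHaar_image volume hV.measurableSet hd hinj
  have heq : ∀ z, ENNReal.ofReal |((fderiv ℂ f z).restrictScalars ℝ).det| = ‖deriv f z‖ₑ ^ 2 := by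
    intro z
    have h1 : ((fderiv ℂ f z).restrictScalars ℝ).det = ‖deriv f z‖ ^ 2 := by
      simp [ContinuousLinearMap.det, LinearMap.det_restrictScalars,
        Algebra.norm_complex_eq, Complex.normSq_eq_norm_sq]
    rw [h1, abs_of_nonneg (by positivity), ENNReal.ofReal_pow (norm_nonneg _), ofReal_norm]
  simp_rw [heq] at h
  rw [h]
  refine lt_of_le_of_lt (measure_mono (t := closedBall 0 M) ?_) measure_closedBall_lt_top
  rintro _ ⟨z, hz, rfl⟩
  simpa using hM z hz

open MeasureTheory Metric in
/-- The Dirichlet integral over the unit disc in polar coordinates around `0`. -/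
lemma lintegral_polar_lt_top {F : ℂ → ENNReal}
    (hF : ∫⁻ z in ball (0 : ℂ) 1, F z < ⊤) :
    ∫⁻ p in Ioo (0:ℝ) 1 ×ˢ Ioo (-Real.pi) Real.pi,
      ENNReal.ofReal p.1 * F (p.1 * Complex.exp (p.2 * Complex.I)) < ⊤ := by
  have h := Complex.lintegral_comp_polarCoord_symm ((ball (0:ℂ) 1).indicator F)
  rw [lintegral_indicator measurableSet_ball] at h
  refine lt_of_le_of_lt ?_ (h ▸ hF)
  refine (lintegral_mono_ae ?_).trans (lintegral_mono_set (s := Ioo (0:ℝ) 1 ×ˢ Ioo (-Real.pi) Real.pi) ?_)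
  · refine (ae_restrict_iff' (measurableSet_Ioo.prod measurableSet_Ioo)).2 (Eventually.of_forall ?_)
    rintro ⟨r, t⟩ ⟨hr, ht⟩
    simp only [Complex.polarCoord_symm_apply, smul_eq_mul]
    have : (r:ℂ) * (Real.cos t + Real.sin t * Complex.I) = r * Complex.exp (t * Complex.I) := by
      rw [Complex.exp_mul_I]; simp
    rw [this, indicator_of_mem]
    simp [Complex.norm_exp_ofReal_mul_I, abs_of_pos hr.1, hr.2]
  · rintro ⟨r, t⟩ ⟨hr, ht⟩
    exact ⟨hr.1, ht⟩

open MeasureTheory Metric in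
lemma enorm_sub_le_lintegral_radial {f : ℂ → ℂ} (hf : DifferentiableOn ℂ f (ball 0 1))
    {c : ℂ} (hc : ‖c‖ = 1) {a b : ℝ} (ha : 0 ≤ a) (hab : a ≤ b) (hb : b < 1) :
    ‖f (b * c) - f (a * c)‖ₑ ≤ ∫⁻ r in Ioo a 1, ‖deriv f (r * c)‖ₑ := by
  have hm : ∀ r ∈ Icc a b, (r : ℂ) * c ∈ ball (0:ℂ) 1 := by
    intro r hr
    simp [hc, abs_of_nonneg (ha.trans hr.1)]
    linarith [hr.2]
  have hdr : ∀ r ∈ Icc a b, HasDerivAt (fun r : ℝ => f (r * c)) (deriv f (r * c) * c) r := by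
    intro r hr
    have h1 := (hf.differentiableAt (isOpen_ball.mem_nhds (hm r hr))).hasDerivAt
    have h2 : HasDerivAt (fun r : ℝ => (r : ℂ) * c) c r := by
      simpa using (Complex.ofRealCLM.hasDerivAt (x := r)).mul_const c
    exact h1.comp r h2
  have hcd : ContDiffOn ℝ 1 (fun r : ℝ => f (r * c)) (Icc a b) := by
    have h1 : ContDiffOn ℂ 1 f (ball 0 1) := hf.contDiffOn isOpen_ball
    have h2 : ContDiffOn ℝ 1 f (ball 0 1) := h1.restrict_scalars ℝ
    refine h2.comp (s := Icc a b) (f := fun r : ℝ => (r : ℂ) * c) ?_ hm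
    exact (Complex.ofRealCLM.contDiff.mul contDiff_const).contDiffOn
  refine (enorm_sub_le_lintegral_deriv_of_contDiffOn_Icc hcd hab).trans ?_
  refine le_trans (le_of_eq ?_) (lintegral_mono_set (s := Ioc a b) (fun r hr => ⟨hr.1, hr.2.trans_lt hb⟩))
  rw [restrict_Ioc_eq_restrict_Icc]
  refine lintegral_congr_ae ((ae_restrict_iff' measurableSet_Icc).2 (Eventually.of_forall ?_))
  intro r hr
  simp only
  rw [(hdr r hr).deriv, enorm_mul, ← ofReal_norm c, hc]
  simp

open MeasureTheory Metric in
lemma tendsto_lintegral_sector_zero {f : ℂ → ℂ}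
    (hA : ∫⁻ z in ball (0 : ℂ) 1, ‖deriv f z‖ₑ ^ 2 < ⊤) {β : ℝ} (hβ : β ≤ Real.pi) :
    Tendsto (fun ρ : ℝ => ∫⁻ θ in Ioo (-β) β, ∫⁻ r in Ioo ρ 1,
      ‖deriv f (r * Complex.exp (θ * Complex.I))‖ₑ) (𝓝[<] 1) (𝓝 0) := by
  set E : ℝ × ℝ → ENNReal := fun p => ‖deriv f (p.1 * Complex.exp (p.2 * Complex.I))‖ₑ with hE
  have hEm : Measurable E := by
    refine ((measurable_deriv f).comp ?_).enorm
    exact Continuous.measurable (by fun_prop)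
  set A : Set (ℝ × ℝ) := Ioo (1/2:ℝ) 1 ×ˢ Ioo (-Real.pi) Real.pi with hAdef
  have hAm : MeasurableSet A := measurableSet_Ioo.prod measurableSet_Ioo
  have hvA : volume A < ⊤ := by
    rw [hAdef, Measure.volume_eq_prod, Measure.prod_prod]
    exact ENNReal.mul_lt_top (by simp) (by simp)
  have hfin : ∫⁻ p in A, E p ≠ ⊤ := by
    refine ne_of_lt (lt_of_le_of_lt (b := ∫⁻ p in A, (1 + 2 * (ENNReal.ofReal p.1 * E p ^ 2))) ?_ ?_)
    · refine lintegral_mono_ae ((ae_restrict_iff' hAm).2 (Eventually.of_forall ?_))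
      rintro ⟨r, t⟩ ⟨hr, ht⟩
      have h1 : (1:ENNReal) ≤ 2 * ENNReal.ofReal r := by
        rw [show (2:ENNReal) = ENNReal.ofReal 2 by simp, ← ENNReal.ofReal_mul (by norm_num)]
        rw [← ENNReal.ofReal_one]
        exact ENNReal.ofReal_le_ofReal (by linarith [hr.1])
      have h2 : ∀ x : ENNReal, x ≤ 1 + x ^ 2 := by
        intro x
        rcases le_total x 1 with h | h
        · exact h.trans le_self_add
        · calc x = x * 1 := by simp
            _ ≤ x * x := by gcongr
            _ = x ^ 2 := (sq x).symm
            _ ≤ _ := le_add_self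
      refine (h2 _).trans ?_
      gcongr
      rw [← mul_assoc]
      exact le_mul_of_one_le_left (by simp) h1
    · rw [lintegral_add_left measurable_const, lintegral_const_mul' _ _ (by simp)]
      refine ENNReal.add_lt_top.2 ⟨by simpa using hvA, ENNReal.mul_lt_top (by simp) ?_⟩
      refine lt_of_le_of_lt (lintegral_mono_set ?_) (lintegral_polar_lt_top hA)
      rintro ⟨r, t⟩ ⟨hr, ht⟩
      exact ⟨⟨by linarith [hr.1], hr.2⟩, ht⟩
  have hlim : Tendsto ((volume.restrict A) ∘ fun ρ : ℝ => Ioo ρ 1 ×ˢ Ioo (-β) β) (𝓝[<] 1) (𝓝 0) := by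
    have h0 : Tendsto (fun ρ : ℝ => ENNReal.ofReal (1 - ρ) * ENNReal.ofReal (β - -β)) (𝓝[<] 1) (𝓝 0) := by
      have : Tendsto (fun ρ : ℝ => ENNReal.ofReal ((1 - ρ) * (max (β - -β) 0))) (𝓝[<] 1) (𝓝 0) := by
        have : Continuous (fun ρ : ℝ => ENNReal.ofReal ((1 - ρ) * (max (β - -β) 0))) :=
          ENNReal.continuous_ofReal.comp (by fun_prop)
        have := this.tendsto 1
        simp only [sub_self, zero_mul, ENNReal.ofReal_zero] at this
        exact this.mono_left nhdsWithin_le_nhds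
      refine this.congr (fun ρ => ?_)
      rw [ENNReal.ofReal_mul' (by simp)]
      simp
    refine tendsto_of_tendsto_of_tendsto_of_le_of_le tendsto_const_nhds h0 (fun _ => bot_le) ?_
    intro ρ
    refine (Measure.restrict_apply_le _ _).trans ?_
    rw [Measure.volume_eq_prod, Measure.prod_prod]
    simp
  have hT := tendsto_setLIntegral_zero hfin hlim
  refine hT.congr' ?_
  filter_upwards [Ioo_mem_nhdsLT (show (1/2:ℝ) < 1 by norm_num)] with ρ hρ
  have hsub : Ioo ρ 1 ×ˢ Ioo (-β) β ⊆ A := by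
    rintro ⟨r, t⟩ ⟨hr, ht⟩
    exact ⟨⟨by linarith [hr.1, hρ.1], hr.2⟩, ⟨by linarith [ht.1], by linarith [ht.2]⟩⟩
  rw [Measure.restrict_restrict (measurableSet_Ioo.prod measurableSet_Ioo),
    inter_eq_left.2 hsub, Measure.volume_eq_prod, ← Measure.prod_restrict,
    lintegral_prod_symm _ hEm.aemeasurable]

open MeasureTheory Metric in
/-- A bounded univalent function on the disc cannot have a constant radial cluster value on an arc
of the circle, unless it takes that value. -/
lemma exists_eq_of_radial_cluster {f : ℂ → ℂ} {M : ℝ} (hf : DifferentiableOn ℂ f (ball 0 1))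
    (hM : ∀ z ∈ ball (0 : ℂ) 1, ‖f z‖ ≤ M)
    (hA : ∫⁻ z in ball (0 : ℂ) 1, ‖deriv f z‖ₑ ^ 2 < ⊤) {p : ℂ} {β : ℝ} (hβ : 0 < β)
    (hp : ∀ θ ∈ Ioo (-β) β, ∀ ε > 0, ∀ R < 1, ∃ r : ℝ, R < r ∧ r < 1 ∧
      ‖f (r * Complex.exp (θ * Complex.I)) - p‖ < ε) : f 0 = p := by
  obtain ⟨N, hN⟩ := exists_nat_gt (Real.pi / β)
  have hNpos : (0:ℝ) < N := lt_trans (by positivity) hN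
  have hN0 : N ≠ 0 := by rintro rfl; simp at hNpos
  set b : ℝ := Real.pi / N with hb
  have hb0 : 0 < b := by positivity
  have hbβ : b < β := by
    rw [hb, div_lt_iff₀ hNpos]; rw [div_lt_iff₀ hβ] at hN; linarith
  have hbpi : b ≤ Real.pi := by
    rw [hb]; exact div_le_self Real.pi_pos.le (by exact_mod_cast Nat.one_le_iff_ne_zero.2 hN0)
  have hball : ∀ (r θ : ℝ), 0 ≤ r → r < 1 → (r : ℂ) * Complex.exp (θ * Complex.I) ∈ ball (0:ℂ) 1 := by
    intro r θ h0 h1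
    simp [Complex.norm_exp_ofReal_mul_I, abs_of_nonneg h0, h1]
  -- radial estimate
  have hrad : ∀ θ ∈ Ioo (-b) b, ∀ ρ : ℝ, 0 ≤ ρ → ρ < 1 →
      ‖f (ρ * Complex.exp (θ * Complex.I)) - p‖ₑ ≤
        ∫⁻ r in Ioo ρ 1, ‖deriv f (r * Complex.exp (θ * Complex.I))‖ₑ := by
    intro θ hθ ρ h0 h1
    refine ENNReal.le_of_forall_pos_le_add (fun ε hε _ => ?_)
    obtain ⟨r, hr1, hr2, hr3⟩ := hp θ ⟨by linarith [hθ.1], by linarith [hθ.2]⟩ ε (by exact_mod_cast hε) ρ h1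
    have h2 := enorm_sub_le_lintegral_radial hf (Complex.norm_exp_ofReal_mul_I θ) h0 hr1.le hr2
    set c := Complex.exp (θ * Complex.I)
    calc ‖f (ρ * c) - p‖ₑ = ‖-(f (r * c) - f (ρ * c)) + (f (r * c) - p)‖ₑ := by congr 1; ring
      _ ≤ ‖-(f (r * c) - f (ρ * c))‖ₑ + ‖f (r * c) - p‖ₑ := enorm_add_le _ _
      _ ≤ _ := by
        rw [enorm_neg]
        gcongr
        rw [← ofReal_norm, ← ENNReal.ofReal_coe_nnreal]
        exact ENNReal.ofReal_le_ofReal hr3.le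
  set w : ℕ → ℂ := fun j => Complex.exp ((2 * Real.pi * j / N : ℝ) * Complex.I) with hw
  set G : ℂ → ℂ := fun z => ∏ j ∈ Finset.range N, (f (w j * z) - p) with hG
  have hwn : ∀ j, ‖w j‖ = 1 := fun j => Complex.norm_exp_ofReal_mul_I _
  have hwball : ∀ j, ∀ z ∈ ball (0:ℂ) 1, w j * z ∈ ball (0:ℂ) 1 := by
    intro j z hz; simpa [hwn] using hz
  have hGd : DifferentiableOn ℂ G (ball 0 1) := by
    refine DifferentiableOn.fun_finsetProd (fun j _ => ?_)
    refine DifferentiableOn.sub_const ?_ _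
    exact hf.comp (by fun_prop) (hwball j)
  have hG0 : G 0 = (f 0 - p) ^ N := by simp [hG]
  have hM' : ∀ z ∈ ball (0:ℂ) 1, ‖f z - p‖ ≤ M + ‖p‖ := fun z hz =>
    (norm_sub_le _ _).trans (by gcongr; exact hM z hz)
  have hMp : 0 ≤ M + ‖p‖ := (norm_nonneg _).trans (hM' 0 (by simp))
  set C : ℝ := (M + ‖p‖) ^ (N - 1) with hC
  have hC0 : 0 ≤ C := by positivity
  have hGb : ∀ z ∈ ball (0:ℂ) 1, ‖G z‖ ≤ C * ‖f z - p‖ := by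
    intro z hz
    obtain ⟨n, rfl⟩ : ∃ n, N = n + 1 := ⟨N - 1, by omega⟩
    simp only [hG, hC, norm_prod, Nat.add_sub_cancel]
    rw [Finset.prod_range_succ']
    have : w 0 = 1 := by simp [hw]
    rw [this, one_mul]
    gcongr
    refine (Finset.prod_le_prod (g := fun _ => M + ‖p‖) (fun _ _ => norm_nonneg _)
      (fun j _ => hM' _ (hwball _ z hz))).trans (by simp)
  have hper : ∀ z, G (w 1 * z) = G z := by
    intro z
    have hwadd : ∀ j, w j * (w 1 * z) = w (j + 1) * z := by
      intro j
      simp only [hw]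
      rw [← mul_assoc, ← Complex.exp_add]
      congr 2
      push_cast
      ring
    simp only [hG, hwadd]
    obtain ⟨n, hn⟩ : ∃ n, N = n + 1 := ⟨N - 1, by omega⟩
    have e1 : w N = w 0 := by
      have hNc : (N:ℂ) ≠ 0 := by exact_mod_cast hN0
      simp only [hw]
      rw [show ((2 * Real.pi * (N:ℕ) / N : ℝ) : ℂ) * Complex.I = 2 * Real.pi * Complex.I by
        push_cast; field_simp]
      simp
    rw [hn, Finset.prod_range_succ (n := n), ← hn, e1, hn, Finset.prod_range_succ' _ n]
  -- mean value
  have key : ∀ ρ : ℝ, 0 < ρ → ρ < 1 → ENNReal.ofReal (2 * Real.pi * ‖G 0‖) ≤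
      N * (ENNReal.ofReal C * ∫⁻ θ in Ioo (-b) b, ∫⁻ r in Ioo ρ 1,
        ‖deriv f (r * Complex.exp (θ * Complex.I))‖ₑ) := by
    intro ρ h0 h1
    have hcl : DiffContOnCl ℂ G (ball 0 |ρ|) := by
      rw [abs_of_pos h0]
      exact (hGd.mono (closedBall_subset_ball h1)).diffContOnCl_ball subset_rfl
    have hav := hcl.circleAverage
    rw [Real.circleAverage_def] at hav
    set g : ℝ → ℂ := fun θ => G (circleMap 0 ρ θ) with hg
    have hgp : Function.Periodic g (2 * b) := by
      intro θ
      simp only [hg, circleMap_zero]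
      rw [← hper (ρ * Complex.exp (θ * Complex.I))]
      congr 1
      simp only [hw, hb]
      rw [mul_left_comm, ← Complex.exp_add]
      congr 2
      push_cast
      ring
    have h_int : ∫ θ in (0:ℝ)..2 * Real.pi, g θ = N * ∫ θ in (-b)..b, g θ := by
      have hgc : Continuous g := by
        refine hGd.continuousOn.comp_continuous (continuous_circleMap 0 ρ) (fun θ => ?_)
        rw [circleMap_zero]
        exact hball ρ θ h0.le h1
      have e1 := hgp.intervalIntegral_add_zsmul_eq N 0 (fun _ _ => hgc.intervalIntegrable _ _)
      have e2 : (N:ℤ) • (2 * b) = 2 * Real.pi := by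
        simp [hb]; field_simp
      rw [e2] at e1
      have e3 := hgp.intervalIntegral_add_eq 0 (-b)
      rw [zero_add] at e3
      rw [zero_add, zero_add] at e1
      rw [e1, e3, show -b + 2 * b = b by ring]
      simp
    have hn : 2 * Real.pi * ‖G 0‖ = N * ‖∫ θ in (-b)..b, g θ‖ := by
      rw [← hav, h_int, norm_smul, norm_mul]
      simp only [norm_inv, Real.norm_eq_abs, abs_of_pos Real.two_pi_pos, Complex.norm_natCast]
      field_simp
    rw [hn, ENNReal.ofReal_mul (by positivity), ENNReal.ofReal_natCast]
    gcongr
    rw [ofReal_norm, intervalIntegral.integral_of_le (by linarith), integral_Ioc_eq_integral_Ioo]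
    refine (enorm_integral_le_lintegral_enorm _).trans ?_
    rw [← lintegral_const_mul' _ _ (by simp)]
    refine lintegral_mono_ae ((ae_restrict_iff' measurableSet_Ioo).2 (Eventually.of_forall ?_))
    intro θ hθ
    have h2 := hGb _ (hball ρ θ h0.le h1)
    have h3 := hrad θ hθ ρ h0.le h1
    simp only [hg, circleMap_zero]
    refine le_trans ?_ (mul_le_mul_right h3 _)
    rw [← ofReal_norm, ← ofReal_norm, ← ENNReal.ofReal_mul hC0]
    exact ENNReal.ofReal_le_ofReal h2
  have hlim := tendsto_lintegral_sector_zero hA hbpi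
  have hlim2 : Tendsto (fun ρ : ℝ => N * (ENNReal.ofReal C * ∫⁻ θ in Ioo (-b) b, ∫⁻ r in Ioo ρ 1,
        ‖deriv f (r * Complex.exp (θ * Complex.I))‖ₑ)) (𝓝[<] 1) (𝓝 0) := by
    have := ENNReal.Tendsto.const_mul (a := (N:ENNReal))
      (ENNReal.Tendsto.const_mul (a := ENNReal.ofReal C) hlim (Or.inr (by simp))) (Or.inr (by simp))
    simpa using this
  have hle : ENNReal.ofReal (2 * Real.pi * ‖G 0‖) ≤ 0 := by
    refine ge_of_tendsto hlim2 ?_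
    filter_upwards [Ioo_mem_nhdsLT (show (0:ℝ) < 1 by norm_num)] with ρ hρ
    exact key ρ hρ.1 hρ.2
  have h4 : 2 * Real.pi * ‖G 0‖ ≤ 0 := by simpa using hle
  have h5 : ‖G 0‖ = 0 := le_antisymm (by nlinarith [Real.pi_pos, norm_nonneg (G 0)]) (norm_nonneg _)
  rw [norm_eq_zero, hG0, pow_eq_zero_iff hN0, sub_eq_zero] at h5
  exact h5

lemma Complex.arg_ofReal_mul_exp {r θ : ℝ} (hr : 0 < r) (hθ : θ ∈ Ioc (-Real.pi) Real.pi) :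
    Complex.arg (r * Complex.exp (θ * Complex.I)) = θ := by
  rw [Complex.exp_mul_I, ← Complex.ofReal_cos, ← Complex.ofReal_sin]
  exact_mod_cast Complex.arg_mul_cos_add_sin_mul_I hr hθ

/-- A connected set avoiding the origin and joining two directions meets all rays of one of the
two complementary sectors. -/
lemma IsPreconnected.meets_rays {S : Set ℂ} (hS : IsPreconnected S) (h0 : (0:ℂ) ∉ S) {c : ℂ}
    (hc : c ≠ 0) {α : ℝ} (hα : α ≤ Real.pi / 2) {u v : ℂ} (hu : u ∈ S) (hv : v ∈ S)
    (hu' : Complex.arg (u / c) ∈ Ioo (-(3 * Real.pi / 4)) (-(α / 2)))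
    (hv' : Complex.arg (v / c) ∈ Ioo (α / 2) (3 * Real.pi / 4)) :
    (∀ θ ∈ Ioo (-(α / 2)) (α / 2), ∃ r : ℝ, 0 < r ∧ r * (c * Complex.exp (θ * Complex.I)) ∈ S) ∨
    (∀ θ ∈ Ioo (-(α / 2)) (α / 2), ∃ r : ℝ, 0 < r ∧ r * (-c * Complex.exp (θ * Complex.I)) ∈ S) := by
  by_contra hcon
  push Not at hcon
  obtain ⟨⟨θ₁, h₁, h₁'⟩, θ₂, h₂, h₂'⟩ := hcon
  have hpi := Real.pi_pos
  set e := Complex.exp (θ₂ * Complex.I) with he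
  have he0 : e ≠ 0 := Complex.exp_ne_zero _
  have hne : ∀ ζ ∈ S, ζ ≠ 0 := fun ζ hζ h => h0 (h ▸ hζ)
  have hform : ∀ ζ ∈ S, ζ = ‖ζ / (c * e)‖ * (c * e * Complex.exp (Complex.arg (ζ / (c * e)) * Complex.I)) := by
    intro ζ hζ
    have := Complex.norm_mul_exp_arg_mul_I (ζ / (c * e))
    calc ζ = (c * e) * (ζ / (c * e)) := by field_simp
      _ = (c * e) * (‖ζ / (c * e)‖ * Complex.exp (Complex.arg (ζ / (c * e)) * Complex.I)) := by rw [this]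
      _ = _ := by ring
  have hslit : ∀ ζ ∈ S, ζ / (c * e) ∈ Complex.slitPlane := by
    intro ζ hζ
    rw [Complex.mem_slitPlane_iff_arg]
    refine ⟨fun harg => ?_, div_ne_zero (hne ζ hζ) (mul_ne_zero hc he0)⟩
    refine h₂' ‖ζ / (c * e)‖ (norm_pos_iff.2 (div_ne_zero (hne ζ hζ) (mul_ne_zero hc he0))) ?_
    have h := hform ζ hζ
    rw [harg, Complex.exp_pi_mul_I] at h
    have h' : (‖ζ / (c * e)‖ : ℂ) * (-c * e) = ζ := by
      conv_rhs => rw [h]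
      ring
    rwa [h']
  have hcont : ContinuousOn (fun ζ : ℂ => Complex.arg (ζ / (c * e))) S := by
    intro ζ hζ
    have h1 : ContinuousAt (fun ζ : ℂ => ζ / (c * e)) ζ := by fun_prop
    exact (ContinuousAt.comp (f := fun ζ : ℂ => ζ / (c * e)) (g := Complex.arg)
      (Complex.continuousAt_arg (hslit ζ hζ)) h1).continuousWithinAt
  have hval : ∀ ζ ∈ S, ∀ s, Complex.arg (ζ / c) = s → s ∈ Ioo (-(3 * Real.pi / 4)) (3 * Real.pi / 4) →
      Complex.arg (ζ / (c * e)) = s - θ₂ := by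
    intro ζ hζ s hs hs'
    have h1 := Complex.norm_mul_exp_arg_mul_I (ζ / c)
    rw [hs] at h1
    have h2 : ζ / (c * e) = ‖ζ / c‖ * Complex.exp ((s - θ₂ : ℝ) * Complex.I) := by
      rw [← div_div, ← h1, he, Complex.ofReal_sub, sub_mul, Complex.exp_sub]
      simp [mul_div_assoc]
    rw [h2, Complex.arg_ofReal_mul_exp (norm_pos_iff.2 (div_ne_zero (hne ζ hζ) hc))]
    constructor <;> linarith [hs'.1, hs'.2, h₂.1, h₂.2]
  have hpc := (hS.image _ hcont).ordConnected
  have hu1 := hval u hu _ rfl ⟨hu'.1, by linarith [hu'.2, h₁.1, h₁.2]⟩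
  have hv1 := hval v hv _ rfl ⟨by linarith [hv'.1, h₁.1, h₁.2], hv'.2⟩
  have hmem := hpc.out (mem_image_of_mem _ hu) (mem_image_of_mem _ hv)
    (show θ₁ - θ₂ ∈ Icc _ _ by
      simp only [hu1, hv1]
      constructor <;> linarith [hu'.2, hv'.1, h₁.1, h₁.2])
  obtain ⟨ζ, hζ, hζ'⟩ := hmem
  simp only at hζ'
  refine h₁' ‖ζ / (c * e)‖ (norm_pos_iff.2 (div_ne_zero (hne ζ hζ) (mul_ne_zero hc he0))) ?_
  have h := hform ζ hζ
  rw [hζ'] at h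
  convert hζ using 1
  conv_rhs => rw [h]
  rw [he, mul_assoc c (Complex.exp _) (Complex.exp _), ← Complex.exp_add]
  push_cast
  ring_nf

open Metric in
/-- A conformal model `f` of the topological disc `g '' ball 0 1`, with `k` the homeomorphism of the
unit disc such that `f ∘ k = g`. -/
structure IsConformalModel (g : ℂ ≃ₜ ℂ) (f k : ℂ → ℂ) : Prop where
  differentiableOn : DifferentiableOn ℂ f (ball 0 1)
  continuousOn : ContinuousOn k (ball 0 1)
  mapsTo : MapsTo k (ball 0 1) (ball 0 1)
  surjOn : SurjOn k (ball 0 1) (ball 0 1)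
  comp_eq : ∀ z ∈ ball (0:ℂ) 1, f (k z) = g z

namespace IsConformalModel

open Metric

variable {g : ℂ ≃ₜ ℂ} {f k : ℂ → ℂ}

lemma injOn (h : IsConformalModel g f k) : InjOn f (ball 0 1) := by
  intro w hw w' hw' hww
  obtain ⟨z, hz, rfl⟩ := h.surjOn hw
  obtain ⟨z', hz', rfl⟩ := h.surjOn hw'
  rw [h.comp_eq z hz, h.comp_eq z' hz'] at hww
  rw [g.injective hww]

lemma injOn_right (h : IsConformalModel g f k) : InjOn k (ball 0 1) := by
  intro z hz z' hz' hzz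
  apply g.injective
  rw [← h.comp_eq z hz, ← h.comp_eq z' hz', hzz]

lemma exists_bound (h : IsConformalModel g f k) : ∃ M : ℝ, ∀ z ∈ ball (0:ℂ) 1, ‖f z‖ ≤ M := by
  obtain ⟨M, hM⟩ := ((isCompact_closedBall (0:ℂ) 1).image g.continuous).isBounded.exists_norm_le
  refine ⟨M, fun w hw => ?_⟩
  obtain ⟨z, hz, rfl⟩ := h.surjOn hw
  rw [h.comp_eq z hz]
  exact hM _ (mem_image_of_mem _ (ball_subset_closedBall hz))

lemma exists_lt_norm (h : IsConformalModel g f k) {R : ℝ} (hR : R < 1) :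
    ∃ r < 1, ∀ z ∈ ball (0:ℂ) 1, r < ‖z‖ → R < ‖k z‖ := by
  have hsub : closedBall (0:ℂ) R ⊆ ball 0 1 := closedBall_subset_ball hR
  have hK : IsCompact (g.symm '' (f '' closedBall 0 R)) :=
    ((isCompact_closedBall (0:ℂ) R).image_of_continuousOn
      (h.differentiableOn.continuousOn.mono hsub)).image g.symm.continuous
  have hKs : g.symm '' (f '' closedBall 0 R) ⊆ ball 0 1 := by
    rintro _ ⟨_, ⟨w, hw, rfl⟩, rfl⟩
    obtain ⟨z, hz, rfl⟩ := h.surjOn (hsub hw)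
    rw [h.comp_eq z hz]
    simpa using hz
  obtain ⟨r, hr, hr'⟩ : ∃ r < 1, ∀ z ∈ g.symm '' (f '' closedBall 0 R), ‖z‖ ≤ r := by
    rcases (g.symm '' (f '' closedBall 0 R)).eq_empty_or_nonempty with he | hne
    · exact ⟨0, one_pos, by simp [he]⟩
    · obtain ⟨z, hz, hmax⟩ := hK.exists_isMaxOn hne continuous_norm.continuousOn
      exact ⟨‖z‖, by simpa using hKs hz, fun w hw => hmax hw⟩
  refine ⟨r, hr, fun z hz hzr => ?_⟩
  by_contra! hcon
  refine absurd (hr' z ⟨f (k z), ⟨k z, by simpa using hcon, rfl⟩, ?_⟩) (not_le.2 hzr)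
  rw [h.comp_eq z hz]; simp

lemma lintegral_lt_top (h : IsConformalModel g f k) {c : ℂ} (hc : ‖c‖ = 1) :
    ∫⁻ z in ball (0 : ℂ) 1, ‖deriv (fun z => f (c * z)) z‖ₑ ^ 2 < ⊤ := by
  obtain ⟨M, hM⟩ := h.exists_bound
  have hb : ∀ z ∈ ball (0:ℂ) 1, c * z ∈ ball (0:ℂ) 1 := fun z hz => by simpa [hc] using hz
  have hc0 : c ≠ 0 := by rintro rfl; simp at hc
  refine lintegral_enorm_deriv_sq_lt_top (M := M) isOpen_ball ?_ ?_ (fun z hz => hM _ (hb z hz))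
  · exact h.differentiableOn.comp (by fun_prop) hb
  · intro z hz z' hz' hzz
    exact mul_left_cancel₀ hc0 (h.injOn (hb z hz) (hb z' hz') hzz)

lemma tendsto_norm (h : IsConformalModel g f k) {ω : ℂ} (hω : ‖ω‖ = 1) :
    Tendsto (fun z => ‖k z‖) (𝓝[ball 0 1] ω) (𝓝 1) := by
  rw [tendsto_order]
  refine ⟨fun R hR => ?_, fun R hR => ?_⟩
  · obtain ⟨r, hr, hr'⟩ := h.exists_lt_norm hR
    have : ∀ᶠ z in 𝓝 ω, r < ‖z‖ :=
      continuous_norm.continuousAt.eventually (lt_mem_nhds (show r < ‖ω‖ by rw [hω]; exact hr))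
    filter_upwards [nhdsWithin_le_nhds this, self_mem_nhdsWithin] with z hz hz'
    exact hr' z hz' hz
  · filter_upwards [self_mem_nhdsWithin] with z hz
    have := h.mapsTo hz
    rw [mem_ball_zero_iff] at this
    linarith

lemma not_mapClusterPt (h : IsConformalModel g f k) {ω : ℂ} (hω : ‖ω‖ = 1) {c : ℂ} (hc : ‖c‖ = 1)
    {α : ℝ} (hα0 : 0 < α) (hα : α ≤ Real.pi / 2)
    (h1 : MapClusterPt (c * Complex.exp ((-α : ℝ) * Complex.I)) (𝓝[ball 0 1] ω) k)
    (h2 : MapClusterPt (c * Complex.exp (α * Complex.I)) (𝓝[ball 0 1] ω) k) : False := by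
  have hc0 : c ≠ 0 := by rintro rfl; simp at hc
  have hpi := Real.pi_pos
  have key : ∀ ε > 0, ∀ R < 1,
      (∀ θ ∈ Ioo (-(α / 2)) (α / 2), ∃ r : ℝ, R < r ∧ r < 1 ∧
        ‖f (c * (r * Complex.exp (θ * Complex.I))) - g ω‖ < ε) ∨
      (∀ θ ∈ Ioo (-(α / 2)) (α / 2), ∃ r : ℝ, R < r ∧ r < 1 ∧
        ‖f (-c * (r * Complex.exp (θ * Complex.I))) - g ω‖ < ε) := by
    intro ε hε R hR
    have e1 : ∀ᶠ z in 𝓝 ω, ‖g z - g ω‖ < ε := by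
      have := (g.continuous.sub continuous_const : Continuous fun z => g z - g ω).norm.continuousAt (x := ω)
      exact this.eventually (gt_mem_nhds (by simpa using hε))
    have e2 : ∀ᶠ z in 𝓝[ball 0 1] ω, max R 0 < ‖k z‖ :=
      (h.tendsto_norm hω).eventually (lt_mem_nhds (max_lt hR one_pos))
    rw [eventually_nhdsWithin_iff] at e2
    obtain ⟨δ, hδ, hδ'⟩ := Metric.eventually_nhds_iff_ball.1 (e1.and e2)
    have hnear : ∀ s : ℝ, s ∈ Ioo (-Real.pi) Real.pi → ∀ l u : ℝ, l < s → s < u →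
        MapClusterPt (c * Complex.exp (s * Complex.I)) (𝓝[ball 0 1] ω) k →
        ∃ z ∈ ball (0:ℂ) 1, z ∈ ball ω δ ∧ Complex.arg (k z / c) ∈ Ioo l u := by
      intro s hs l u hl hu hcl
      have hca : ContinuousAt (fun w : ℂ => Complex.arg (w / c)) (c * Complex.exp (s * Complex.I)) := by
        refine ContinuousAt.comp (f := fun w : ℂ => w / c) (g := Complex.arg) ?_ (by fun_prop)
        apply Complex.continuousAt_arg
        rw [mul_div_cancel_left₀ _ hc0, Complex.mem_slitPlane_iff_arg]
        refine ⟨?_, Complex.exp_ne_zero _⟩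
        have := Complex.arg_ofReal_mul_exp one_pos ⟨hs.1, hs.2.le⟩
        rw [Complex.ofReal_one, one_mul] at this
        rw [this]
        exact hs.2.ne
      have hv : Complex.arg (c * Complex.exp (s * Complex.I) / c) = s := by
        rw [mul_div_cancel_left₀ _ hc0]
        have := Complex.arg_ofReal_mul_exp one_pos ⟨hs.1, hs.2.le⟩
        rwa [Complex.ofReal_one, one_mul] at this
      have hev := hca.eventually (Ioo_mem_nhds (hv.symm ▸ hl) (hv.symm ▸ hu))
      have hfr := (mapClusterPt_iff_frequently.1 hcl _ hev)
      have hev2 : ∀ᶠ z in 𝓝[ball 0 1] ω, z ∈ ball (0:ℂ) 1 ∧ z ∈ ball ω δ := by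
        filter_upwards [self_mem_nhdsWithin, mem_nhdsWithin_of_mem_nhds (ball_mem_nhds ω hδ)] with z a b
        exact ⟨a, b⟩
      obtain ⟨z, hz1, hz2, hz3⟩ := (hfr.and_eventually hev2).exists
      exact ⟨z, hz2, hz3, hz1⟩
    obtain ⟨z, hz, hzδ, hza⟩ := hnear (-α) ⟨by linarith, by linarith⟩ (-(3 * Real.pi / 4)) (-(α / 2))
      (by linarith) (by linarith) h1
    obtain ⟨z', hz', hzδ', hza'⟩ := hnear α ⟨by linarith, by linarith⟩ (α / 2) (3 * Real.pi / 4)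
      (by linarith) (by linarith) h2
    have hsub1 := (convex_ball (0:ℂ) 1).segment_subset hz hz'
    have hsub2 := (convex_ball ω δ).segment_subset hzδ hzδ'
    have hpre : IsPreconnected (k '' segment ℝ z z') :=
      (convex_segment z z').isPreconnected.image _ (h.continuousOn.mono hsub1)
    have hfin : ∀ w ∈ k '' segment ℝ z z', max R 0 < ‖w‖ ∧ ‖w‖ < 1 ∧ ‖f w - g ω‖ < ε := by
      rintro _ ⟨x, hx, rfl⟩
      refine ⟨(hδ' x (hsub2 hx)).2 (hsub1 hx), by simpa using h.mapsTo (hsub1 hx), ?_⟩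
      rw [h.comp_eq x (hsub1 hx)]
      exact (hδ' x (hsub2 hx)).1
    have h0 : (0:ℂ) ∉ k '' segment ℝ z z' := by
      intro hmem
      have := (hfin 0 hmem).1
      simp at this
    have fin2 : ∀ (d : ℂ), ‖d‖ = 1 → ∀ θ r : ℝ, 0 < r →
        (r : ℂ) * (d * Complex.exp (θ * Complex.I)) ∈ k '' segment ℝ z z' →
        ∃ r : ℝ, R < r ∧ r < 1 ∧ ‖f (d * (r * Complex.exp (θ * Complex.I))) - g ω‖ < ε := by
      intro d hd θ r hr hmem
      have hn : ‖(r : ℂ) * (d * Complex.exp (θ * Complex.I))‖ = r := by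
        simp [hd, Complex.norm_exp_ofReal_mul_I, abs_of_pos hr]
      obtain ⟨a, b, e⟩ := hfin _ hmem
      rw [hn] at a b
      refine ⟨r, (le_max_left _ _).trans_lt a, b, ?_⟩
      rwa [mul_left_comm]
    refine (hpre.meets_rays h0 hc0 hα (mem_image_of_mem _ (left_mem_segment ℝ z z'))
      (mem_image_of_mem _ (right_mem_segment ℝ z z')) hza hza').imp ?_ ?_
    · intro hh θ hθ
      obtain ⟨r, hr, hmem⟩ := hh θ hθ
      exact fin2 c hc θ r hr hmem
    · intro hh θ hθ
      obtain ⟨r, hr, hmem⟩ := hh θ hθ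
      exact fin2 (-c) (by simpa using hc) θ r hr hmem
  have hfinal : ∀ d : ℂ, ‖d‖ = 1 → ¬ ∀ ε > 0, ∀ R < 1,
      (∀ θ ∈ Ioo (-(α / 2)) (α / 2), ∃ r : ℝ, R < r ∧ r < 1 ∧
        ‖f (d * (r * Complex.exp (θ * Complex.I))) - g ω‖ < ε) := by
    intro d hd hall
    obtain ⟨M, hM⟩ := h.exists_bound
    have hb : ∀ z ∈ ball (0:ℂ) 1, d * z ∈ ball (0:ℂ) 1 := fun z hz => by simpa [hd] using hz
    have := exists_eq_of_radial_cluster (f := fun z => f (d * z)) (M := M) (p := g ω) (β := α / 2)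
      (h.differentiableOn.comp (by fun_prop) hb) (fun z hz => hM _ (hb z hz))
      (h.lintegral_lt_top hd) (by positivity) (fun θ hθ ε hε R hR => hall ε hε R hR θ hθ)
    rw [mul_zero] at this
    obtain ⟨z, hz, hz0⟩ := h.surjOn (show (0:ℂ) ∈ ball 0 1 by simp)
    rw [← hz0, h.comp_eq z hz] at this
    have := g.injective this
    rw [this] at hz
    simp [hω] at hz
  have n1 := hfinal c hc
  have n2 := hfinal (-c) (by simpa using hc)
  push Not at n1 n2
  obtain ⟨ε₁, hε₁, R₁, hR₁, θ₁, hθ₁, n1⟩ := n1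
  obtain ⟨ε₂, hε₂, R₂, hR₂, θ₂, hθ₂, n2⟩ := n2
  rcases key (min ε₁ ε₂) (lt_min hε₁ hε₂) (max R₁ R₂) (max_lt hR₁ hR₂) with hk | hk
  · obtain ⟨r, a, b, e⟩ := hk θ₁ hθ₁
    exact absurd (n1 r ((le_max_left _ _).trans_lt a) b) (not_le.2 (e.trans_le (min_le_left _ _)))
  · obtain ⟨r, a, b, e⟩ := hk θ₂ hθ₂
    exact absurd (n2 r ((le_max_right _ _).trans_lt a) b) (not_le.2 (e.trans_le (min_le_right _ _)))

lemma exists_tendsto (h : IsConformalModel g f k) {ω : ℂ} (hω : ‖ω‖ = 1) :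
    ∃ a, Tendsto k (𝓝[ball 0 1] ω) (𝓝 a) := by
  have hne : (𝓝[ball (0:ℂ) 1] ω).NeBot := by
    rw [← mem_closure_iff_nhdsWithin_neBot, closure_ball _ one_ne_zero]
    simp [hω]
  have hle : map k (𝓝[ball 0 1] ω) ≤ 𝓟 (closedBall 0 1) := by
    rw [le_principal_iff, mem_map]
    filter_upwards [self_mem_nhdsWithin] with z hz
    exact ball_subset_closedBall (h.mapsTo hz)
  have hnorm : ∀ a, MapClusterPt a (𝓝[ball 0 1] ω) k → ‖a‖ = 1 := by
    intro a ha
    have h1 : MapClusterPt ‖a‖ (𝓝[ball 0 1] ω) (norm ∘ k) :=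
      ha.continuousAt_comp continuous_norm.continuousAt
    have h2 : map (norm ∘ k) (𝓝[ball 0 1] ω) ≤ 𝓝 1 := h.tendsto_norm hω
    have h3 : (𝓝 ‖a‖ ⊓ 𝓝 (1:ℝ)).NeBot := h1.neBot.mono (inf_le_inf_left _ h2)
    exact eq_of_nhds_neBot h3
  have huniq : ∀ a b, MapClusterPt a (𝓝[ball 0 1] ω) k → MapClusterPt b (𝓝[ball 0 1] ω) k →
      0 < Complex.arg (b / a) → False := by
    intro a b ha hb hpos
    have ha1 := hnorm a ha
    have hb1 := hnorm b hb
    have ha0 : a ≠ 0 := by rintro rfl; simp at ha1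
    set α := Complex.arg (b / a) / 2 with hα
    have hba : b = a * Complex.exp ((2 * α : ℝ) * Complex.I) := by
      have := Complex.norm_mul_exp_arg_mul_I (b / a)
      rw [norm_div, ha1, hb1, div_one, Complex.ofReal_one, one_mul] at this
      rw [hα, mul_div_cancel₀ _ two_ne_zero, this, mul_div_cancel₀ _ ha0]
    refine h.not_mapClusterPt hω (c := a * Complex.exp (α * Complex.I)) (α := α)
      (by rw [norm_mul, ha1, Complex.norm_exp_ofReal_mul_I, one_mul]) (by positivity)
      (by rw [hα]; linarith [Complex.arg_le_pi (b / a)]) ?_ ?_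
    · convert ha using 1
      rw [mul_assoc, ← Complex.exp_add]
      simp
    · convert hb using 1
      rw [hba, mul_assoc, ← Complex.exp_add]
      congr 2
      push_cast
      ring
  obtain ⟨a, -, ha⟩ := (isCompact_closedBall (0:ℂ) 1) hle
  refine ⟨a, (isCompact_closedBall (0:ℂ) 1).le_nhds_of_unique_clusterPt (le_principal_iff.1 hle) ?_⟩
  intro b _ hb
  have ha1 := hnorm a ha
  have hb1 := hnorm b hb
  have ha0 : a ≠ 0 := by rintro rfl; simp at ha1
  rcases lt_trichotomy (Complex.arg (b / a)) 0 with h1 | h1 | h1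
  · refine (huniq b a hb ha ?_).elim
    rw [← inv_div, Complex.arg_inv, if_neg (by intro h; linarith [Real.pi_pos])]
    linarith
  · have := Complex.norm_mul_exp_arg_mul_I (b / a)
    rw [norm_div, ha1, hb1, h1] at this
    simp only [div_one, Complex.ofReal_one, Complex.ofReal_zero, zero_mul, Complex.exp_zero,
      mul_one] at this
    rw [eq_div_iff ha0, one_mul] at this
    exact this.symm
  · exact (huniq a b ha hb h1).elim

end IsConformalModel

open Metric in
lemma mul_exp_mem_ball_one_iff {r ψ : ℝ} (hr : 0 < r) :
    (r : ℂ) * Complex.exp (ψ * Complex.I) ∈ ball (1:ℂ) 1 ↔ r / 2 < Real.cos ψ := by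
  have h : ‖(r : ℂ) * Complex.exp (ψ * Complex.I) - 1‖ ^ 2 = 1 + r * (r - 2 * Real.cos ψ) := by
    rw [← Complex.normSq_eq_norm_sq, Complex.exp_mul_I, ← Complex.ofReal_cos, ← Complex.ofReal_sin,
      Complex.normSq_apply]
    simp [-Complex.ofReal_cos, -Complex.ofReal_sin]
    linear_combination r ^ 2 * Real.sin_sq_add_cos_sq ψ
  rw [mem_ball, dist_eq_norm, ← abs_of_nonneg (norm_nonneg (_ - _)), ← sq_lt_one_iff_abs_lt_one, h]
  constructor
  · intro h1
    by_contra! h2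
    nlinarith
  · intro h1
    nlinarith

lemma ENNReal.le_add_mul_sq {δ : ℝ} (hδ : 0 < δ) (h : ENNReal) :
    h ≤ ENNReal.ofReal δ + ENNReal.ofReal δ⁻¹ * h ^ 2 := by
  rcases le_total h (ENNReal.ofReal δ) with h1 | h1
  · exact h1.trans le_self_add
  · refine le_trans ?_ le_add_self
    calc h = ENNReal.ofReal δ⁻¹ * (ENNReal.ofReal δ * h) := by
          rw [← mul_assoc, ← ENNReal.ofReal_mul (by positivity), inv_mul_cancel₀ hδ.ne']
          simp
      _ ≤ ENNReal.ofReal δ⁻¹ * (h * h) := by gcongr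
      _ = _ := by rw [sq]

open MeasureTheory Metric in
/-- Length-area principle: a bounded univalent function on a disc does not separate, by a fixed
distance, points on all small circular crosscuts around a boundary point. -/
lemma exists_crosscut_dist_lt {f : ℂ → ℂ} {M : ℝ} (hf : DifferentiableOn ℂ f (ball 1 1))
    (hinj : InjOn f (ball 1 1)) (hM : ∀ z ∈ ball (1 : ℂ) 1, ‖f z‖ ≤ M) {d r₀ : ℝ} (hd : 0 < d)
    (hr₀ : 0 < r₀) : ∃ r : ℝ, 0 < r ∧ r < r₀ ∧ ∀ z ∈ ball (1:ℂ) 1, ∀ w ∈ ball (1:ℂ) 1,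
      ‖z‖ = r → ‖w‖ = r → ‖f z - f w‖ < d := by
  by_contra! hcon
  have hpi := Real.pi_pos
  set E : ℝ × ℝ → ENNReal := fun p =>
    (ball (1:ℂ) 1).indicator (fun z => ‖deriv f z‖ₑ) (p.1 * Complex.exp (p.2 * Complex.I)) with hE
  have hEm : Measurable E := by
    refine Measurable.comp (((measurable_deriv f).enorm).indicator measurableSet_ball) ?_
    exact Continuous.measurable (by fun_prop)
  have hpolar : ∫⁻ r in Ioi (0:ℝ), ∫⁻ ψ in Ioo (-Real.pi) Real.pi,
      ENNReal.ofReal r * E (r, ψ) ^ 2 < ⊤ := by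
    have h1 := Complex.lintegral_comp_polarCoord_symm
      ((ball (1:ℂ) 1).indicator (fun z => ‖deriv f z‖ₑ ^ 2))
    rw [lintegral_indicator measurableSet_ball] at h1
    have h2 := h1 ▸ lintegral_enorm_deriv_sq_lt_top isOpen_ball hf hinj hM
    rw [polarCoord_target, Measure.volume_eq_prod, ← Measure.prod_restrict] at h2
    have h3 : ∀ p : ℝ × ℝ, ENNReal.ofReal p.1 • (ball (1:ℂ) 1).indicator (fun z => ‖deriv f z‖ₑ ^ 2)
        (Complex.polarCoord.symm p) = ENNReal.ofReal p.1 * E p ^ 2 := by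
      rintro ⟨r, t⟩
      simp only [Complex.polarCoord_symm_apply, smul_eq_mul, hE]
      have : (r:ℂ) * (Real.cos t + Real.sin t * Complex.I) = r * Complex.exp (t * Complex.I) := by
        rw [Complex.exp_mul_I]; simp
      rw [this]
      congr 1
      by_cases hm : (r:ℂ) * Complex.exp (t * Complex.I) ∈ ball (1:ℂ) 1
      · simp [indicator_of_mem hm]
      · simp [indicator_of_notMem hm]
    simp_rw [h3] at h2
    have h4 : Measurable fun p : ℝ × ℝ => ENNReal.ofReal p.1 * E p ^ 2 :=
      measurable_fst.ennreal_ofReal.mul (hEm.pow_const 2)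
    rwa [lintegral_prod _ h4.aemeasurable] at h2
  have hest : ∀ r : ℝ, 0 < r → r < r₀ → ENNReal.ofReal (d ^ 2 / (8 * Real.pi) * r⁻¹) ≤
      ∫⁻ ψ in Ioo (-Real.pi) Real.pi, ENNReal.ofReal r * E (r, ψ) ^ 2 := by
    intro r hr hr'
    obtain ⟨z, hz, w, hw, hzr, hwr, hdist⟩ := hcon r hr hr'
    have hlen : ENNReal.ofReal d ≤ ∫⁻ ψ in Ioo (-Real.pi) Real.pi, ENNReal.ofReal r * E (r, ψ) := by
      wlog hle : Complex.arg z ≤ Complex.arg w generalizing z w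
      · exact this w hw z hz hwr hzr (by rwa [norm_sub_rev]) (le_of_not_ge hle)
      set a := Complex.arg z
      set b := Complex.arg w
      have hz' : (r:ℂ) * Complex.exp (a * Complex.I) = z := by
        rw [← hzr]; exact Complex.norm_mul_exp_arg_mul_I z
      have hw' : (r:ℂ) * Complex.exp (b * Complex.I) = w := by
        rw [← hwr]; exact Complex.norm_mul_exp_arg_mul_I w
      have ha := (mul_exp_mem_ball_one_iff hr).1 (hz'.symm ▸ hz)
      have hb := (mul_exp_mem_ball_one_iff hr).1 (hw'.symm ▸ hw)
      have hm : ∀ ψ ∈ Icc a b, (r:ℂ) * Complex.exp (ψ * Complex.I) ∈ ball (1:ℂ) 1 := by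
        intro ψ hψ
        rw [mul_exp_mem_ball_one_iff hr]
        have hmax : |ψ| ≤ max |a| |b| := by
          rw [max_comm]; exact abs_le_max_abs_abs hψ.1 hψ.2 |>.trans (by rw [max_comm])
        rw [← Real.cos_abs ψ]
        refine lt_of_lt_of_le (lt_min (Real.cos_abs a ▸ ha) (Real.cos_abs b ▸ hb)) ?_
        rcases le_max_iff.1 hmax with h | h
        · exact (min_le_left _ _).trans
            (Real.cos_le_cos_of_nonneg_of_le_pi (abs_nonneg _) (Complex.abs_arg_le_pi z) h)
        · exact (min_le_right _ _).trans
            (Real.cos_le_cos_of_nonneg_of_le_pi (abs_nonneg _) (Complex.abs_arg_le_pi w) h)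
      have hdr : ∀ ψ ∈ Icc a b, HasDerivAt (fun ψ : ℝ => f (r * Complex.exp (ψ * Complex.I)))
          (deriv f (r * Complex.exp (ψ * Complex.I)) * (r * (Complex.exp (ψ * Complex.I) * Complex.I))) ψ := by
        intro ψ hψ
        have h1 := (hf.differentiableAt (isOpen_ball.mem_nhds (hm ψ hψ))).hasDerivAt
        have h2 : HasDerivAt (fun ψ : ℝ => (r : ℂ) * Complex.exp (ψ * Complex.I))
            (r * (Complex.exp (ψ * Complex.I) * Complex.I)) ψ := by
          have h3 : HasDerivAt (fun ψ : ℝ => (ψ : ℂ) * Complex.I) Complex.I ψ := by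
            simpa using (Complex.ofRealCLM.hasDerivAt (x := ψ)).mul_const Complex.I
          exact (h3.cexp).const_mul _
        exact h1.comp ψ h2
      have hcd : ContDiffOn ℝ 1 (fun ψ : ℝ => f (r * Complex.exp (ψ * Complex.I))) (Icc a b) := by
        have h1 : ContDiffOn ℂ 1 f (ball 1 1) := hf.contDiffOn isOpen_ball
        have h2 : ContDiffOn ℝ 1 f (ball 1 1) := h1.restrict_scalars ℝ
        refine h2.comp (s := Icc a b) (f := fun ψ : ℝ => (r:ℂ) * Complex.exp (ψ * Complex.I)) ?_ hm
        exact (contDiff_const.mul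
          ((Complex.ofRealCLM.contDiff.mul contDiff_const).cexp)).contDiffOn
      have hftc := enorm_sub_le_lintegral_deriv_of_contDiffOn_Icc hcd hle
      rw [hw', hz'] at hftc
      calc ENNReal.ofReal d ≤ ENNReal.ofReal ‖f w - f z‖ := by
            rw [norm_sub_rev]; exact ENNReal.ofReal_le_ofReal hdist
        _ ≤ ∫⁻ ψ in Icc a b, ‖deriv (fun ψ : ℝ => f (r * Complex.exp (ψ * Complex.I))) ψ‖ₑ := by
            rw [ofReal_norm]; exact hftc
        _ = ∫⁻ ψ in Icc a b, ENNReal.ofReal r * E (r, ψ) := by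
            refine lintegral_congr_ae ((ae_restrict_iff' measurableSet_Icc).2 (Eventually.of_forall ?_))
            intro ψ hψ
            simp only [hE]
            rw [(hdr ψ hψ).deriv, indicator_of_mem (hm ψ hψ), enorm_mul, mul_comm]
            congr 1
            rw [← ofReal_norm]
            simp [Complex.norm_exp_ofReal_mul_I, abs_of_pos hr]
        _ = ∫⁻ ψ in Ioo a b, ENNReal.ofReal r * E (r, ψ) := by rw [restrict_Ioo_eq_restrict_Icc]
        _ ≤ _ := lintegral_mono_set (Ioo_subset_Ioo (Complex.neg_pi_lt_arg z).le (Complex.arg_le_pi w))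
    set e := ∫⁻ ψ in Ioo (-Real.pi) Real.pi, E (r, ψ) ^ 2 with he
    have hEr : Measurable fun ψ : ℝ => E (r, ψ) := hEm.comp (by fun_prop)
    rw [lintegral_const_mul _ hEr] at hlen
    rw [lintegral_const_mul _ (hEr.pow_const 2), ← he]
    have hδ : 0 < d / (4 * Real.pi * r) := by positivity
    have h_int : ∫⁻ ψ in Ioo (-Real.pi) Real.pi, E (r, ψ) ≤
        ENNReal.ofReal (d / (2 * r)) + ENNReal.ofReal (d / (4 * Real.pi * r))⁻¹ * e := by
      refine (lintegral_mono (fun ψ => ENNReal.le_add_mul_sq hδ (E (r, ψ)))).trans ?_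
      rw [lintegral_add_left measurable_const, lintegral_const_mul _ (hEr.pow_const 2)]
      gcongr
      simp only [lintegral_const, Measure.restrict_apply, MeasurableSet.univ, univ_inter,
        Real.volume_Ioo]
      rw [← ENNReal.ofReal_mul hδ.le]
      refine ENNReal.ofReal_le_ofReal (le_of_eq ?_)
      field_simp
      ring
    have h3 := hlen.trans (mul_le_mul_right h_int _)
    rcases eq_or_ne e ⊤ with htop | htop
    · rw [htop, ENNReal.mul_top (by simpa using hr)]; exact le_top
    · rw [← ENNReal.ofReal_toReal htop] at h3 ⊢
      have he0 : 0 ≤ e.toReal := ENNReal.toReal_nonneg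
      generalize e.toReal = x at *
      rw [← ENNReal.ofReal_mul (by positivity), ← ENNReal.ofReal_add (by positivity) (by positivity),
        ← ENNReal.ofReal_mul (by positivity), ENNReal.ofReal_le_ofReal_iff (by positivity)] at h3
      rw [← ENNReal.ofReal_mul (by positivity)]
      refine ENNReal.ofReal_le_ofReal ?_
      have h4 : d ≤ d / 2 + r * x * (4 * Real.pi * r) / d := by
        refine h3.trans (le_of_eq ?_)
        field_simp
      have h5 : d * d ≤ d * d / 2 + r * x * (4 * Real.pi * r) := by
        calc d * d ≤ (d / 2 + r * x * (4 * Real.pi * r) / d) * d := by gcongr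
          _ = _ := by field_simp
      rw [← div_eq_mul_inv, div_div, div_le_iff₀ (by positivity)]
      nlinarith
  have hfin : ∫⁻ r in Ioo (0:ℝ) r₀, ENNReal.ofReal (d ^ 2 / (8 * Real.pi) * r⁻¹) < ⊤ := by
    refine lt_of_le_of_lt ?_ hpolar
    refine le_trans ?_ (lintegral_mono_set (s := Ioo 0 r₀) (fun r hr => hr.1))
    refine lintegral_mono_ae ((ae_restrict_iff' measurableSet_Ioo).2 (Eventually.of_forall ?_))
    exact fun r hr => hest r hr.1 hr.2
  have hII : IntegrableOn (fun r : ℝ => d ^ 2 / (8 * Real.pi) * r⁻¹) (Ioo 0 r₀) := by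
    refine ⟨(measurable_inv.const_mul _).aestronglyMeasurable, ?_⟩
    rw [hasFiniteIntegral_iff_ofReal]
    · exact hfin
    · refine (ae_restrict_iff' measurableSet_Ioo).2 (Eventually.of_forall fun r hr => ?_)
      have := hr.1
      simp only [Pi.zero_apply]
      positivity
  have h6 : IntervalIntegrable (fun r : ℝ => d ^ 2 / (8 * Real.pi) * r⁻¹) volume 0 r₀ := by
    rw [intervalIntegrable_iff_integrableOn_Ioo_of_le hr₀.le]; exact hII
  have h7 := h6.const_mul (d ^ 2 / (8 * Real.pi))⁻¹
  have h8 : (fun r : ℝ => (d ^ 2 / (8 * Real.pi))⁻¹ * (d ^ 2 / (8 * Real.pi) * r⁻¹)) = fun r => r⁻¹ := by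
    funext r
    rw [← mul_assoc, inv_mul_cancel₀ (by positivity), one_mul]
  rw [h8, intervalIntegrable_inv_iff] at h7
  rcases h7 with h7 | h7
  · exact hr₀.ne h7
  · exact h7 left_mem_uIcc

namespace IsConformalModel

open Metric

variable {g : ℂ ≃ₜ ℂ} {f k : ℂ → ℂ}

lemma eq_of_tendsto (h : IsConformalModel g f k) {ω₁ ω₂ a : ℂ} (hω₁ : ‖ω₁‖ = 1) (hω₂ : ‖ω₂‖ = 1)
    (h₁ : Tendsto k (𝓝[ball 0 1] ω₁) (𝓝 a)) (h₂ : Tendsto k (𝓝[ball 0 1] ω₂) (𝓝 a)) : ω₁ = ω₂ := by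
  by_contra hne
  obtain ⟨M, hM⟩ := h.exists_bound
  set d := ‖g ω₁ - g ω₂‖ with hd
  have hd0 : 0 < d := norm_pos_iff.2 (sub_ne_zero.2 (g.injective.ne hne))
  have hcl : ∀ ω : ℂ, ‖ω‖ = 1 → (𝓝[ball (0:ℂ) 1] ω).NeBot := by
    intro ω hω
    rw [← mem_closure_iff_nhdsWithin_neBot, closure_ball _ one_ne_zero]
    simp [hω]
  have ha : ‖a‖ = 1 := by
    have := hcl ω₁ hω₁
    exact tendsto_nhds_unique ((continuous_norm.tendsto a).comp h₁) (h.tendsto_norm hω₁)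
  have ha0 : a ≠ 0 := by rintro rfl; simp at ha
  have hcross : ∀ ω : ℂ, ‖ω‖ = 1 → Tendsto k (𝓝[ball 0 1] ω) (𝓝 a) →
      ∃ r₀ > 0, ∀ r : ℝ, 0 < r → r < r₀ → ∃ ζ ∈ ball (0:ℂ) 1, ‖ζ - a‖ = r ∧ ‖f ζ - g ω‖ < d / 3 := by
    intro ω hω ht
    have hev : ∀ᶠ t : ℝ in 𝓝[<] 1, ‖g (t * ω) - g ω‖ < d / 3 := by
      have hc : Continuous fun t : ℝ => ‖g (t * ω) - g ω‖ := by fun_prop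
      refine nhdsWithin_le_nhds (hc.continuousAt.eventually (gt_mem_nhds ?_))
      simp; positivity
    obtain ⟨t₁, ht₁, ht₁'⟩ := (mem_nhdsLT_iff_exists_Ioo_subset.1
      (inter_mem hev (Ioo_mem_nhdsLT (show (0:ℝ) < 1 by norm_num))))
    set t₀ := (t₁ + 1) / 2 with ht₀
    have ht₁1 : t₁ < 1 := ht₁
    have hmem : ∀ t : ℝ, t ∈ Ico t₀ 1 → ‖g (t * ω) - g ω‖ < d / 3 ∧ (t:ℂ) * ω ∈ ball (0:ℂ) 1 := by
      intro t ht
      have := ht₁' (show t ∈ Ioo t₁ 1 from ⟨by linarith [ht.1], ht.2⟩)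
      refine ⟨this.1, ?_⟩
      simp [hω, abs_of_pos this.2.1, this.2.2]
    have h0m := (hmem t₀ ⟨le_rfl, by linarith⟩).2
    refine ⟨‖k (t₀ * ω) - a‖, ?_, fun r hr hr' => ?_⟩
    · refine norm_pos_iff.2 (sub_ne_zero.2 ?_)
      intro he
      have := h.mapsTo h0m
      rw [he] at this
      simp [ha] at this
    · have htend : Tendsto (fun t : ℝ => ‖k (t * ω) - a‖) (𝓝[<] 1) (𝓝 0) := by
        have e1 : Tendsto (fun t : ℝ => (t:ℂ) * ω) (𝓝[<] 1) (𝓝[ball 0 1] ω) := by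
          refine tendsto_nhdsWithin_iff.2 ⟨?_, ?_⟩
          · have : Continuous fun t : ℝ => (t:ℂ) * ω := by fun_prop
            have := this.tendsto 1
            simp only [Complex.ofReal_one, one_mul] at this
            exact this.mono_left nhdsWithin_le_nhds
          · filter_upwards [Ioo_mem_nhdsLT (show (0:ℝ) < 1 by norm_num)] with t ht
            simp [hω, abs_of_pos ht.1, ht.2]
        have e2 := ((ht.comp e1).sub_const a).norm
        simpa using e2
      obtain ⟨t₂, ht₂, ht₂'⟩ := ((htend.eventually (gt_mem_nhds hr)).and
        (Ioo_mem_nhdsLT (show t₀ < 1 by linarith))).exists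
      have hcont : ContinuousOn (fun t : ℝ => ‖k (t * ω) - a‖) (Icc t₀ t₂) := by
        refine (ContinuousOn.sub ?_ continuousOn_const).norm
        refine h.continuousOn.comp (by fun_prop) (fun t ht => ?_)
        exact (hmem t ⟨ht.1, ht.2.trans_lt ht₂'.2⟩).2
      obtain ⟨t, ht, htr⟩ := intermediate_value_Icc' ht₂'.1.le hcont ⟨ht₂.le, hr'.le⟩
      have hmt := hmem t ⟨ht.1, ht.2.trans_lt ht₂'.2⟩
      refine ⟨k (t * ω), h.mapsTo hmt.2, htr, ?_⟩
      rw [h.comp_eq _ hmt.2]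
      exact hmt.1
  obtain ⟨r₁, hr₁, H₁⟩ := hcross ω₁ hω₁ h₁
  obtain ⟨r₂, hr₂, H₂⟩ := hcross ω₂ hω₂ h₂
  have hb : ∀ z ∈ ball (1:ℂ) 1, a * (1 - z) ∈ ball (0:ℂ) 1 := by
    intro z hz
    rw [mem_ball_zero_iff, norm_mul, ha, one_mul, norm_sub_rev]
    simpa [dist_eq_norm] using hz
  obtain ⟨r, hr, hr', hrr⟩ := exists_crosscut_dist_lt (f := fun z => f (a * (1 - z))) (M := M)
    (h.differentiableOn.comp (by fun_prop) hb)
    (fun z hz w hw hzw => by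
      have := mul_left_cancel₀ ha0 (h.injOn (hb z hz) (hb w hw) hzw)
      exact sub_right_injective this) (fun z hz => hM _ (hb z hz))
    (show 0 < d / 3 by positivity) (lt_min hr₁ hr₂)
  obtain ⟨ζ₁, hζ₁, e₁, e₁'⟩ := H₁ r hr (hr'.trans_le (min_le_left _ _))
  obtain ⟨ζ₂, hζ₂, e₂, e₂'⟩ := H₂ r hr (hr'.trans_le (min_le_right _ _))
  have hinv : ∀ ζ, a * (1 - (1 - ζ / a)) = ζ := fun ζ => by field_simp; ring
  have hn : ∀ ζ, ‖1 - ζ / a‖ = ‖ζ - a‖ := fun ζ => by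
    rw [show 1 - ζ / a = -(ζ - a) / a by field_simp; ring, norm_div, ha, norm_neg, div_one]
  have hm : ∀ ζ ∈ ball (0:ℂ) 1, 1 - ζ / a ∈ ball (1:ℂ) 1 := fun ζ hζ => by
    simpa [dist_eq_norm, ha] using hζ
  have := hrr _ (hm ζ₁ hζ₁) _ (hm ζ₂ hζ₂) ((hn _).trans e₁) ((hn _).trans e₂)
  simp only [hinv] at this
  have e3 : d ≤ ‖f ζ₁ - g ω₁‖ + ‖f ζ₁ - f ζ₂‖ + ‖f ζ₂ - g ω₂‖ := by
    rw [hd, norm_sub_rev (f ζ₁) (g ω₁)]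
    calc ‖g ω₁ - g ω₂‖ = ‖(g ω₁ - f ζ₁) + (f ζ₁ - f ζ₂) + (f ζ₂ - g ω₂)‖ := by congr 1; ring
      _ ≤ _ := norm_add₃_le
  linarith

end IsConformalModel

namespace IsConformalModel

open Metric

variable {g : ℂ ≃ₜ ℂ} {f k : ℂ → ℂ}

/-- Carathéodory's theorem for a topological disc with collared boundary. -/
lemma exists_extension (h : IsConformalModel g f k) : ∃ K L : ℂ → ℂ,
    ContinuousOn K (closedBall 0 1) ∧ ContinuousOn L (closedBall 0 1) ∧
    MapsTo K (ball 0 1) (ball 0 1) ∧ MapsTo L (ball 0 1) (ball 0 1) ∧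
    MapsTo K (sphere 0 1) (sphere 0 1) ∧ MapsTo L (sphere 0 1) (sphere 0 1) ∧
    LeftInvOn L K (closedBall 0 1) ∧ LeftInvOn K L (closedBall 0 1) ∧ EqOn K k (ball 0 1) := by
  have hcl : closure (ball (0:ℂ) 1) = closedBall 0 1 := closure_ball _ one_ne_zero
  have hlim : ∀ z ∈ closedBall (0:ℂ) 1, ∃ a, Tendsto k (𝓝[ball 0 1] z) (𝓝 a) := by
    intro z hz
    rcases (mem_closedBall_zero_iff.1 hz).lt_or_eq with h1 | h1
    · exact ⟨k z, h.continuousOn z (by simpa using h1)⟩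
    · exact h.exists_tendsto h1
  set K := extendFrom (ball 0 1) k with hK
  have hKeq : EqOn K k (ball 0 1) := extendFrom_extends h.continuousOn
  have hKt : ∀ z ∈ closedBall (0:ℂ) 1, Tendsto k (𝓝[ball 0 1] z) (𝓝 (K z)) := by
    intro z hz
    obtain ⟨a, ha⟩ := hlim z hz
    rwa [hK, extendFrom_eq (hcl.symm ▸ hz) ha]
  have hKc : ContinuousOn K (closedBall 0 1) := continuousOn_extendFrom hcl.ge hlim
  have hKb : MapsTo K (ball 0 1) (ball 0 1) := fun z hz => by
    rw [hKeq hz]; exact h.mapsTo hz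
  have hKs : MapsTo K (sphere 0 1) (sphere 0 1) := by
    intro z hz
    have hz' : ‖z‖ = 1 := by simpa using hz
    have hne : (𝓝[ball (0:ℂ) 1] z).NeBot := by
      rw [← mem_closure_iff_nhdsWithin_neBot, hcl]; exact sphere_subset_closedBall hz
    have := tendsto_nhds_unique
      ((continuous_norm.tendsto _).comp (hKt z (sphere_subset_closedBall hz))) (h.tendsto_norm hz')
    simpa using this
  have hsplit : ∀ z ∈ closedBall (0:ℂ) 1, z ∈ ball (0:ℂ) 1 ∨ z ∈ sphere (0:ℂ) 1 := by
    intro z hz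
    rw [← mem_union, ball_union_sphere]; exact hz
  have hdisj : ∀ z ∈ ball (0:ℂ) 1, z ∉ sphere (0:ℂ) 1 := by
    intro z hz hz'
    rw [mem_ball] at hz
    rw [mem_sphere] at hz'
    linarith
  have hinj : InjOn K (closedBall 0 1) := by
    intro z hz w hw hzw
    rcases hsplit z hz with h1 | h1 <;> rcases hsplit w hw with h2 | h2
    · rw [hKeq h1, hKeq h2] at hzw
      exact h.injOn_right h1 h2 hzw
    · exact (hdisj _ (hKb h1) (hzw ▸ hKs h2)).elim
    · exact (hdisj _ (hKb h2) (hzw ▸ hKs h1)).elim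
    · exact h.eq_of_tendsto (by simpa using h1) (by simpa using h2) (hKt z hz) (hzw ▸ hKt w hw)
  have hmaps : MapsTo K (closedBall 0 1) (closedBall 0 1) := by
    intro z hz
    rcases hsplit z hz with h1 | h1
    · exact ball_subset_closedBall (hKb h1)
    · exact sphere_subset_closedBall (hKs h1)
  have himg : K '' closedBall 0 1 = closedBall 0 1 := by
    refine subset_antisymm hmaps.image_subset ?_
    have hclosed : IsClosed (K '' closedBall 0 1) :=
      ((isCompact_closedBall (0:ℂ) 1).image_of_continuousOn hKc).isClosed
    rw [← hcl]
    refine (hcl ▸ hclosed).closure_subset_iff.2 ?_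
    intro w hw
    obtain ⟨z, hz, rfl⟩ := h.surjOn hw
    exact ⟨z, subset_closure hz, hKeq hz⟩
  set L := Function.invFunOn K (closedBall 0 1) with hL
  have hLK : LeftInvOn L K (closedBall 0 1) := hinj.leftInvOn_invFunOn
  have hsurj : SurjOn K (closedBall 0 1) (closedBall 0 1) := himg.ge
  have hKL : LeftInvOn K L (closedBall 0 1) := hsurj.rightInvOn_invFunOn
  have hLmaps : MapsTo L (closedBall 0 1) (closedBall 0 1) := hsurj.mapsTo_invFunOn
  refine ⟨K, L, hKc, ?_, hKb, ?_, hKs, ?_, hLK, hKL, hKeq⟩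
  · rw [continuousOn_iff_isClosed]
    intro C hC
    refine ⟨K '' (C ∩ closedBall 0 1), ?_, ?_⟩
    · exact (((isCompact_closedBall (0:ℂ) 1).inter_left hC).image_of_continuousOn
        (hKc.mono inter_subset_right)).isClosed
    · ext w
      constructor
      · rintro ⟨h1, h2⟩
        exact ⟨⟨L w, ⟨h1, hLmaps h2⟩, hKL h2⟩, h2⟩
      · rintro ⟨⟨z, ⟨h1, h2⟩, rfl⟩, h3⟩
        exact ⟨by rw [mem_preimage, hLK h2]; exact h1, h3⟩
  · intro w hw
    have hw' := ball_subset_closedBall hw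
    refine (hsplit _ (hLmaps hw')).resolve_right (fun h1 => ?_)
    have := hKs h1
    rw [hKL hw'] at this
    exact hdisj w hw this
  · intro w hw
    have hw' := sphere_subset_closedBall hw
    refine (hsplit _ (hLmaps hw')).resolve_left (fun h1 => ?_)
    have := hKb h1
    rw [hKL hw'] at this
    exact hdisj w this hw

end IsConformalModel

open Metric in
lemma Homeomorph.exists_isConformalModel (g : ℂ ≃ₜ ℂ) : ∃ f k : ℂ → ℂ, IsConformalModel g f k ∧
    ∀ w ∈ ball (0:ℂ) 1, deriv f w ≠ 0 := by
  have hUo : IsOpen (g '' ball 0 1) := g.isOpenMap _ isOpen_ball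
  have hUs : IsSimplyConnected (g '' ball (0:ℂ) 1) := by
    have h1 : IsSimplyConnected (ball (0:ℂ) 1) := by
      have := (convex_ball (0:ℂ) 1).contractibleSpace ⟨0, by simp⟩
      exact SimplyConnectedSpace.ofContractible _
    exact (g.isSimplyConnected_image).2 h1
  have hUb : Bornology.IsBounded (g '' ball (0:ℂ) 1) :=
    (((isCompact_closedBall (0:ℂ) 1).image g.continuous).isBounded).subset
      (image_mono ball_subset_closedBall)
  obtain ⟨f, φ, hf, hφ, hfm, hφm, hfφ, hφf⟩ := exists_biholomorphic_unitBall hUo hUs hUb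
  have hg : MapsTo g (ball (0:ℂ) 1) (g '' ball (0:ℂ) 1) := mapsTo_image _ _
  refine ⟨f, fun z => φ (g z), ⟨hf, ?_, ?_, ?_, ?_⟩, ?_⟩
  · exact hφ.continuousOn.comp g.continuous.continuousOn hg
  · exact fun z hz => hφm (hg hz)
  · intro w hw
    obtain ⟨z, hz, hzw⟩ := hfm hw
    exact ⟨z, hz, by simp only [hzw, hφf hw]⟩
  · exact fun z hz => hfφ (hg hz)
  · intro w hw h0
    have h1 := (hf.differentiableAt (isOpen_ball.mem_nhds hw)).hasDerivAt
    have h2 := (hφ.differentiableAt (hUo.mem_nhds (hfm hw))).hasDerivAt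
    have h3 := h2.comp w h1
    have h4 : HasDerivAt (φ ∘ f) 1 w := by
      refine (hasDerivAt_id w).congr_of_eventuallyEq ?_
      filter_upwards [isOpen_ball.mem_nhds hw] with z hz
      exact hφf hz
    have := h3.unique h4
    rw [h0, mul_zero] at this
    exact zero_ne_one this

/-- The shear of the upper half plane interpolating between `χ` on the real line and the
identity above height `1`. -/
noncomputable def halfPlaneShear (χ : ℝ → ℝ) (ζ : ℂ) : ℂ :=
  ⟨(1 - max 0 (min 1 (1 - ζ.im))) * ζ.re + max 0 (min 1 (1 - ζ.im)) * χ ζ.re, ζ.im⟩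

namespace halfPlaneShear

variable {χ : ℝ → ℝ}

lemma im (χ : ℝ → ℝ) (ζ : ℂ) : (halfPlaneShear χ ζ).im = ζ.im := rfl

lemma continuous (hχ : Continuous χ) : Continuous (halfPlaneShear χ) := by
  have : halfPlaneShear χ = fun ζ => Complex.equivRealProdCLM.symm
    ((1 - max 0 (min 1 (1 - ζ.im))) * ζ.re + max 0 (min 1 (1 - ζ.im)) * χ ζ.re, ζ.im) := by
    rfl
  rw [this]
  refine Complex.equivRealProdCLM.symm.continuous.comp ?_
  have := hχ.comp Complex.continuous_re
  fun_prop

lemma eq_of_one_le {ζ : ℂ} (h : 1 ≤ ζ.im) : halfPlaneShear χ ζ = ζ := by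
  have : max 0 (min 1 (1 - ζ.im)) = 0 := by
    rw [max_eq_left]; exact (min_le_right _ _).trans (by linarith)
  apply Complex.ext <;> simp [halfPlaneShear, this]

lemma eq_of_im_zero {ζ : ℂ} (h : ζ.im = 0) : halfPlaneShear χ ζ = χ ζ.re := by
  apply Complex.ext <;> simp [halfPlaneShear, h]

lemma weight_mem (y : ℝ) : max 0 (min 1 (1 - y)) ∈ Icc (0:ℝ) 1 :=
  ⟨le_max_left _ _, max_le zero_le_one (min_le_left _ _)⟩

lemma injective (hχ : StrictMono χ) : Function.Injective (halfPlaneShear χ) := by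
  intro a b hab
  have h1 : (halfPlaneShear χ a).im = (halfPlaneShear χ b).im := congrArg Complex.im hab
  rw [im, im] at h1
  have h2 := congrArg Complex.re hab
  simp only [halfPlaneShear, h1] at h2
  obtain ⟨h3, h4⟩ := weight_mem b.im
  set l := max 0 (min 1 (1 - b.im))
  have key : ∀ u v : ℝ, u < v → (1 - l) * u + l * χ u < (1 - l) * v + l * χ v := by
    intro u v huv
    have := hχ huv
    rcases h3.eq_or_lt with h | h
    · rw [← h]; linarith
    · nlinarith
  refine Complex.ext ?_ h1
  rcases lt_trichotomy a.re b.re with h | h | h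
  · exact absurd h2 (key _ _ h).ne
  · exact h
  · exact absurd h2 (key _ _ h).ne'

lemma surjective (hχ : StrictMono χ) (hc : Continuous χ) (hs : Function.Surjective χ) :
    Function.Surjective (halfPlaneShear χ) := by
  intro w
  obtain ⟨h3, h4⟩ := weight_mem w.im
  set l := max 0 (min 1 (1 - w.im)) with hl
  obtain ⟨u, hu⟩ := hs w.re
  have hcont : ContinuousOn (fun x => (1 - l) * x + l * χ x)
      (uIcc (min u w.re) (max u w.re)) := by fun_prop
  have hle : min u w.re ≤ max u w.re := min_le_max
  have := intermediate_value_uIcc hcont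
  have hm : w.re ∈ uIcc ((1 - l) * min u w.re + l * χ (min u w.re))
      ((1 - l) * max u w.re + l * χ (max u w.re)) := by
    have ha : χ (min u w.re) ≤ w.re := by
      rw [← hu]; exact hχ.monotone (min_le_left _ _)
    have hb : w.re ≤ χ (max u w.re) := by
      conv_lhs => rw [← hu]
      exact hχ.monotone (le_max_left _ _)
    have ha' := min_le_right u w.re
    have hb' := le_max_right u w.re
    apply Set.Icc_subset_uIcc
    constructor <;> nlinarith
  obtain ⟨x, -, hx⟩ := this hm
  refine ⟨⟨x, w.im⟩, Complex.ext ?_ rfl⟩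
  exact hx

lemma tendsto_norm (hχ : StrictMono χ) (hs : Function.Surjective χ) :
    Tendsto (fun ζ => ‖halfPlaneShear χ ζ‖) (cocompact ℂ) atTop := by
  rw [tendsto_atTop]
  intro R
  obtain ⟨u, hu⟩ := hs (max R 0)
  obtain ⟨v, hv⟩ := hs (-max R 0)
  set M := max (max (|u|) (|v|)) (max R 0)
  have hM1 : |u| ≤ M := (le_max_left _ _).trans (le_max_left _ _)
  have hM2 : |v| ≤ M := (le_max_right _ _).trans (le_max_left _ _)
  have hM3 : max R 0 ≤ M := le_max_right _ _
  filter_upwards [(tendsto_norm_cocompact_atTop (E := ℂ)).eventually_ge_atTop (M + M)] with ζ hζ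
  have hR := le_max_left R 0
  have h0 := le_max_right R 0
  have hsum := hζ.trans (Complex.norm_le_abs_re_add_abs_im ζ)
  by_cases him : M ≤ |ζ.im|
  · have := Complex.abs_im_le_norm (halfPlaneShear χ ζ)
    rw [im] at this
    linarith
  · have hre : M ≤ |ζ.re| := by linarith
    refine le_trans ?_ (Complex.abs_re_le_norm _)
    obtain ⟨h3, h4⟩ := weight_mem ζ.im
    simp only [halfPlaneShear]
    set l := max 0 (min 1 (1 - ζ.im))
    refine hR.trans ?_
    rcases le_total 0 ζ.re with h | h
    · rw [abs_of_nonneg h] at hre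
      have : max R 0 ≤ χ ζ.re := by
        rw [← hu]; exact hχ.monotone ((le_abs_self u).trans (hM1.trans hre))
      refine le_trans ?_ (le_abs_self _)
      nlinarith
    · rw [abs_of_nonpos h] at hre
      have : χ ζ.re ≤ -max R 0 := by
        rw [← hv]; exact hχ.monotone (by linarith [neg_abs_le v])
      refine le_trans ?_ (neg_le_abs _)
      nlinarith

end halfPlaneShear

namespace Complex

/-- The Cayley transform from the upper half plane to the unit disc. -/
noncomputable def cayley (ζ : ℂ) : ℂ := (ζ - I) / (ζ + I)

/-- The Cayley transform from the unit disc to the upper half plane. -/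
noncomputable def invCayley (w : ℂ) : ℂ := I * (1 + w) / (1 - w)

lemma add_I_ne_zero {ζ : ℂ} (h : 0 ≤ ζ.im) : ζ + I ≠ 0 := by
  intro h0
  have := congrArg im h0
  simp at this
  linarith

lemma invCayley_cayley {ζ : ℂ} (h : 0 ≤ ζ.im) : invCayley (cayley ζ) = ζ := by
  have h1 := add_I_ne_zero h
  have h2 : (1:ℂ) - (ζ - I) / (ζ + I) ≠ 0 := by
    have : (1:ℂ) - (ζ - I) / (ζ + I) = 2 * I / (ζ + I) := by field_simp; ring
    rw [this]
    exact div_ne_zero (by simp) h1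
  unfold invCayley cayley
  field_simp
  ring_nf

lemma cayley_invCayley {w : ℂ} (h : w ≠ 1) : cayley (invCayley w) = w := by
  have h1 : 1 - w ≠ 0 := sub_ne_zero.2 h.symm
  have h2 : I * (1 + w) / (1 - w) + I = 2 * I / (1 - w) := by field_simp; ring
  have h3 : I * (1 + w) / (1 - w) - I = 2 * I * w / (1 - w) := by field_simp; ring
  unfold cayley invCayley
  rw [h2, h3]
  field_simp

lemma invCayley_im (w : ℂ) : (invCayley w).im = (1 - ‖w‖ ^ 2) / ‖1 - w‖ ^ 2 := by
  rw [Complex.sq_norm, Complex.sq_norm]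
  simp only [invCayley, div_im, normSq_apply, mul_re, mul_im, I_re, I_im, add_re, add_im, one_re,
    one_im, sub_re, sub_im]
  ring

lemma invCayley_im_nonneg {w : ℂ} (h : ‖w‖ ≤ 1) : 0 ≤ (invCayley w).im := by
  rw [invCayley_im]
  have : ‖w‖ ^ 2 ≤ 1 := by nlinarith [norm_nonneg w]
  exact div_nonneg (by linarith) (by positivity)

lemma invCayley_im_eq_zero {w : ℂ} (h : ‖w‖ = 1) : (invCayley w).im = 0 := by
  rw [invCayley_im, h]; simp

lemma cayley_ne_one (ζ : ℂ) (h : 0 ≤ ζ.im) : cayley ζ ≠ 1 := by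
  intro h0
  rw [cayley, div_eq_one_iff_eq (add_I_ne_zero h)] at h0
  have := congrArg im h0
  simp at this
  linarith

lemma norm_cayley_le_one {ζ : ℂ} (h : 0 ≤ ζ.im) : ‖cayley ζ‖ ≤ 1 := by
  by_contra! hlt
  have h1 := invCayley_im (cayley ζ)
  rw [invCayley_cayley h] at h1
  have h2 : (1 - ‖cayley ζ‖ ^ 2) / ‖1 - cayley ζ‖ ^ 2 < 0 := by
    apply div_neg_of_neg_of_pos
    · nlinarith
    · have := sub_ne_zero.2 (cayley_ne_one ζ h).symm
      positivity
  linarith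

lemma norm_cayley_eq_one {ζ : ℂ} (h : ζ.im = 0) : ‖cayley ζ‖ = 1 := by
  have h1 := invCayley_im (cayley ζ)
  have h2 := sub_ne_zero.2 (cayley_ne_one ζ h.ge).symm
  rw [invCayley_cayley h.ge, h, eq_comm, div_eq_zero_iff] at h1
  rcases h1 with h1 | h1
  · nlinarith [norm_nonneg (cayley ζ)]
  · exact absurd h1 (by positivity)

lemma one_le_invCayley_im {w : ℂ} (h : w ∈ Metric.ball (1 / 2 : ℂ) (1 / 2)) :
    1 ≤ (invCayley w).im := by
  rw [mem_ball_iff_norm] at h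
  have h1 : ‖w - 1 / 2‖ ^ 2 < 1 / 4 := by nlinarith [norm_nonneg (w - 1 / 2)]
  have hw : w ≠ 1 := by
    rintro rfl
    norm_num at h
  have h2 : 0 < ‖1 - w‖ ^ 2 := by
    have := sub_ne_zero.2 hw.symm
    positivity
  rw [invCayley_im, le_div_iff₀ h2]
  rw [Complex.sq_norm, normSq_apply] at h1 ⊢
  rw [Complex.sq_norm, normSq_apply]
  norm_num at h1 ⊢
  nlinarith

lemma continuousAt_invCayley {w : ℂ} (h : w ≠ 1) : ContinuousAt invCayley w := by
  have h1 : 1 - w ≠ 0 := sub_ne_zero.2 h.symm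
  unfold invCayley
  fun_prop (disch := exact h1)

lemma continuousAt_cayley {ζ : ℂ} (h : 0 ≤ ζ.im) : ContinuousAt cayley ζ := by
  have h1 := add_I_ne_zero h
  unfold cayley
  fun_prop (disch := exact h1)

lemma tendsto_cayley_cocompact : Tendsto cayley (cocompact ℂ) (𝓝 1) := by
  have h1 : Tendsto (fun ζ : ℂ => 1 - 2 * I * (ζ + I)⁻¹) (cocompact ℂ) (𝓝 (1 - 2 * I * 0)) := by
    refine tendsto_const_nhds.sub (tendsto_const_nhds.mul ?_)
    exact (tendsto_inv₀_cobounded (α := ℂ)).comp (by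
      rw [Metric.cobounded_eq_cocompact]
      exact (Homeomorph.addRight I).isClosedEmbedding.tendsto_cocompact)
  rw [mul_zero, sub_zero] at h1
  refine h1.congr' ?_
  have : ∀ᶠ ζ : ℂ in cocompact ℂ, ζ ≠ -I := by
    have := (isCompact_singleton (x := -I)).compl_mem_cocompact
    exact this
  filter_upwards [this] with ζ hζ
  have : ζ + I ≠ 0 := fun h => hζ (eq_neg_of_add_eq_zero_left h)
  unfold cayley
  field_simp
  ring

lemma tendsto_invCayley : Tendsto invCayley (𝓝[≠] 1) (cocompact ℂ) := by
  rw [← Metric.cobounded_eq_cocompact]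
  have h1 : Tendsto (fun w : ℂ => (1 - w)⁻¹) (𝓝[≠] 1) (Bornology.cobounded ℂ) := by
    refine tendsto_inv₀_nhdsNE_zero.comp ?_
    refine tendsto_nhdsWithin_iff.2 ⟨?_, ?_⟩
    · have : Tendsto (fun w : ℂ => 1 - w) (𝓝 1) (𝓝 (1 - 1)) := by
        exact (continuous_const.sub continuous_id).tendsto _
      rw [sub_self] at this
      exact this.mono_left nhdsWithin_le_nhds
    · filter_upwards [self_mem_nhdsWithin] with w hw
      exact sub_ne_zero.2 (Ne.symm hw)
  rw [← tendsto_norm_atTop_iff_cobounded] at h1 ⊢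
  have h2 : Tendsto (fun w : ℂ => ‖I * (1 + w)‖) (𝓝[≠] 1) (𝓝 2) := by
    have : Tendsto (fun w : ℂ => ‖I * (1 + w)‖) (𝓝 1) (𝓝 ‖I * (1 + 1)‖) :=
      Continuous.tendsto (by fun_prop) _
    have e : ‖I * (1 + 1)‖ = 2 := by norm_num
    rw [e] at this
    exact this.mono_left nhdsWithin_le_nhds
  refine (h2.pos_mul_atTop two_pos h1).congr fun w => ?_
  rw [← norm_mul]
  rfl

end Complex

open Metric in
/-- A homeomorphism of the circle fixing `1`, increasing in the half plane coordinate, extends to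
the closed disc by the identity on a horodisc. -/
lemma Complex.exists_disc_extension_of_strictMono {K L : ℂ → ℂ}
    (hK : ContinuousOn K (sphere 0 1)) (hKs : MapsTo K (sphere 0 1) (sphere 0 1))
    (hLs : MapsTo L (sphere 0 1) (sphere 0 1)) (hLK : LeftInvOn L K (sphere 0 1))
    (hKL : LeftInvOn K L (sphere 0 1)) (hK1 : K 1 = 1)
    (hm : StrictMono fun x : ℝ => (invCayley (K (cayley x))).re) :
    ∃ Θ : ℂ → ℂ, ContinuousOn Θ (closedBall 0 1) ∧ BijOn Θ (closedBall 0 1) (closedBall 0 1) ∧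
      EqOn Θ K (sphere 0 1) ∧ ∀ w ∈ ball (1 / 2 : ℂ) (1 / 2), Θ w = w := by
  set χ : ℝ → ℝ := fun x => (invCayley (K (cayley x))).re with hχ
  have h1s : (1:ℂ) ∈ sphere (0:ℂ) 1 := by simp
  have hL1 : L 1 = 1 := by
    have := hLK h1s; rwa [hK1] at this
  have hcs : ∀ x : ℝ, cayley x ∈ sphere (0:ℂ) 1 := fun x => by
    simpa using norm_cayley_eq_one (ζ := x) (by simp)
  have hc1 : ∀ x : ℝ, cayley x ≠ 1 := fun x => cayley_ne_one _ (by simp)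
  have hKne : ∀ w ∈ sphere (0:ℂ) 1, w ≠ 1 → K w ≠ 1 := fun w hw hw1 h => hw1 (by
    rw [← hLK hw, h, hL1])
  have hLne : ∀ w ∈ sphere (0:ℂ) 1, w ≠ 1 → L w ≠ 1 := fun w hw hw1 h => hw1 (by
    rw [← hKL hw, h, hK1])
  have hreal : ∀ w ∈ sphere (0:ℂ) 1, (((invCayley w).re : ℝ) : ℂ) = invCayley w := by
    intro w hw
    have : ‖w‖ = 1 := by simpa using hw
    exact Complex.ext (by simp) (by simp [invCayley_im_eq_zero this])
  have hχc : Continuous χ := by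
    refine Complex.continuous_re.comp ?_
    rw [continuous_iff_continuousAt]
    intro x
    refine ContinuousAt.comp (f := fun x : ℝ => K (cayley x))
      (continuousAt_invCayley (hKne _ (hcs x) (hc1 x))) ?_
    have h1 : Tendsto (fun x : ℝ => cayley x) (𝓝 x) (𝓝[sphere 0 1] cayley x) := by
      refine tendsto_nhdsWithin_iff.2 ⟨?_, Eventually.of_forall hcs⟩
      exact (ContinuousAt.comp (continuousAt_cayley (ζ := x) (by simp))
        Complex.continuous_ofReal.continuousAt)
    exact (hK _ (hcs x)).tendsto.comp h1
  have hχs : Function.Surjective χ := by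
    intro y
    refine ⟨(invCayley (L (cayley y))).re, ?_⟩
    simp only [hχ]
    rw [hreal _ (hLs (hcs y)), cayley_invCayley (hLne _ (hcs y) (hc1 y)), hKL (hcs y),
      invCayley_cayley (by simp)]
    simp
  set c := halfPlaneShear χ with hc
  have hcc : Continuous c := halfPlaneShear.continuous hχc
  have hci := halfPlaneShear.injective hm
  have hcsu := halfPlaneShear.surjective hm hχc hχs
  classical
  set Θ : ℂ → ℂ := fun w => if w = 1 then 1 else cayley (c (invCayley w)) with hΘ
  have hΘ1 : Θ 1 = 1 := by simp [hΘ]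
  have hΘne : ∀ w, w ≠ 1 → Θ w = cayley (c (invCayley w)) := fun w hw => by simp [hΘ, hw]
  have him : ∀ w ∈ closedBall (0:ℂ) 1, 0 ≤ (c (invCayley w)).im := fun w hw => by
    rw [hc, halfPlaneShear.im]; exact invCayley_im_nonneg (by simpa using hw)
  refine ⟨Θ, ?_, ⟨?_, ?_, ?_⟩, ?_, ?_⟩
  · intro w hw
    by_cases hw1 : w = 1
    · subst hw1
      refine ContinuousAt.continuousWithinAt ?_
      rw [continuousAt_iff_punctured_nhds, hΘ1]
      have : Tendsto (fun w => cayley (c (invCayley w))) (𝓝[≠] 1) (𝓝 1) := by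
        refine tendsto_cayley_cocompact.comp (Tendsto.comp (g := c) ?_ tendsto_invCayley)
        rw [← cobounded_eq_cocompact, ← tendsto_norm_atTop_iff_cobounded, cobounded_eq_cocompact]
        exact halfPlaneShear.tendsto_norm hm hχs
      refine this.congr' ?_
      filter_upwards [self_mem_nhdsWithin] with v hv
      exact (hΘne v hv).symm
    · refine ContinuousAt.continuousWithinAt ?_
      have : ContinuousAt (fun w => cayley (c (invCayley w))) w :=
        ContinuousAt.comp (f := fun w => c (invCayley w)) (continuousAt_cayley (him w hw))
          (ContinuousAt.comp (g := c) hcc.continuousAt (continuousAt_invCayley hw1))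
      refine this.congr ?_
      filter_upwards [isOpen_ne.mem_nhds hw1] with v hv
      exact (hΘne v hv).symm
  · intro w hw
    by_cases hw1 : w = 1
    · subst hw1; rwa [hΘ1]
    · rw [hΘne w hw1]
      simpa using norm_cayley_le_one (him w hw)
  · intro w hw v hv hwv
    by_cases hw1 : w = 1 <;> by_cases hv1 : v = 1
    · rw [hw1, hv1]
    · rw [hw1, hΘ1, hΘne v hv1] at hwv
      exact absurd hwv.symm (cayley_ne_one _ (him v hv))
    · rw [hv1, hΘ1, hΘne w hw1] at hwv
      exact absurd hwv (cayley_ne_one _ (him w hw))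
    · rw [hΘne w hw1, hΘne v hv1] at hwv
      have h1 := congrArg invCayley hwv
      rw [invCayley_cayley (him w hw), invCayley_cayley (him v hv)] at h1
      have h2 := congrArg cayley (hci h1)
      rwa [cayley_invCayley hw1, cayley_invCayley hv1] at h2
  · intro w hw
    by_cases hw1 : w = 1
    · exact ⟨1, by simp, by rw [hΘ1, hw1]⟩
    · obtain ⟨ζ, hζ⟩ := hcsu (invCayley w)
      have hζi : 0 ≤ ζ.im := by
        have := congrArg Complex.im hζ
        rw [halfPlaneShear.im] at this
        rw [this]; exact invCayley_im_nonneg (by simpa using hw)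
      refine ⟨cayley ζ, by simpa using norm_cayley_le_one hζi, ?_⟩
      rw [hΘne _ (cayley_ne_one _ hζi), invCayley_cayley hζi, hc, hζ, cayley_invCayley hw1]
  · intro w hw
    by_cases hw1 : w = 1
    · rw [hw1, hΘ1, hK1]
    · have hw' : ‖w‖ = 1 := by simpa using hw
      rw [hΘne _ hw1, hc, halfPlaneShear.eq_of_im_zero (invCayley_im_eq_zero hw')]
      simp only [hχ]
      rw [hreal w hw, cayley_invCayley hw1, hreal _ (hKs hw), cayley_invCayley (hKne _ hw hw1)]
  · intro w hw
    have hw1 : w ≠ 1 := by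
      rintro rfl
      rw [mem_ball_iff_norm] at hw
      norm_num at hw
    rw [hΘne _ hw1, hc, halfPlaneShear.eq_of_one_le (one_le_invCayley_im hw),
      cayley_invCayley hw1]

open Metric ComplexConjugate in
/-- A homeomorphism of the circle fixing `1` extends to the closed disc by the identity or by
the complex conjugation on a horodisc. -/
lemma Complex.exists_disc_extension {K L : ℂ → ℂ}
    (hK : ContinuousOn K (sphere 0 1)) (hKs : MapsTo K (sphere 0 1) (sphere 0 1))
    (hLs : MapsTo L (sphere 0 1) (sphere 0 1)) (hLK : LeftInvOn L K (sphere 0 1))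
    (hKL : LeftInvOn K L (sphere 0 1)) (hK1 : K 1 = 1) :
    ∃ Θ : ℂ → ℂ, ContinuousOn Θ (closedBall 0 1) ∧ BijOn Θ (closedBall 0 1) (closedBall 0 1) ∧
      EqOn Θ K (sphere 0 1) ∧ ((∀ w ∈ ball (1 / 2 : ℂ) (1 / 2), Θ w = w) ∨
        ∀ w ∈ ball (1 / 2 : ℂ) (1 / 2), Θ w = conj w) := by
  have h1s : (1:ℂ) ∈ sphere (0:ℂ) 1 := by simp
  have hcs : ∀ x : ℝ, cayley x ∈ sphere (0:ℂ) 1 := fun x => by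
    simpa using norm_cayley_eq_one (ζ := x) (by simp)
  have hc1 : ∀ x : ℝ, cayley x ≠ 1 := fun x => cayley_ne_one _ (by simp)
  have hKne : ∀ w ∈ sphere (0:ℂ) 1, w ≠ 1 → K w ≠ 1 := fun w hw hw1 h => hw1 (by
    have := hLK hw
    rw [h] at this
    rw [← this, ← hK1, hLK h1s, hK1])
  have hreal : ∀ w ∈ sphere (0:ℂ) 1, (((invCayley w).re : ℝ) : ℂ) = invCayley w := by
    intro w hw
    have : ‖w‖ = 1 := by simpa using hw
    exact Complex.ext (by simp) (by simp [invCayley_im_eq_zero this])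
  have hχc : Continuous fun x : ℝ => (invCayley (K (cayley x))).re := by
    refine Complex.continuous_re.comp ?_
    rw [continuous_iff_continuousAt]
    intro x
    refine ContinuousAt.comp (f := fun x : ℝ => K (cayley x))
      (continuousAt_invCayley (hKne _ (hcs x) (hc1 x))) ?_
    have h1 : Tendsto (fun x : ℝ => cayley x) (𝓝 x) (𝓝[sphere 0 1] cayley x) := by
      refine tendsto_nhdsWithin_iff.2 ⟨?_, Eventually.of_forall hcs⟩
      exact (ContinuousAt.comp (continuousAt_cayley (ζ := x) (by simp))
        Complex.continuous_ofReal.continuousAt)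
    exact (hK _ (hcs x)).tendsto.comp h1
  have hχi : Function.Injective fun x : ℝ => (invCayley (K (cayley x))).re := by
    intro x y hxy
    have h1 : invCayley (K (cayley x)) = invCayley (K (cayley y)) := by
      rw [← hreal _ (hKs (hcs x)), ← hreal _ (hKs (hcs y))]
      exact congrArg _ hxy
    have h2 := congrArg cayley h1
    rw [cayley_invCayley (hKne _ (hcs x) (hc1 x)), cayley_invCayley (hKne _ (hcs y) (hc1 y))] at h2
    have h3 := congrArg invCayley (hLK.injOn (hcs x) (hcs y) h2)
    rw [invCayley_cayley (by simp), invCayley_cayley (by simp)] at h3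
    exact_mod_cast h3
  rcases hχc.strictMono_of_inj hχi with hm | hm
  · obtain ⟨Θ, h1, h2, h3, h4⟩ :=
      exists_disc_extension_of_strictMono hK hKs hLs hLK hKL hK1 hm
    exact ⟨Θ, h1, h2, h3, Or.inl h4⟩
  · have hconj : ∀ w, invCayley (conj w) = - conj (invCayley w) := by
      intro w
      simp only [invCayley, map_div₀, map_mul, map_add, map_sub, map_one, conj_I]
      ring
    have hms : MapsTo (fun w : ℂ => conj w) (sphere 0 1) (sphere 0 1) := fun w hw => by
      simpa using hw
    have hmc : MapsTo (fun w : ℂ => conj w) (closedBall 0 1) (closedBall 0 1) := fun w hw => by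
      simpa using hw
    obtain ⟨Θ, h1, h2, h3, h4⟩ :=
      exists_disc_extension_of_strictMono (K := fun w => conj (K w)) (L := fun w => L (conj w))
        (continuous_conj.comp_continuousOn hK) (fun w hw => hms (hKs hw))
        (fun w hw => hLs (hms hw)) (fun w hw => by simp [hLK hw])
        (fun w hw => by simp [hKL (hms hw)]) (by simp [hK1]) (by
          intro x y hxy
          have := hm hxy
          simp only [hconj] at this ⊢
          simpa using this)
    refine ⟨fun w => conj (Θ w), continuous_conj.comp_continuousOn h1, ?_, ?_, Or.inr ?_⟩
    · refine BijOn.comp (t := closedBall 0 1) ⟨hmc, ?_, ?_⟩ h2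
      · exact (star_injective (R := ℂ)).injOn
      · intro w hw
        exact ⟨conj w, hmc hw, by simp⟩
    · intro w hw
      simp [h3 hw]
    · intro w hw
      simp [h4 w hw]

open Metric in
/-- A self-bijection of the closed unit disc which is the identity on the boundary extends to a
homeomorphism of the plane. -/
lemma Complex.exists_homeomorph_eqOn_closedBall {T : ℂ → ℂ} (hT : ContinuousOn T (closedBall 0 1))
    (hb : BijOn T (closedBall 0 1) (closedBall 0 1)) (hs : ∀ z ∈ sphere (0:ℂ) 1, T z = z) :
    ∃ τ : ℂ ≃ₜ ℂ, EqOn τ T (closedBall 0 1) ∧ ∀ z ∉ ball (0:ℂ) 1, τ z = z := by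
  classical
  set S : ℂ → ℂ := (closedBall (0:ℂ) 1).piecewise T id with hS
  have h1 : EqOn S T (closedBall 0 1) := piecewise_eqOn _ _ _
  have h2 : ∀ z ∉ ball (0:ℂ) 1, S z = z := by
    intro z hz
    by_cases hz' : z ∈ closedBall (0:ℂ) 1
    · rw [h1 hz']
      apply hs
      rw [← ball_union_sphere] at hz'
      exact hz'.resolve_left hz
    · simp [hS, hz']
  have h3 : ∀ z ∉ closedBall (0:ℂ) 1, S z = z := fun z hz =>
    h2 z (fun h => hz (ball_subset_closedBall h))
  have hc : Continuous S := by
    refine continuous_piecewise ?_ (by rwa [isClosed_closedBall.closure_eq]) continuousOn_id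
    intro z hz
    rw [frontier_closedBall _ one_ne_zero] at hz
    exact hs z hz
  have hinj : Function.Injective S := by
    intro a b hab
    by_cases ha : a ∈ closedBall (0:ℂ) 1 <;> by_cases hb' : b ∈ closedBall (0:ℂ) 1
    · rw [h1 ha, h1 hb'] at hab
      exact hb.injOn ha hb' hab
    · rw [h1 ha, h3 b hb'] at hab
      exact absurd (hab ▸ hb.mapsTo ha) hb'
    · rw [h1 hb', h3 a ha] at hab
      exact absurd (hab ▸ hb.mapsTo hb') ha
    · rwa [h3 a ha, h3 b hb'] at hab
  have hsurj : Function.Surjective S := by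
    intro b
    by_cases hb' : b ∈ closedBall (0:ℂ) 1
    · obtain ⟨a, ha, rfl⟩ := hb.surjOn hb'
      exact ⟨a, h1 ha⟩
    · exact ⟨b, h3 b hb'⟩
  have hprop : IsProperMap S := by
    rw [isProperMap_iff_tendsto_cocompact]
    refine ⟨hc, tendsto_id.congr' ?_⟩
    filter_upwards [(isCompact_closedBall (0:ℂ) 1).compl_mem_cocompact] with z hz
    exact (h3 z hz).symm
  refine ⟨(Equiv.ofBijective S ⟨hinj, hsurj⟩).toHomeomorphOfContinuousClosed hc
    hprop.isClosedMap, fun z hz => h1 hz, fun z hz => h2 z hz⟩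

open Metric ComplexConjugate in
/-- A homeomorphism of the plane can be modified inside the unit disc so as to be conformal or
anticonformal on the horodisc at `1`. -/
lemma Homeomorph.exists_eq_compl_ball_and_conformal (g : ℂ ≃ₜ ℂ) :
    ∃ (G : ℂ ≃ₜ ℂ) (f : ℂ → ℂ), DifferentiableOn ℂ f (ball 0 1) ∧
      (∀ w ∈ ball (0:ℂ) 1, deriv f w ≠ 0) ∧ (∀ w ∉ ball (0:ℂ) 1, G w = g w) ∧
      ((∀ w ∈ ball (1 / 2 : ℂ) (1 / 2), G w = f w) ∨
        ∀ w ∈ ball (1 / 2 : ℂ) (1 / 2), G w = f (conj w)) := by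
  obtain ⟨f, k, hm, hd⟩ := g.exists_isConformalModel
  obtain ⟨K, L, hK, hL, hKb, hLb, hKs, hLs, hLK, hKL, hKk⟩ := hm.exists_extension
  set α := K 1 with hα
  have hα1 : ‖α‖ = 1 := by simpa using hKs (show (1:ℂ) ∈ sphere (0:ℂ) 1 by simp)
  have hαα : conj α * α = 1 := by
    rw [← Complex.normSq_eq_conj_mul_self, Complex.normSq_eq_norm_sq, hα1]; simp
  have hααw : ∀ w, conj α * (α * w) = w := fun w => by rw [← mul_assoc, hαα, one_mul]
  have hααw' : ∀ w, α * (conj α * w) = w := fun w => by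
    rw [← mul_assoc, mul_comm α, hαα, one_mul]
  have hrc : MapsTo (fun w => α * w) (closedBall 0 1) (closedBall 0 1) := fun w hw => by
    simpa [hα1] using hw
  have hrb : MapsTo (fun w => α * w) (ball 0 1) (ball 0 1) := fun w hw => by
    simpa [hα1] using hw
  have hrs : MapsTo (fun w => α * w) (sphere 0 1) (sphere 0 1) := fun w hw => by
    simpa [hα1] using hw
  have hrs' : MapsTo (fun w => conj α * w) (sphere 0 1) (sphere 0 1) := fun w hw => by
    simpa [hα1] using hw
  have hrc' : MapsTo (fun w => conj α * w) (closedBall 0 1) (closedBall 0 1) := fun w hw => by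
    simpa [hα1] using hw
  have hsc : sphere (0:ℂ) 1 ⊆ closedBall 0 1 := sphere_subset_closedBall
  have hKc : MapsTo K (closedBall 0 1) (closedBall 0 1) := by
    intro z hz
    rw [← ball_union_sphere] at hz ⊢
    exact hz.imp (fun h => hKb h) (fun h => hKs h)
  have hLc : MapsTo L (closedBall 0 1) (closedBall 0 1) := by
    intro z hz
    rw [← ball_union_sphere] at hz ⊢
    exact hz.imp (fun h => hLb h) (fun h => hLs h)
  obtain ⟨Θ, hΘc, hΘb, hΘs, hΘ⟩ := Complex.exists_disc_extension
    (K := fun w => conj α * K w) (L := fun w => L (α * w))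
    (continuousOn_const.mul (hK.mono hsc)) (fun w hw => hrs' (hKs hw)) (fun w hw => hLs (hrs hw))
    (fun w hw => by simp [hααw', hLK (hsc hw)]) (fun w hw => by
      simp only [hKL (hsc (hrs hw)), hααw]) (by simpa using hαα)
  have hLα : ContinuousOn (fun w => L (α * w)) (closedBall 0 1) :=
    hL.comp (continuousOn_const.mul continuousOn_id) hrc
  have hLαb : BijOn (fun w => L (α * w)) (closedBall 0 1) (closedBall 0 1) := by
    refine ⟨fun w hw => hLc (hrc hw), ?_, ?_⟩
    · intro w hw v hv hwv
      have := hKL.injOn (hrc hw) (hrc hv) hwv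
      rw [← hααw w, ← hααw v]
      exact congrArg _ this
    · intro w hw
      exact ⟨conj α * K w, hrc' (hKc hw), by simp [hααw', hLK hw]⟩
  obtain ⟨τ, hτ, hτo⟩ := Complex.exists_homeomorph_eqOn_closedBall
    (T := fun w => L (α * Θ w)) (hLα.comp hΘc hΘb.mapsTo) (hLαb.comp hΘb) (by
      intro z hz
      simp only [hΘs hz, hααw', hLK (hsc hz)])
  have hhoro : ball (1 / 2 : ℂ) (1 / 2) ⊆ ball 0 1 := by
    apply ball_subset_ball'
    norm_num [dist_eq_norm]
  have hkey : ∀ w ∈ ball (0:ℂ) 1, g (L (α * w)) = f (α * w) := by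
    intro w hw
    have h1 := hLb (hrb hw)
    rw [← hm.comp_eq _ h1, ← hKk h1, hKL (ball_subset_closedBall (hrb hw))]
  refine ⟨τ.trans g, fun w => f (α * w), ?_, ?_, ?_, ?_⟩
  · exact hm.differentiableOn.comp (by fun_prop) hrb
  · intro w hw
    have h1 := hm.differentiableOn.differentiableAt (isOpen_ball.mem_nhds (hrb hw))
    have h2 : HasDerivAt (fun w => f (α * w)) (deriv f (α * w) * α) w := by
      have h3 : HasDerivAt (fun w => α * w) α w := by
        simpa using (hasDerivAt_id w).const_mul α
      exact h1.hasDerivAt.comp w h3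
    rw [h2.deriv]
    refine mul_ne_zero (hd _ (hrb hw)) ?_
    rw [← norm_ne_zero_iff, hα1]; exact one_ne_zero
  · intro w hw
    simp [hτo w hw]
  · have hmain : ∀ w ∈ ball (1 / 2 : ℂ) (1 / 2), Θ w ∈ ball (0:ℂ) 1 →
        (τ.trans g) w = f (α * Θ w) := by
      intro w hw h
      rw [Homeomorph.trans_apply, hτ (ball_subset_closedBall (hhoro hw))]
      exact hkey _ h
    rcases hΘ with h | h
    · left
      intro w hw
      rw [hmain w hw (by rw [h w hw]; exact hhoro hw), h w hw]
    · right
      intro w hw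
      rw [hmain w hw (by rw [h w hw]; simpa using hhoro hw), h w hw]

lemma Convex.exists_log {E : Type*} [NormedAddCommGroup E] [NormedSpace ℝ E] {U : Set E}
    (hc : Convex ℝ U) (ho : IsOpen U) (hne : U.Nonempty) {F : E → ℂ} (hF : ContinuousOn F U)
    (h0 : ∀ x ∈ U, F x ≠ 0) :
    ∃ A : E → ℂ, ContinuousOn A U ∧ ∀ x ∈ U, Complex.exp (A x) = F x := by
  have h1 : IsSimplyConnected U := by
    have := hc.contractibleSpace hne
    exact SimplyConnectedSpace.ofContractible _
  obtain ⟨A, hA, hAe⟩ := Complex.exists_continuousOn_eqOn_exp_comp h1 ho hF (by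
    rintro ⟨x, hx, hx0⟩
    exact h0 x hx hx0)
  exact ⟨A, hA, hAe⟩

lemma IsPreconnected.exists_int_log_sub {X : Type*} [TopologicalSpace X] {S : Set X}
    (hS : IsPreconnected S) {A B : X → ℂ} (hA : ContinuousOn A S) (hB : ContinuousOn B S)
    (h : ∀ x ∈ S, Complex.exp (A x) = Complex.exp (B x)) :
    ∃ n : ℤ, ∀ x ∈ S, A x = B x + n * (2 * Real.pi * Complex.I) := by
  rcases S.eq_empty_or_nonempty with rfl | ⟨x₀, hx₀⟩
  · exact ⟨0, by simp⟩
  have h1 : ∀ x ∈ S, ∃ n : ℤ, A x = B x + n * (2 * Real.pi * Complex.I) := fun x hx =>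
    Complex.exp_eq_exp_iff_exists_int.1 (h x hx)
  choose! N hN using h1
  set r : X → ℝ := fun x => ((A x - B x) / (2 * Real.pi * Complex.I)).re with hr
  have hrc : ContinuousOn r S :=
    Complex.continuous_re.comp_continuousOn ((hA.sub hB).div_const _)
  have hrN : ∀ x ∈ S, r x = N x := by
    intro x hx
    have : (A x - B x) / (2 * Real.pi * Complex.I) = N x := by
      rw [hN x hx, add_sub_cancel_left, mul_div_assoc, div_self Complex.two_pi_I_ne_zero, mul_one]
    simp [hr, this]
  have key : ∀ x ∈ S, ∀ y ∈ S, ¬ N x < N y := by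
    intro x hx y hy hlt
    have h2 : (N x : ℝ) + 1 / 2 ∈ Icc (r x) (r y) := by
      rw [hrN x hx, hrN y hy]
      have : (N x : ℝ) + 1 ≤ N y := by exact_mod_cast hlt
      constructor <;> linarith
    obtain ⟨z, hz, hzr⟩ := hS.intermediate_value hx hy hrc h2
    rw [hrN z hz] at hzr
    have h3 : ((2 * N z : ℤ) : ℝ) = ((2 * N x + 1 : ℤ) : ℝ) := by push_cast; linarith
    have h4 : 2 * N z = 2 * N x + 1 := by exact_mod_cast h3
    omega
  refine ⟨N x₀, fun x hx => ?_⟩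
  have : N x = N x₀ := le_antisymm (not_lt.1 (key _ hx₀ _ hx)) (not_lt.1 (key _ hx _ hx₀))
  rw [← this]
  exact hN x hx

namespace Complex

/-- A map of the plane joined to the identity by a continuous family of injections. -/
def IsotopicToIdMap (h : ℂ → ℂ) : Prop :=
  ∃ H : ℝ → ℂ → ℂ, Continuous (fun p : ℝ × ℂ => H p.1 p.2) ∧ (∀ u, Function.Injective (H u)) ∧
    H 0 = id ∧ H 1 = h

/-- The local index of an injective map is `k`. -/
def HasIndex (g : ℂ → ℂ) (k : ℤ) : Prop :=
  ∃ A : ℂ × ℂ → ℂ, Continuous A ∧ (∀ p ζ, exp (A (p, ζ)) = g (p + exp ζ) - g p) ∧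
    ∀ p ζ, A (p, ζ + 2 * Real.pi * I) = A (p, ζ) + k * (2 * Real.pi * I)

lemma exists_log_family {H : ℝ → ℂ → ℂ} (hH : Continuous (fun p : ℝ × ℂ => H p.1 p.2))
    (hi : ∀ u, Function.Injective (H u)) :
    ∃ (k : ℤ) (A : ℝ × ℂ × ℂ → ℂ), Continuous A ∧
      (∀ u p ζ, exp (A (u, p, ζ)) = H u (p + exp ζ) - H u p) ∧
      ∀ u p ζ, A (u, p, ζ + 2 * Real.pi * I) = A (u, p, ζ) + k * (2 * Real.pi * I) := by
  obtain ⟨A, hA, hAe⟩ := (convex_univ (𝕜 := ℝ) (E := ℝ × ℂ × ℂ)).exists_log isOpen_univ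
    univ_nonempty (F := fun q => H q.1 (q.2.1 + exp q.2.2) - H q.1 q.2.1) (by
      refine Continuous.continuousOn ?_
      refine Continuous.sub (hH.comp (f := fun q : ℝ × ℂ × ℂ => (q.1, q.2.1 + exp q.2.2)) ?_)
        (hH.comp (f := fun q : ℝ × ℂ × ℂ => (q.1, q.2.1)) ?_) <;> fun_prop)
    (fun q _ => sub_ne_zero.2 fun h => exp_ne_zero q.2.2 (by simpa using hi _ h))
  rw [continuousOn_univ] at hA
  obtain ⟨k, hk⟩ := isPreconnected_univ.exists_int_log_sub (X := ℝ × ℂ × ℂ)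
    (A := fun q => A (q.1, q.2.1, q.2.2 + 2 * Real.pi * I)) (B := A)
    (Continuous.continuousOn (by fun_prop)) hA.continuousOn (fun q _ => by
      rw [hAe _ (mem_univ _), hAe _ (mem_univ _)]
      simp [exp_periodic _])
  exact ⟨k, A, hA, fun u p ζ => hAe _ (mem_univ _), fun u p ζ => hk (u, p, ζ) (mem_univ _)⟩

lemma exists_hasIndex {g : ℂ → ℂ} (hg : Continuous g) (hi : Function.Injective g) :
    ∃ k, HasIndex g k := by
  obtain ⟨k, A, hA, hAe, hAk⟩ := exists_log_family (H := fun _ => g)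
    (hg.comp continuous_snd) (fun _ => hi)
  exact ⟨k, fun q => A (0, q), by fun_prop, fun p ζ => hAe 0 p ζ, fun p ζ => hAk 0 p ζ⟩

/-- Computation of the index from a logarithm of `g (p + r * exp (θ * I)) - g p`. -/
lemma HasIndex.eq_of_log {g : ℂ → ℂ} {k m : ℤ} (hk : HasIndex g k) {p : ℂ} (r : ℝ) {B : ℝ → ℂ}
    (hB : Continuous B) (hBe : ∀ θ : ℝ, exp (B θ) = g (p + exp (r + θ * I)) - g p)
    (hm : B (2 * Real.pi) = B 0 + m * (2 * Real.pi * I)) : k = m := by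
  obtain ⟨A, hA, hAe, hAk⟩ := hk
  obtain ⟨n, hn⟩ := isPreconnected_univ.exists_int_log_sub (X := ℝ)
    (A := fun θ => A (p, r + θ * I)) (B := B) (Continuous.continuousOn (by fun_prop))
    hB.continuousOn (fun θ _ => by rw [hAe, hBe])
  have h0 := hn 0 (mem_univ _)
  have h1 := hn (2 * Real.pi) (mem_univ _)
  have h2 := hAk p r
  simp only [ofReal_zero, zero_mul, add_zero, ofReal_mul, ofReal_ofNat] at h0 h1
  rw [h1, h0, hm] at h2
  have h3 : (m : ℂ) * (2 * Real.pi * I) = k * (2 * Real.pi * I) := by linear_combination h2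
  have := mul_right_cancel₀ two_pi_I_ne_zero h3
  exact_mod_cast this.symm

lemma IsotopicToIdMap.hasIndex {h : ℂ → ℂ} (hh : IsotopicToIdMap h) : HasIndex h 1 := by
  obtain ⟨H, hc, hi, h0, h1⟩ := hh
  obtain ⟨k, A, hA, hAe, hAk⟩ := exists_log_family hc hi
  have hid : HasIndex id k :=
    ⟨fun q => A (0, q), by fun_prop, fun p ζ => by rw [hAe, h0], fun p ζ => hAk 0 p ζ⟩
  have hk : k = 1 := hid.eq_of_log (p := 0) 0 (B := fun θ => θ * I) (by fun_prop) (by simp)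
    (by simp)
  subst hk
  exact ⟨fun q => A (1, q), by fun_prop, fun p ζ => by rw [hAe, h1], fun p ζ => hAk 1 p ζ⟩

lemma HasIndex.eq_of_eq_compl_ball {g h : ℂ → ℂ} {k m : ℤ} (hg : HasIndex g k)
    (hh : HasIndex h m) (he : ∀ z ∉ Metric.ball (0:ℂ) 1, g z = h z) : k = m := by
  obtain ⟨B, hB, hBe, hBm⟩ := hh
  refine hg.eq_of_log (p := 2) (Real.log 10) (B := fun θ => B (2, Real.log 10 + θ * I))
    (by fun_prop) ?_ ?_
  · intro θ
    rw [hBe, he, he]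
    · norm_num
    · have h1 : ‖exp (Real.log 10 + θ * I)‖ = 10 := by
        rw [norm_exp, add_re, ofReal_re, re_ofReal_mul, I_re, mul_zero, add_zero,
          Real.exp_log (by norm_num)]
      have h2 := norm_sub_le (2 + exp (Real.log 10 + θ * I)) 2
      rw [add_sub_cancel_left, h1] at h2
      rw [norm_ofNat] at h2
      simp only [mem_ball_zero_iff, not_lt]
      linarith
  · simpa using hBm 2 (Real.log 10)

lemma HasIndex.eq_one_of_hasDerivAt {g f : ℂ → ℂ} {k : ℤ} (hg : HasIndex g k) {p d : ℂ}
    (hf : HasDerivAt f d p) (hd : d ≠ 0) (he : f =ᶠ[𝓝 p] g) (hgc : Continuous g) : k = 1 := by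
  have hgd : HasDerivAt g d p := hf.congr_of_eventuallyEq he.symm
  have h1 := hasDerivAt_iff_tendsto_slope.1 hgd
  rw [Metric.tendsto_nhds] at h1
  have h2 := h1 ‖d‖ (norm_pos_iff.2 hd)
  rw [eventually_nhdsWithin_iff, Metric.eventually_nhds_iff] at h2
  obtain ⟨ε, hε, h2⟩ := h2
  set r := Real.log (ε / 2) with hr
  have hq : ∀ θ : ℝ, ‖exp (r + θ * I)‖ = ε / 2 := fun θ => by
    rw [norm_exp]; simp [hr, Real.exp_log (half_pos hε)]
  set s : ℝ → ℂ := fun θ => (g (p + exp (r + θ * I)) - g p) / exp (r + θ * I) / d with hs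
  have hsc : Continuous s := by
    have hne : ∀ θ : ℝ, exp (r + θ * I) ≠ 0 := fun θ => exp_ne_zero _
    refine Continuous.div_const (Continuous.div ?_ (by fun_prop) hne) _
    fun_prop
  have hslit : ∀ θ, s θ ∈ slitPlane := by
    intro θ
    have h3 := h2 (y := p + exp (r + θ * I)) (by
      rw [dist_eq_norm, add_sub_cancel_left, hq]; linarith) (by simp)
    have h4 : ‖s θ - 1‖ < 1 := by
      have : s θ - 1 = (slope g p (p + exp (r + θ * I)) - d) / d := by
        rw [slope_def_field, add_sub_cancel_left]
        simp only [hs]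
        field_simp
      rw [this, norm_div, div_lt_one (norm_pos_iff.2 hd), ← dist_eq_norm]
      exact h3
    exact ball_one_subset_slitPlane (by rwa [mem_ball_iff_norm])
  refine hg.eq_of_log (p := p) r (B := fun θ => log (s θ) + log d + (r + θ * I)) ?_ ?_ ?_
  · have : Continuous fun θ => log (s θ) := hsc.clog hslit
    fun_prop
  · intro θ
    rw [exp_add, exp_add, exp_log (slitPlane_ne_zero (hslit θ)), exp_log hd]
    simp only [hs]
    have := exp_ne_zero (r + θ * I)
    field_simp
  · have : s (2 * Real.pi) = s 0 := by
      simp only [hs, ofReal_mul, ofReal_ofNat, ofReal_zero, zero_mul, add_zero, exp_periodic _]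
    rw [this]
    push_cast
    ring

open ComplexConjugate in
lemma HasIndex.comp_conj {g : ℂ → ℂ} {k : ℤ} (hg : HasIndex g k) :
    HasIndex (fun w => g (conj w)) (-k) := by
  obtain ⟨A, hA, hAe, hAk⟩ := hg
  refine ⟨fun q => A (conj q.1, conj q.2), by fun_prop, fun p ζ => ?_, fun p ζ => ?_⟩
  · simp only [hAe, exp_conj, map_add]
  · have := hAk (conj p) (conj ζ - 2 * Real.pi * I)
    rw [sub_add_cancel] at this
    simp only [map_add, map_mul, conj_I, conj_ofReal, map_ofNat]
    rw [this, mul_neg, ← sub_eq_add_neg]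
    push_cast
    ring

end Complex

open Metric Complex ComplexConjugate in
/-- An orientation preserving homeomorphism of the plane can be modified inside the unit disc so
as to be conformal on the horodisc at `1`. -/
lemma Homeomorph.exists_conformal_on_horodisc (g : ℂ ≃ₜ ℂ) (hg : IsotopicToIdMap g) :
    ∃ G : ℂ ≃ₜ ℂ, (∀ w ∉ ball (0:ℂ) 1, G w = g w) ∧
      DifferentiableOn ℂ G (ball (1 / 2 : ℂ) (1 / 2)) ∧
      ∀ w ∈ ball (1 / 2 : ℂ) (1 / 2), deriv G w ≠ 0 := by
  obtain ⟨G, f, hf, hd, he, h⟩ := g.exists_eq_compl_ball_and_conformal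
  obtain ⟨k, hk⟩ := exists_hasIndex G.continuous G.injective
  have hk1 : k = 1 := hk.eq_of_eq_compl_ball hg.hasIndex he
  subst hk1
  have hhoro : ball (1 / 2 : ℂ) (1 / 2) ⊆ ball 0 1 := by
    apply ball_subset_ball'
    norm_num [dist_eq_norm]
  have hmem : (1 / 2 : ℂ) ∈ ball (1 / 2 : ℂ) (1 / 2) := by simp
  refine ⟨G, he, ?_⟩
  rcases h with h | h
  · refine ⟨(hf.mono hhoro).congr h, fun w hw => ?_⟩
    have : (G : ℂ → ℂ) =ᶠ[𝓝 w] f := by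
      filter_upwards [isOpen_ball.mem_nhds hw] with v hv
      exact h v hv
    rw [this.deriv_eq]
    exact hd w (hhoro hw)
  · exfalso
    have h1 := hk.comp_conj.eq_one_of_hasDerivAt (p := 1 / 2) (f := f)
      (hf.differentiableAt (isOpen_ball.mem_nhds (hhoro hmem))).hasDerivAt (hd _ (hhoro hmem)) (by
        filter_upwards [isOpen_ball.mem_nhds hmem] with v hv
        have hv' : conj v ∈ ball (1 / 2 : ℂ) (1 / 2) := by
          have h2 : conj (1 / 2 : ℂ) = 1 / 2 := by
            rw [map_div₀, map_one, Complex.conj_ofNat]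
          rw [mem_ball_iff_norm] at hv ⊢
          rw [← norm_conj, map_sub, conj_conj, h2]
          exact hv
        rw [h _ hv', conj_conj]) (by fun_prop)
    norm_num at h1

namespace Complex

/-- A translation curve has no shortest return. -/
lemma IsotopicToIdMap.false_of_minimal_loop {h : ℂ → ℂ} (hh : IsotopicToIdMap h)
    (hf : ∀ z, h z ≠ z) {l : ℝ → ℂ} (hl : Continuous l) (he : ∀ s, l (s + 1) = h (l s))
    {L : ℝ} (hL : 1 < L) (h0 : l 0 = l L) (hne : ∀ s t, s < t → t - s < L → l s ≠ l t) : False := by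
  obtain ⟨H, hc, hi, hH0, hH1⟩ := hh
  have hcont : Continuous h := by
    have : Continuous fun z : ℂ => H 1 z := hc.comp (Continuous.prodMk_right (1:ℝ))
    rwa [hH1] at this
  set U : Set (ℝ × ℝ × ℝ) := {q | q.2.1 < q.2.2 ∧ q.2.2 - q.2.1 < L} with hU
  have hUo : IsOpen U :=
    IsOpen.and (isOpen_lt (f := fun q : ℝ × ℝ × ℝ => q.2.1) (by fun_prop) (by fun_prop))
      (isOpen_lt (f := fun q : ℝ × ℝ × ℝ => q.2.2 - q.2.1) (by fun_prop) (by fun_prop))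
  have hUc : Convex ℝ U := by
    rintro ⟨u, s, t⟩ ⟨h1, h2⟩ ⟨u', s', t'⟩ ⟨h1', h2'⟩ a b ha hb hab
    simp only at h1 h2 h1' h2'
    simp only [hU, mem_ofPred_eq, Prod.smul_mk, Prod.mk_add_mk, smul_eq_mul]
    obtain rfl : b = 1 - a := by linarith
    constructor
    · rcases ha.eq_or_lt with rfl | ha
      · simpa using h1'
      · nlinarith
    · rcases ha.eq_or_lt with rfl | ha
      · simpa using h2'
      · nlinarith
  obtain ⟨A, hA, hAe⟩ := hUc.exists_log hUo ⟨(0, 0, 1), by simp [hU, hL]⟩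
    (F := fun q => H q.1 (l q.2.2) - H q.1 (l q.2.1)) (by
      refine Continuous.continuousOn ?_
      refine Continuous.sub (hc.comp (f := fun q : ℝ × ℝ × ℝ => (q.1, l q.2.2)) ?_)
        (hc.comp (f := fun q : ℝ × ℝ × ℝ => (q.1, l q.2.1)) ?_) <;> fun_prop)
    (fun q hq => sub_ne_zero.2 fun h' => hne _ _ hq.1 hq.2 (hi _ h').symm)
  have hmaps : ∀ {X : Type} [TopologicalSpace X] {S : Set X} {φ : X → ℝ × ℝ × ℝ},
      Continuous φ → MapsTo φ S U → ContinuousOn (fun x => A (φ x)) S :=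
    fun hφ hm => hA.comp hφ.continuousOn hm
  -- the isotopy shifts both parameters by one
  have hVc : IsPreconnected {q : ℝ × ℝ | q.1 < q.2 ∧ q.2 - q.1 < L} := by
    have hcv : Convex ℝ {q : ℝ × ℝ | q.1 < q.2 ∧ q.2 - q.1 < L} := by
      rintro ⟨s, t⟩ ⟨h1, h2⟩ ⟨s', t'⟩ ⟨h1', h2'⟩ a b ha hb hab
      simp only at h1 h2 h1' h2'
      simp only [mem_ofPred_eq, Prod.smul_mk, Prod.mk_add_mk, smul_eq_mul]
      obtain rfl : b = 1 - a := by linarith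
      constructor
      · rcases ha.eq_or_lt with rfl | ha
        · simpa using h1'
        · nlinarith
      · rcases ha.eq_or_lt with rfl | ha
        · simpa using h2'
        · nlinarith
    exact hcv.isPreconnected
  obtain ⟨n, hn⟩ := hVc.exists_int_log_sub
    (A := fun q => A (1, q.1, q.2)) (B := fun q => A (0, q.1 + 1, q.2 + 1))
    (hmaps (by fun_prop) (fun q hq => hq))
    (hmaps (by fun_prop) (fun q hq => ⟨by linarith [hq.1], by
      have := hq.2
      simp only
      linarith⟩))
    (fun q hq => by
      rw [hAe _ (show ((1:ℝ), q.1, q.2) ∈ U from hq), hAe _ (show ((0:ℝ), q.1 + 1, q.2 + 1) ∈ U from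
        ⟨by linarith [hq.1], by have := hq.2; simp only; linarith⟩)]
      simp [hH0, hH1, he])
  -- the pinched loop reverses the direction
  obtain ⟨m, hm⟩ := ((convex_univ (𝕜 := ℝ) (E := ℝ)).prod
    (convex_Ioo 0 L)).isPreconnected.exists_int_log_sub
    (A := fun q : ℝ × ℝ => A (q.1, q.2, L)) (B := fun q => A (q.1, 0, q.2) + Real.pi * I)
    (hmaps (by fun_prop) (fun q hq => ⟨hq.2.2, by have := hq.2.1; simp only; linarith⟩))
    ((hmaps (by fun_prop) (fun q hq => ⟨hq.2.1, by simpa using hq.2.2⟩)).add continuousOn_const)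
    (fun q hq => by
      rw [exp_add, exp_pi_mul_I,
        hAe _ (show (q.1, q.2, L) ∈ U from ⟨hq.2.2, by have := hq.2.1; simp only; linarith⟩),
        hAe _ (show (q.1, 0, q.2) ∈ U from ⟨hq.2.1, by simpa using hq.2.2⟩)]
      simp only [← h0]
      ring)
  -- the displacement has a logarithm
  obtain ⟨B, hB, hBe⟩ := (convex_univ (𝕜 := ℝ) (E := ℂ)).exists_log isOpen_univ univ_nonempty
    (F := fun z => h z - z) (by fun_prop) (fun z _ => sub_ne_zero.2 (hf z))
  rw [continuousOn_univ] at hB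
  obtain ⟨j, hj⟩ := (isPreconnected_univ (α := ℝ)).exists_int_log_sub
    (A := fun s => A (0, s, s + 1)) (B := fun s => B (l s))
    (hmaps (by fun_prop) (fun q _ => ⟨by simp, by simpa using hL⟩))
    (Continuous.continuousOn (by fun_prop))
    (fun s _ => by
      rw [hAe _ ⟨by simp, by simpa using hL⟩, hBe _ (mem_univ _)]
      simp [hH0, he])
  have e1 := hm (0, 1) ⟨mem_univ _, by simp, hL⟩
  have e2 := hm (1, L - 1) ⟨mem_univ _, by simpa using hL, by simp⟩
  have e3 := hn (L - 1, L) ⟨by simp, by simp; linarith⟩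
  have e4 := hn (0, L - 1) ⟨by simpa using hL, by simp⟩
  have e5 := hj 0 (mem_univ _)
  have e6 := hj L (mem_univ _)
  simp only [zero_add, sub_add_cancel] at e1 e2 e3 e4 e5 e6
  rw [h0] at e5
  have : (2 * m + 1 : ℂ) * (2 * Real.pi * I) = 0 := by
    linear_combination e3 + e6 - e4 - e2 - e1 - e5
  rcases mul_eq_zero.1 this with h1 | h1
  · have : 2 * m + 1 = 0 := by exact_mod_cast h1
    omega
  · exact two_pi_I_ne_zero h1

theorem IsotopicToIdMap.injective_of_equivariant {h : ℂ → ℂ} (hh : IsotopicToIdMap h)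
    (hhi : Function.Injective h)
    (hf : ∀ z, h z ≠ z) {l : ℝ → ℂ} (hl : Continuous l) (he : ∀ s, l (s + 1) = h (l s))
    (hloc : ∀ s t, s < t → t - s ≤ 1 → l s ≠ l t) : Function.Injective l := by
  have hnat : ∀ (n : ℕ) s t, l s = l t ↔ l (s + n) = l (t + n) := by
    intro n
    induction n with
    | zero => simp
    | succ n ih =>
      intro s t
      push_cast
      rw [ih, ← add_assoc, ← add_assoc, he, he, hhi.eq_iff]
  have h_int : ∀ (n : ℤ) s t, l s = l t → l (s + n) = l (t + n) := by
    intro n s t hst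
    obtain ⟨n, rfl | rfl⟩ := n.eq_nat_or_neg
    · exact_mod_cast (hnat n s t).1 hst
    · rw [hnat n]
      push_cast
      simpa using hst
  have key : ∀ s t, s < t → l s ≠ l t := by
    intro s₀ t₀ hst heq
    set M := t₀ - s₀ with hM
    have hM1 : 1 < M := by
      by_contra! hle
      exact hloc _ _ hst hle heq
    set C : Set (ℝ × ℝ) := (Icc (0:ℝ) 1 ×ˢ Icc 1 M) ∩ {q | l q.1 = l (q.1 + q.2)} with hC
    have hCc : IsCompact C := (isCompact_Icc.prod isCompact_Icc).inter_right
      (isClosed_eq (by fun_prop) (by fun_prop))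
    have hshift : ∀ s L, l s = l (s + L) → l (Int.fract s) = l (Int.fract s + L) := by
      intro s L hsL
      have := h_int (-⌊s⌋) _ _ hsL
      push_cast at this
      rw [← sub_eq_add_neg, Int.self_sub_floor] at this
      rw [this, ← Int.self_sub_floor]
      congr 1; ring
    have hCn : C.Nonempty := ⟨(Int.fract s₀, M), ⟨⟨Int.fract_nonneg _, (Int.fract_lt_one _).le⟩,
      hM1.le, le_rfl⟩, hshift s₀ M (by rw [heq, hM]; congr 1; ring)⟩
    obtain ⟨⟨a, L⟩, ⟨⟨ha, hL⟩, haL⟩, hmin⟩ := hCc.exists_isMinOn hCn continuousOn_snd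
    simp only [mem_ofPred_eq] at haL
    have hL1 : 1 < L := hL.1.lt_of_ne (by
      rintro rfl
      exact hloc a (a + 1) (by simp) (by simp) haL)
    refine hh.false_of_minimal_loop hf (l := fun s => l (s + a)) (by fun_prop) ?_ hL1 ?_ ?_
    · intro s
      rw [← he]; congr 1; ring
    · simp only [zero_add]
      rw [haL, add_comm]
    · intro s t hs ht h1
      have h2 : 1 < t - s := by
        by_contra! hle
        exact hloc (s + a) (t + a) (by linarith) (by linarith) h1
      have h3 := hshift (s + a) (t - s) (by rw [h1]; congr 1; ring)
      have h4 : (Int.fract (s + a), t - s) ∈ C :=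
        ⟨⟨⟨Int.fract_nonneg _, (Int.fract_lt_one _).le⟩, h2.le, by
          simp only
          linarith [hL.2]⟩, h3⟩
      have := hmin h4
      simp only [mem_ofPred_eq] at this
      linarith
  intro s t hst
  rcases lt_trichotomy s t with h1 | h1 | h1
  · exact absurd hst (key _ _ h1)
  · exact h1
  · exact absurd hst.symm (key _ _ h1)

end Complex

lemma Homeomorph.exists_equivariant_extension {X Y : Type*} [TopologicalSpace X]
    [TopologicalSpace Y] (h : X ≃ₜ X) {F : ℝ → Y → X} (hF : Continuous fun q : ℝ × Y => F q.1 q.2)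
    {δ : ℝ} (hδ : 0 < δ) (hδ1 : δ ≤ 1) (hs : ∀ s x, |s| < δ → F (s + 1) x = h (F s x)) :
    ∃ Ψ : ℝ → Y → X, (Continuous fun q : ℝ × Y => Ψ q.1 q.2) ∧
      (∀ s x, Ψ (s + 1) x = h (Ψ s x)) ∧ ∀ s x, -δ < s → s < 1 + δ → Ψ s x = F s x := by
  set Ψ : ℝ → Y → X := fun s x => (h ^ ⌊s⌋) (F (Int.fract s) x) with hΨ
  have hadd : ∀ (n : ℤ) (z : X), (h ^ (n + 1)) z = (h ^ n) (h z) := fun n z => by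
    rw [zpow_add_one]; rfl
  have key : ∀ (n : ℤ) s x, -δ < s - n → s - n < 1 + δ → Ψ s x = (h ^ n) (F (s - n) x) := by
    intro n s x h1 h2
    rcases lt_or_ge (s - n) 0 with h3 | h3
    · have hfl : ⌊s⌋ = n - 1 := by
        rw [Int.floor_eq_iff]; push_cast; constructor <;> linarith
      have hfr : Int.fract s = (s - n) + 1 := by
        rw [← Int.self_sub_floor, hfl]; push_cast; ring
      simp only [hΨ]
      rw [hfr, hs _ _ (by rw [abs_lt]; constructor <;> linarith), ← hadd, hfl, sub_add_cancel]
    · rcases lt_or_ge (s - n) 1 with h4 | h4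
      · have hfl : ⌊s⌋ = n := by
          rw [Int.floor_eq_iff]; constructor <;> linarith
        simp only [hΨ]
        rw [← Int.self_sub_floor, hfl]
      · have hfl : ⌊s⌋ = n + 1 := by
          rw [Int.floor_eq_iff]; push_cast; constructor <;> linarith
        have hfr : Int.fract s = s - n - 1 := by
          rw [← Int.self_sub_floor, hfl]; push_cast; ring
        simp only [hΨ]
        rw [hfr, hfl, hadd, ← hs _ _ (by rw [abs_lt]; constructor <;> linarith), sub_add_cancel]
  refine ⟨Ψ, ?_, ?_, ?_⟩
  · rw [continuous_iff_continuousAt]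
    rintro ⟨s₀, x₀⟩
    have h1 : Continuous fun q : ℝ × Y => (h ^ ⌊s₀⌋) (F (q.1 - ⌊s₀⌋) q.2) :=
      (h ^ ⌊s₀⌋).continuous.comp (hF.comp (f := fun q : ℝ × Y => (q.1 - ⌊s₀⌋, q.2)) (by fun_prop))
    refine h1.continuousAt.congr ?_
    have h2 : ∀ᶠ q : ℝ × Y in 𝓝 (s₀, x₀), -δ < q.1 - ⌊s₀⌋ ∧ q.1 - ⌊s₀⌋ < 1 + δ := by
      have hc : ContinuousAt (fun q : ℝ × Y => q.1 - ⌊s₀⌋) (s₀, x₀) := by fun_prop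
      refine hc.eventually (Ioo_mem_nhds ?_ ?_)
      · simp only [Int.self_sub_floor]; linarith [Int.fract_nonneg s₀]
      · simp only [Int.self_sub_floor]; linarith [Int.fract_lt_one s₀]
    filter_upwards [h2] with q hq
    exact (key _ _ _ hq.1 hq.2).symm
  · intro s x
    simp only [hΨ, Int.floor_add_one, Int.fract_add_one]
    rw [add_comm, zpow_one_add]; rfl
  · intro s x h1 h2
    simpa using key 0 s x (by simpa using h1) (by simpa using h2)

open Complex in
/-- A translation arc generates an injective translation curve. -/
theorem Homeomorph.exists_translation_curve (h : ℂ ≃ₜ ℂ) (hh : IsotopicToIdMap h)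
    (hf : ∀ z, h z ≠ z) {c : ℝ → ℂ} (hc : Continuous c) (hc1 : c 1 = h (c 0))
    (hinj : InjOn c (Icc 0 1)) (hd : ∀ r s, 0 < r → r ≤ s → s < 1 → c s ≠ h (c r)) :
    ∃ l : ℝ → ℂ, Continuous l ∧ (∀ s, l (s + 1) = h (l s)) ∧ EqOn l c (Icc 0 1) ∧
      Function.Injective l := by
  set F : ℝ → ℂ := fun s => if s ≤ 0 then h.symm (c (s + 1)) else
    if s ≤ 1 then c s else h (c (s - 1)) with hF
  have hFc : Continuous F := by
    refine Continuous.if_le (by fun_prop) (Continuous.if_le (by fun_prop) (by fun_prop)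
      continuous_id continuous_const ?_) continuous_id continuous_const ?_
    · rintro x rfl; simp [hc1]
    · rintro x rfl; simp [hc1]
  have hF01 : EqOn F c (Icc 0 1) := by
    intro s hs
    rcases hs.1.eq_or_lt with rfl | h1
    · simp [hF, hc1]
    · simp [hF, h1.not_ge, hs.2]
  obtain ⟨Ψ, hΨ, hΨe, hΨF⟩ := h.exists_equivariant_extension (Y := Unit) (F := fun s _ => F s)
    (hFc.comp continuous_fst) one_pos le_rfl (by
      intro s _ hs
      rw [abs_lt] at hs
      rcases le_or_gt s 0 with h1 | h1
      · rw [hF01 ⟨by linarith, by linarith⟩]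
        simp [hF, h1]
      · rw [hF01 ⟨h1.le, hs.2.le⟩]
        have : ¬ s + 1 ≤ 0 := by linarith
        simp [hF, this, h1.not_ge])
  have hl : Continuous fun s => Ψ s () := hΨ.comp (Continuous.prodMk_left ())
  have hlc : EqOn (fun s => Ψ s ()) c (Icc 0 1) := fun s hs => by
    simp only
    rw [hΨF s () (by linarith [hs.1]) (by linarith [hs.2]), hF01 hs]
  refine ⟨fun s => Ψ s (), hl, fun s => hΨe s (), hlc, ?_⟩
  refine hh.injective_of_equivariant h.injective hf hl (fun s => hΨe s ()) ?_
  have base : ∀ s ∈ Ico (0:ℝ) 1, ∀ t, s < t → t - s ≤ 1 → Ψ s () ≠ Ψ t () := by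
    intro s hs t hst ht heq
    have e1 := hlc ⟨hs.1, hs.2.le⟩
    simp only at e1
    rcases le_or_gt t 1 with h1 | h1
    · have e2 := hlc (show t ∈ Icc (0:ℝ) 1 from ⟨by linarith [hs.1], h1⟩)
      simp only at e2
      rw [e1, e2] at heq
      have := hinj ⟨hs.1, hs.2.le⟩ ⟨by linarith [hs.1], h1⟩ heq
      linarith
    · have e2 := hlc (show t - 1 ∈ Icc (0:ℝ) 1 from ⟨by linarith, by linarith [hs.2]⟩)
      simp only at e2
      have e3 := hΨe (t - 1) ()
      rw [sub_add_cancel] at e3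
      rw [e1, e3, e2] at heq
      exact hd (t - 1) s (by linarith) (by linarith) hs.2 heq
  have hk : ∀ (n : ℕ) s, Ψ (s + n) () = (h ^ n) (Ψ s ()) := by
    intro n
    induction n with
    | zero => intro s; simp
    | succ n ih =>
      intro s
      push_cast
      rw [← add_assoc, hΨe, ih, pow_succ']; rfl
  intro s t hst ht heq
  refine base (Int.fract s) ⟨Int.fract_nonneg _, Int.fract_lt_one _⟩ (t - ⌊s⌋)
    (by rw [← Int.self_sub_floor]; linarith) (by rw [← Int.self_sub_floor]; linarith) ?_
  rw [← Int.self_sub_floor]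
  obtain ⟨n, hn | hn⟩ := ⌊s⌋.eq_nat_or_neg
  · apply (h ^ n).injective
    rw [← hk, ← hk, hn]
    simpa using heq
  · rw [hn]
    push_cast
    rw [sub_neg_eq_add, sub_neg_eq_add, hk, hk, heq]

/-- The largest free disc centred at a point: it touches its image at `h z`. -/
lemma Homeomorph.exists_critical_disc (h : ℂ ≃ₜ ℂ) (hf : ∀ z, h z ≠ z) (x : ℂ) :
    ∃ r : ℝ, 0 < r ∧ (∃ z, ‖z - x‖ = r ∧ ‖h z - x‖ = r) ∧ (∀ q, ‖q - x‖ < r → r < ‖h q - x‖) ∧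
      ∀ q, ‖q - x‖ ≤ r → r ≤ ‖h q - x‖ := by
  set m : ℂ → ℝ := fun q => max ‖q - x‖ ‖h q - x‖ with hm
  have hmc : Continuous m := by fun_prop
  have hmt : Tendsto m (cocompact ℂ) atTop := by
    refine tendsto_atTop_mono (fun q => le_max_left _ _) ?_
    exact tendsto_norm_cocompact_atTop.comp
      (Homeomorph.subRight x).isClosedEmbedding.tendsto_cocompact
  obtain ⟨z, hz⟩ := hmc.exists_forall_le hmt
  set r := m z with hr
  have hmem : ∀ q, q ∈ Metric.ball x r ↔ ‖q - x‖ < r := fun q => by rw [mem_ball_iff_norm]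
  have hr0 : 0 < r := by
    by_contra! hle
    have h1 : ‖z - x‖ ≤ 0 := (le_max_left _ _).trans hle
    have h2 : ‖h z - x‖ ≤ 0 := (le_max_right _ _).trans hle
    rw [norm_le_zero_iff, sub_eq_zero] at h1 h2
    exact hf z (by rw [h2, h1])
  have hdisj : Disjoint (Metric.ball x r) (h '' Metric.ball x r) := by
    rw [Set.disjoint_left]
    rintro _ h1 ⟨q, h2, rfl⟩
    rw [hmem] at h1 h2
    exact absurd (hz q) (not_le.2 (max_lt h2 h1))
  have hcl : closure (Metric.ball x r) = Metric.closedBall x r := closure_ball _ hr0.ne'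
  have hopen : IsOpen (h '' Metric.ball x r) := h.isOpenMap _ Metric.isOpen_ball
  have hd1 : Disjoint (Metric.closedBall x r) (h '' Metric.ball x r) := by
    rw [← hcl]; exact hdisj.closure_left hopen
  have hd2 : Disjoint (Metric.ball x r) (h '' Metric.closedBall x r) := by
    rw [← hcl, h.image_closure]; exact hdisj.closure_right Metric.isOpen_ball
  have p1 : ∀ q, ‖q - x‖ < r → r < ‖h q - x‖ := by
    intro q hq
    by_contra! hle
    exact Set.disjoint_left.1 hd1 (mem_closedBall_iff_norm.2 hle) ⟨q, (hmem q).2 hq, rfl⟩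
  have p2 : ∀ q, ‖q - x‖ ≤ r → r ≤ ‖h q - x‖ := by
    intro q hq
    by_contra! hle
    exact Set.disjoint_left.1 hd2 ((hmem _).2 hle) ⟨q, mem_closedBall_iff_norm.2 hq, rfl⟩
  have hz1 : ‖z - x‖ ≤ r := le_max_left _ _
  have hz2 : ‖h z - x‖ ≤ r := le_max_right _ _
  refine ⟨r, hr0, ⟨z, ?_, le_antisymm hz2 (p2 z hz1)⟩, p1, p2⟩
  refine hz1.eq_or_lt.resolve_right fun hlt => ?_
  exact absurd (p1 z hlt) (not_lt.2 hz2)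

namespace Complex

lemma IsotopicToIdMap.iterate_ne {h : ℂ ≃ₜ ℂ} (hh : IsotopicToIdMap h) (hf : ∀ z, h z ≠ z)
    (x : ℂ) {n : ℕ} (hn : 0 < n) : h^[n] x ≠ x := by
  obtain ⟨r, hr, ⟨z, hz, hw⟩, h1, h2⟩ := h.exists_critical_disc hf x
  set c : ℝ → ℂ := fun s => x + (max 0 (1 - 2 * s) : ℝ) * (z - x) +
    (max 0 (2 * s - 1) : ℝ) * (h z - x) with hc
  have hcl : ∀ s ≤ 1 / 2, c s = x + (1 - 2 * s : ℝ) * (z - x) := by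
    intro s hs
    simp only [hc]
    rw [max_eq_right (by linarith), max_eq_left (by linarith)]
    simp
  have hcr : ∀ s, 1 / 2 ≤ s → c s = x + (2 * s - 1 : ℝ) * (h z - x) := by
    intro s hs
    simp only [hc]
    rw [max_eq_left (by linarith), max_eq_right (by linarith)]
    simp
  have hnl : ∀ s ∈ Icc (0:ℝ) (1 / 2), ‖c s - x‖ = (1 - 2 * s) * r := by
    intro s hs
    rw [hcl s hs.2, add_sub_cancel_left, norm_mul, hz, norm_real, Real.norm_eq_abs,
      abs_of_nonneg (by linarith [hs.2])]
  have hnr : ∀ s ∈ Icc (1 / 2 : ℝ) 1, ‖c s - x‖ = (2 * s - 1) * r := by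
    intro s hs
    rw [hcr s hs.1, add_sub_cancel_left, norm_mul, hw, norm_real, Real.norm_eq_abs,
      abs_of_nonneg (by linarith [hs.1])]
  have hcross : ∀ s ∈ Icc (0:ℝ) (1 / 2), ∀ t ∈ Icc (1 / 2 : ℝ) 1, c s = c t → s = t := by
    intro s hs t ht hst
    have e1 := hnl s hs
    have e2 := hnr t ht
    rw [hst, e2] at e1
    have e3 := mul_right_cancel₀ hr.ne' e1
    rw [hcl s hs.2, hcr t ht.1, e3, add_right_inj] at hst
    rcases eq_or_ne (1 - 2 * s) 0 with h0 | h0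
    · linarith
    · have := mul_left_cancel₀ (ofReal_ne_zero.2 h0) hst
      exact absurd (sub_left_injective this).symm (hf z)
  have hsame : ∀ s t : ℝ, ‖c s - x‖ = ‖c t - x‖ → (s ∈ Icc (0:ℝ) (1 / 2) ∧ t ∈ Icc (0:ℝ) (1 / 2) ∨
      s ∈ Icc (1 / 2 : ℝ) 1 ∧ t ∈ Icc (1 / 2 : ℝ) 1) → s = t := by
    rintro s t hst (⟨hs, ht⟩ | ⟨hs, ht⟩)
    · rw [hnl s hs, hnl t ht] at hst
      linarith [mul_right_cancel₀ hr.ne' hst]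
    · rw [hnr s hs, hnr t ht] at hst
      linarith [mul_right_cancel₀ hr.ne' hst]
  obtain ⟨l, hl, hle, hlc, hli⟩ := h.exists_translation_curve hh hf (c := c)
    (by fun_prop) (by rw [hcl 0 (by norm_num), hcr 1 (by norm_num)]; norm_num) (by
      intro s hs t ht hst
      rcases le_total s (1 / 2) with h3 | h3 <;> rcases le_total t (1 / 2) with h4 | h4
      · exact hsame s t (by rw [hst]) (Or.inl ⟨⟨hs.1, h3⟩, ht.1, h4⟩)
      · exact hcross s ⟨hs.1, h3⟩ t ⟨h4, ht.2⟩ hst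
      · exact (hcross t ⟨ht.1, h4⟩ s ⟨h3, hs.2⟩ hst.symm).symm
      · exact hsame s t (by rw [hst]) (Or.inr ⟨⟨h3, hs.2⟩, h4, ht.2⟩))
    (by
      intro t s ht hts hs heq
      have e1 : ‖c s - x‖ < r := by
        rcases le_total s (1 / 2) with h3 | h3
        · rw [hnl s ⟨by linarith, h3⟩]; nlinarith
        · rw [hnr s ⟨h3, hs.le⟩]; nlinarith
      have e2 : ‖c t - x‖ ≤ r := by
        rcases le_total t (1 / 2) with h3 | h3
        · rw [hnl t ⟨ht.le, h3⟩]; nlinarith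
        · rw [hnr t ⟨h3, by linarith⟩]; nlinarith
      have := h2 _ e2
      rw [← heq] at this
      linarith)
  have hx : l (1 / 2) = x := by
    rw [hlc ⟨by norm_num, by norm_num⟩, hcl _ le_rfl]; norm_num
  have hit : ∀ n : ℕ, l (1 / 2 + n) = h^[n] x := by
    intro n
    induction n with
    | zero => simpa using hx
    | succ n ih =>
      push_cast
      rw [← add_assoc, hle, ih, Function.iterate_succ_apply']
  intro heq
  rw [← hit, ← hx] at heq
  have := hli heq
  have hn' : (0:ℝ) < n := by exact_mod_cast hn
  linarith

lemma IsotopicToIdMap.comp {f g : ℂ → ℂ} (hf : IsotopicToIdMap f) (hg : IsotopicToIdMap g) :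
    IsotopicToIdMap (f ∘ g) := by
  obtain ⟨H, hc, hi, h0, h1⟩ := hf
  obtain ⟨K, kc, ki, k0, k1⟩ := hg
  refine ⟨fun u z => H u (K u z), ?_, fun u => (hi u).comp (ki u), ?_, ?_⟩
  · exact hc.comp (f := fun q : ℝ × ℂ => (q.1, K q.1 q.2)) (by fun_prop)
  · ext z; simp [h0, k0]
  · ext z; simp [h1, k1]

/-- A point can be pushed to a nearby one by a homeomorphism supported in a disc. -/
lemma exists_push {a b : ℂ} {ρ : ℝ} (hb : ‖b - a‖ < ρ) :
    ∃ φ : ℂ ≃ₜ ℂ, IsotopicToIdMap φ ∧ (∀ z, ρ ≤ ‖z - a‖ → φ z = z) ∧ φ a = b := by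
  have hρ : 0 < ρ := (norm_nonneg _).trans_lt hb
  set β : ℂ → ℝ := fun z => max 0 (1 - ‖z - a‖ / ρ) with hβ
  have hβc : Continuous β := by fun_prop
  have hβl : ∀ z w, |β z - β w| ≤ ‖z - w‖ / ρ := by
    have key : ∀ z w, β z ≤ β w + ‖z - w‖ / ρ := by
      intro z w
      have h1 : ‖w - a‖ ≤ ‖z - a‖ + ‖z - w‖ := by
        rw [← norm_neg (z - w)]
        exact (congrArg norm (by ring)).trans_le (norm_add_le (z - a) (-(z - w)))
      have h2 : ‖w - a‖ / ρ ≤ ‖z - a‖ / ρ + ‖z - w‖ / ρ := by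
        rw [← add_div]; gcongr
      have h3 : 0 ≤ ‖z - w‖ / ρ := by positivity
      refine max_le ?_ ?_
      · exact add_nonneg (le_max_left _ _) h3
      · linarith [le_max_right 0 (1 - ‖w - a‖ / ρ)]
    intro z w
    rw [abs_le]
    have h1 := key z w
    have h2 := key w z
    rw [norm_sub_rev] at h2
    constructor <;> linarith
  set κ : NNReal := ⟨‖b - a‖ / ρ, by positivity⟩ with hκ
  have hκ1 : (κ : ℝ) < 1 := (div_lt_one hρ).2 hb
  set H : ℝ → ℂ → ℂ := fun u z => z + (max 0 (min 1 u) * β z : ℝ) * (b - a) with hH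
  have happ : ∀ u z w, ‖H u z - H u w - (z - w)‖ ≤ κ * ‖z - w‖ := by
    intro u z w
    have e : H u z - H u w - (z - w) = ((max 0 (min 1 u) * (β z - β w) : ℝ) : ℂ) * (b - a) := by
      simp only [hH]; push_cast; ring
    have h1 : |max 0 (min 1 u)| ≤ 1 := by
      rw [abs_of_nonneg (le_max_left _ _)]
      exact max_le zero_le_one (min_le_left _ _)
    rw [e, norm_mul, norm_real, Real.norm_eq_abs, abs_mul]
    calc |max 0 (min 1 u)| * |β z - β w| * ‖b - a‖ ≤ 1 * (‖z - w‖ / ρ) * ‖b - a‖ := by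
          gcongr; exact hβl z w
      _ = κ * ‖z - w‖ := by
          change _ = ‖b - a‖ / ρ * ‖z - w‖
          ring
  have hinj : ∀ u, Function.Injective (H u) := by
    intro u z w hzw
    have h1 := happ u z w
    rw [hzw, sub_self, zero_sub, norm_neg] at h1
    by_contra hne
    have h2 : 0 < ‖z - w‖ := norm_pos_iff.2 (sub_ne_zero.2 hne)
    nlinarith
  have hap : ApproximatesLinearOn (H 1) ((ContinuousLinearEquiv.refl ℝ ℂ : ℂ ≃L[ℝ] ℂ) : ℂ →L[ℝ] ℂ)
      univ κ := fun z _ w _ => happ 1 z w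
  have hc : κ < ‖((ContinuousLinearEquiv.refl ℝ ℂ).symm : ℂ →L[ℝ] ℂ)‖₊⁻¹ := by
    have e : ((ContinuousLinearEquiv.refl ℝ ℂ).symm : ℂ →L[ℝ] ℂ) = ContinuousLinearMap.id ℝ ℂ := rfl
    rw [e, ContinuousLinearMap.nnnorm_id, inv_one]
    exact_mod_cast hκ1
  refine ⟨hap.toHomeomorph (H 1) (Or.inr hc), ⟨H, ?_, hinj, ?_, rfl⟩, ?_, ?_⟩
  · simp only [hH]; fun_prop
  · ext z; simp [hH]
  · intro z hz
    change H 1 z = z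
    have : β z = 0 := max_eq_left (by rw [sub_nonpos, one_le_div hρ]; exact hz)
    simp [hH, this]
  · change H 1 a = b
    simp [hH, hβ]

/-- Homogeneity of connected open sets. -/
lemma exists_isotopicToIdMap_of_isPreconnected {S : Set ℂ} (hS : IsOpen S) (hc : IsPreconnected S)
    {a b : ℂ} (ha : a ∈ S) (hb : b ∈ S) :
    ∃ φ : ℂ ≃ₜ ℂ, IsotopicToIdMap φ ∧ (∀ z ∉ S, φ z = z) ∧ φ a = b := by
  refine hc.induction₂' (fun a b => ∃ φ : ℂ ≃ₜ ℂ, IsotopicToIdMap φ ∧ (∀ z ∉ S, φ z = z) ∧ φ a = b)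
    (fun x hx => ?_) (fun x y z _ _ _ h1 h2 => ?_) ha hb
  · obtain ⟨ρ, hρ, hsub⟩ := Metric.isOpen_iff.1 hS x hx
    refine Filter.mem_of_superset (mem_nhdsWithin_of_mem_nhds
      (Metric.ball_mem_nhds x (half_pos hρ))) fun y hy => ?_
    rw [mem_ball_iff_norm] at hy
    constructor
    · obtain ⟨φ, h1, h2, h3⟩ := exists_push (a := x) (b := y) (ρ := ρ) (by linarith)
      refine ⟨φ, h1, fun z hz => h2 z ?_, h3⟩
      by_contra! hlt
      exact hz (hsub (mem_ball_iff_norm.2 hlt))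
    · rw [norm_sub_rev] at hy
      obtain ⟨φ, h1, h2, h3⟩ := exists_push (a := y) (b := x) (ρ := ρ / 2) hy
      refine ⟨φ, h1, fun z hz => h2 z ?_, h3⟩
      by_contra! hlt
      refine hz (hsub (mem_ball_iff_norm.2 ?_))
      have e : z - x = (z - y) - (x - y) := by ring
      rw [e]
      linarith [norm_sub_le (z - y) (x - y)]
  · obtain ⟨φ, a1, a2, a3⟩ := h1
    obtain ⟨ψ, b1, b2, b3⟩ := h2
    refine ⟨φ.trans ψ, b1.comp a1, fun w hw => ?_, ?_⟩
    · simp [a2 w hw, b2 w hw]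
    · simp [a3, b3]

/-- A connected open set that is free for a fixed point free isotopic-to-identity homeomorphism
is disjoint from all its iterates. -/
theorem IsotopicToIdMap.iterate_notMem {h : ℂ ≃ₜ ℂ} (hh : IsotopicToIdMap h) (hf : ∀ z, h z ≠ z)
    {S : Set ℂ} (hS : IsOpen S) (hc : IsPreconnected S) (hfree : ∀ q ∈ S, h q ∉ S) {n : ℕ}
    (hn : 0 < n) {q : ℂ} (hq : q ∈ S) : h^[n] q ∉ S := by
  induction n using Nat.strong_induction_on generalizing q with
  | _ n ih =>
  intro hmem
  obtain ⟨φ, hφ, hφS, hφq⟩ := exists_isotopicToIdMap_of_isPreconnected hS hc hmem hq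
  have hφS' : ∀ z, φ z ∈ S ↔ z ∈ S := by
    intro z
    constructor
    · intro hz
      by_contra hn'
      exact hn' ((hφS z hn') ▸ hz)
    · intro hz
      by_contra hn'
      have := φ.injective (hφS _ hn')
      exact hn' (this.symm ▸ hz)
  set k : ℂ ≃ₜ ℂ := h.trans φ with hk
  have hkh : IsotopicToIdMap k := hφ.comp hh
  have hkf : ∀ z, k z ≠ z := by
    intro z hz
    change φ (h z) = z at hz
    by_cases h1 : h z ∈ S
    · have h2 : z ∈ S := hz ▸ (hφS' _).2 h1
      exact hfree z h2 h1
    · rw [hφS _ h1] at hz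
      exact hf z hz
  have hit : ∀ m < n, k^[m] q = h^[m] q := by
    intro m
    induction m with
    | zero => simp
    | succ m ihm =>
      intro hm
      rw [Function.iterate_succ_apply', Function.iterate_succ_apply', ihm (by omega)]
      change φ (h (h^[m] q)) = _
      refine hφS _ ?_
      rw [← Function.iterate_succ_apply' h m q]
      exact ih (m + 1) hm (by omega) hq
  obtain ⟨m, rfl⟩ : ∃ m, n = m + 1 := ⟨n - 1, by omega⟩
  refine hkh.iterate_ne hkf q hn ?_
  rw [Function.iterate_succ_apply', hit m (by omega)]
  change φ (h (h^[m] q)) = q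
  rw [← Function.iterate_succ_apply' h m q, hφq]

end Complex

lemma IsLocalHomeomorphOn.congr_nhds {X Y : Type*} [TopologicalSpace X] [TopologicalSpace Y]
    {f g : X → Y} {x : X} (hg : IsLocalHomeomorphOn g {x}) (hfg : f =ᶠ[𝓝 x] g) :
    IsLocalHomeomorphOn f {x} := by
  refine IsLocalHomeomorphOn.mk _ _ fun y hy => ?_
  obtain rfl : y = x := hy
  obtain ⟨e, he, rfl⟩ := hg y rfl
  obtain ⟨U, hU, hUo, hyU⟩ := eventually_nhds_iff.1 hfg
  exact ⟨e.restrOpen U hUo, by simp [he, hyU], fun z hz => hU z (by simpa using hz.2)⟩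

lemma isOpen_setOf_isLocalHomeomorphOn {X Y : Type*} [TopologicalSpace X] [TopologicalSpace Y]
    (f : X → Y) : IsOpen {x | IsLocalHomeomorphOn f {x}} := by
  rw [isOpen_iff_mem_nhds]
  intro x hx
  obtain ⟨e, he, hfe⟩ := hx x rfl
  refine mem_of_superset (e.open_source.mem_nhds he) fun y hy z hz => ?_
  obtain rfl : z = y := hz
  exact ⟨e, hy, hfe⟩

/-- A neighbourhood of `K × {0}` contains a uniform strip when `K` is compact. -/
lemma IsCompact.exists_strip_subset {K : Set ℝ} (hK : IsCompact K) {U : Set (ℝ × ℝ)}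
    (hU : ∀ s ∈ K, U ∈ 𝓝 (s, (0 : ℝ))) :
    ∃ ε > 0, ∀ s ∈ K, ∀ t : ℝ, |t| < ε → (s, t) ∈ U := by
  obtain ⟨u, v, hu, hv, hKu, h0v, huv⟩ := generalized_tube_lemma hK (isCompact_singleton (x := (0:ℝ)))
    (isOpen_interior (s := U)) (by
      rintro ⟨s, t⟩ ⟨hs, ht⟩
      obtain rfl : t = 0 := ht
      exact mem_interior_iff_mem_nhds.2 (hU s hs))
  obtain ⟨ε, hε, hb⟩ := Metric.isOpen_iff.1 hv 0 (h0v rfl)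
  refine ⟨ε, hε, fun s hs t ht => interior_subset (huv ⟨hKu hs, hb ?_⟩)⟩
  simpa using ht

lemma Homeomorph.map_add_intCast_of_equivariant {X : Type*} [TopologicalSpace X] (h : X ≃ₜ X)
    {f : ℝ → X} (he : ∀ s, f (s + 1) = h (f s)) (n : ℤ) (s : ℝ) : f (s + n) = (h ^ n) (f s) := by
  induction n using Int.induction_on with
  | zero => simp
  | succ n ih =>
    push_cast at ih ⊢
    rw [← add_assoc, he, ih, ← Homeomorph.mul_apply, ← zpow_one_add, add_comm]
  | pred n ih =>
    have := he (s + (-(n : ℤ) - 1 : ℤ))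
    push_cast at ih this ⊢
    rw [show s + (-(n:ℝ) - 1) + 1 = s + -n by ring, ih] at this
    refine h.injective ?_
    rw [← this, ← Homeomorph.mul_apply, ← zpow_one_add]
    congr 2; ring

lemma IsLocalHomeomorphOn.add_intCast_of_equivariant {X Y : Type*} [TopologicalSpace X]
    [TopologicalSpace Y] (h : X ≃ₜ X) {Ψ : ℝ × Y → X} (he : ∀ s t, Ψ (s + 1, t) = h (Ψ (s, t)))
    {s : ℝ} {t : Y} (hl : IsLocalHomeomorphOn Ψ {(s, t)}) (n : ℤ) :
    IsLocalHomeomorphOn Ψ {(s + n, t)} := by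
  have h2 : Ψ = (h ^ n : X ≃ₜ X) ∘ Ψ ∘ fun q : ℝ × Y => (q.1 + (-n : ℤ), q.2) := by
    ext q
    simp only [Function.comp_apply]
    rw [h.map_add_intCast_of_equivariant (f := fun s => Ψ (s, q.2)) (fun s => he s q.2),
      ← Homeomorph.mul_apply, ← zpow_add]
    simp
  rw [h2]
  have h3 : IsLocalHomeomorphOn (fun q : ℝ × Y => (q.1 + (-n : ℤ), q.2)) {(s + n, t)} :=
    (((Homeomorph.addRight ((-n : ℤ) : ℝ)).prodCongr
      (Homeomorph.refl Y)).isLocalHomeomorph.isLocalHomeomorphOn).mono (subset_univ _)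
  refine (h ^ n : X ≃ₜ X).isLocalHomeomorph.isLocalHomeomorphOn.comp
    (hl.comp h3 ?_) (mapsTo_univ _ _)
  rintro _ rfl
  simp

namespace Complex

/-- An equivariant map which is a local homeomorphism along an injective translation curve
restricts to an open embedding of a strip. -/
theorem IsotopicToIdMap.exists_isOpenEmbedding_strip {h : ℂ ≃ₜ ℂ} (hh : IsotopicToIdMap h)
    (hf : ∀ z, h z ≠ z) {Ψ : ℝ × ℝ → ℂ} (hc : Continuous Ψ)
    (he : ∀ s t, Ψ (s + 1, t) = h (Ψ (s, t))) (hi : Function.Injective fun s => Ψ (s, 0))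
    (hl : ∀ s, IsLocalHomeomorphOn Ψ {(s, 0)}) :
    ∃ Θ : ℝ × ℝ → ℂ, IsOpenEmbedding Θ ∧ (∀ s t, Θ (s + 1, t) = h (Θ (s, t))) ∧
      ∀ s, Θ (s, 0) = Ψ (s, 0) := by
  have hen : ∀ (n : ℕ) s t, Ψ (s + n, t) = h^[n] (Ψ (s, t)) := by
    intro n s t
    induction n with
    | zero => simp
    | succ n ih =>
      push_cast
      rw [← add_assoc, he, ih, Function.iterate_succ_apply']
  obtain ⟨ε₁, hε₁, hl₁⟩ := (isCompact_Icc (a := (0:ℝ)) (b := 1)).exists_strip_subset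
    (U := {x | IsLocalHomeomorphOn Ψ {x}}) fun s _ =>
      (isOpen_setOf_isLocalHomeomorphOn Ψ).mem_nhds (hl s)
  have hinjc : InjOn Ψ (Icc (-1) 3 ×ˢ {0}) := by
    rintro ⟨s, t⟩ ⟨_, ht⟩ ⟨s', t'⟩ ⟨_, ht'⟩ hst
    obtain rfl : t = 0 := ht
    obtain rfl : t' = 0 := ht'
    rw [hi hst]
  obtain ⟨U, hU, hUi⟩ := hinjc.exists_mem_nhdsSet (isCompact_Icc.prod isCompact_singleton)
    (fun x _ => hc.continuousAt) (by
      rintro ⟨s, t⟩ ⟨_, ht⟩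
      obtain rfl : t = 0 := ht
      obtain ⟨e, h1, h2⟩ := hl s _ rfl
      exact ⟨e.source, e.open_source.mem_nhds h1, h2 ▸ e.injOn⟩)
  obtain ⟨ε₂, hε₂, hl₂⟩ := (isCompact_Icc (a := (-1:ℝ)) (b := 3)).exists_strip_subset (U := U)
    fun s hs => mem_nhdsSet_iff_forall.1 hU _ ⟨hs, rfl⟩
  set ε := min ε₁ ε₂ with hε
  have hε0 : 0 < ε := lt_min hε₁ hε₂
  have hshift : ∀ (n : ℤ) s t s' t', Ψ (s + n, t) = Ψ (s' + n, t') ↔ Ψ (s, t) = Ψ (s', t') := by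
    intro n s t s' t'
    obtain ⟨n, rfl | rfl⟩ := n.eq_nat_or_neg
    · push_cast
      rw [hen, hen, (h.injective.iterate n).eq_iff]
    · push_cast
      rw [← (h.injective.iterate n).eq_iff, ← hen, ← hen, neg_add_cancel_right,
        neg_add_cancel_right]
  have hlocinj : ∀ s t s' t', |t| < ε → |t'| < ε → |s - s'| ≤ 2 → Ψ (s, t) = Ψ (s', t') →
      s = s' ∧ t = t' := by
    have aux : ∀ s t s' t', |t| < ε → |t'| < ε → s ≤ s' → s' - s ≤ 2 → Ψ (s, t) = Ψ (s', t') →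
        s = s' ∧ t = t' := by
      intro s t s' t' ht ht' hss h2 heq
      have e1 := (hshift (-⌊s⌋) s t s' t').2 heq
      have f1 := Int.floor_le s
      have f2 := Int.lt_floor_add_one s
      have := hUi (hl₂ _ ⟨by push_cast; linarith, by push_cast; linarith⟩ t
        (ht.trans_le (min_le_right _ _))) (hl₂ _ ⟨by push_cast; linarith, by push_cast; linarith⟩
        t' (ht'.trans_le (min_le_right _ _))) e1
      rw [Prod.mk.injEq] at this
      exact ⟨by linarith [this.1], this.2⟩
    intro s t s' t' ht ht' hss heq
    rw [abs_le] at hss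
    rcases le_total s s' with h1 | h1
    · exact aux s t s' t' ht ht' h1 (by linarith) heq
    · have := aux s' t' s t ht' ht h1 (by linarith) heq.symm
      exact ⟨this.1.symm, this.2.symm⟩
  have hloc : ∀ s t, |t| < ε → IsLocalHomeomorphOn Ψ {(s, t)} := by
    intro s t ht
    have h1 : IsLocalHomeomorphOn Ψ {(Int.fract s, t)} := hl₁ _
      ⟨Int.fract_nonneg s, (Int.fract_lt_one s).le⟩ t (ht.trans_le (min_le_left _ _))
    simpa using h1.add_intCast_of_equivariant h he ⌊s⌋
  have hinj : ∀ s t s' t', |t| < ε → |t'| < ε → s ≤ s' → Ψ (s, t) = Ψ (s', t') →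
      s = s' ∧ t = t' := by
    intro s t s' t' ht ht' hss heq
    set k := ⌊s' - s + 1 / 2⌋₊ with hk
    have k1 := Nat.floor_le (show 0 ≤ s' - s + 1 / 2 by linarith)
    have k2 := Nat.lt_floor_add_one (s' - s + 1 / 2)
    rw [← hk] at k1 k2
    rcases Nat.eq_zero_or_pos k with h0 | h0
    · rw [h0] at k2
      refine hlocinj s t s' t' ht ht' ?_ heq
      rw [abs_le]
      norm_num at k2
      constructor <;> linarith
    · exfalso
      set a := min s (s' - k) - 1 / 10 with ha
      have hm := min_le_left s (s' - k)
      have hm' := min_le_right s (s' - k)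
      have hm2 : s - 1 / 2 ≤ min s (s' - k) := le_min (by linarith) (by linarith)
      have hm3 : s' - k - 1 / 2 ≤ min s (s' - k) := le_min (by linarith) (by linarith)
      set W : Set (ℝ × ℝ) := Ioo a (a + 9 / 10) ×ˢ Ioo (-ε) ε with hW
      have hWo : IsOpen W := isOpen_Ioo.prod isOpen_Ioo
      have hS : IsOpen (Ψ '' W) := by
        rw [isOpen_iff_mem_nhds]
        rintro _ ⟨⟨σ, τ⟩, hq, rfl⟩
        rw [← (hloc σ τ (abs_lt.2 hq.2)).map_nhds_eq rfl]
        exact image_mem_map (hWo.mem_nhds hq)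
      have hSc : IsPreconnected (Ψ '' W) :=
        (isPreconnected_Ioo.prod isPreconnected_Ioo).image _ hc.continuousOn
      refine hh.iterate_notMem hf hS hSc ?_ h0 (q := Ψ (s' - k, t')) ?_ ?_
      · rintro _ ⟨⟨σ, τ⟩, ⟨hσ, hτ⟩, rfl⟩ ⟨⟨σ', τ'⟩, ⟨hσ', hτ'⟩, heq'⟩
        rw [← he] at heq'
        simp only [mem_Ioo] at hσ hσ'
        have := hlocinj _ _ _ _ (abs_lt.2 hτ') (abs_lt.2 hτ) (by
          rw [abs_le]; constructor <;> linarith) heq'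
        linarith
      · exact ⟨_, ⟨⟨by linarith, by linarith⟩, abs_lt.1 ht'⟩, rfl⟩
      · rw [← hen, sub_add_cancel, ← heq]
        exact ⟨_, ⟨⟨by linarith, by linarith⟩, abs_lt.1 ht⟩, rfl⟩
  set b := OpenPartialHomeomorph.univBall (0 : ℝ) ε with hb
  have hbs : b.source = univ := OpenPartialHomeomorph.univBall_source _ _
  have hbt : ∀ t, |b t| < ε := by
    intro t
    have := b.map_source (x := t) (by rw [hbs]; trivial)
    rw [hb, OpenPartialHomeomorph.univBall_target _ hε0] at this
    simpa using this
  have hbe : IsOpenEmbedding b := b.isOpenEmbedding hbs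
  have hlh : IsLocalHomeomorph (Ψ ∘ Prod.map id b) := by
    rw [isLocalHomeomorph_iff_isLocalHomeomorphOn_univ]
    have h1 : IsLocalHomeomorphOn Ψ {q | |q.2| < ε} := fun q hq => hloc q.1 q.2 hq q rfl
    refine h1.comp ((IsOpenEmbedding.id.prodMap hbe).isLocalHomeomorph.isLocalHomeomorphOn)
      fun q _ => hbt q.2
  refine ⟨Ψ ∘ Prod.map id b, hlh.isOpenEmbedding_of_injective ?_, fun s t => he s (b t), ?_⟩
  · rintro ⟨s, t⟩ ⟨s', t'⟩ heq
    change Ψ (s, b t) = Ψ (s', b t') at heq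
    have : s = s' ∧ b t = b t' := by
      rcases le_total s s' with h1 | h1
      · exact hinj _ _ _ _ (hbt t) (hbt t') h1 heq
      · have := hinj _ _ _ _ (hbt t') (hbt t) h1 heq.symm
        exact ⟨this.1.symm, this.2.symm⟩
    rw [this.1, hbe.injective this.2]
  · intro s
    change Ψ (s, b 0) = _
    rw [hb, OpenPartialHomeomorph.univBall_apply_zero]

end Complex

namespace Complex

open ComplexConjugate in
/-- Translating a curve in a transverse direction gives a local homeomorphism. -/
lemma isLocalHomeomorphOn_add_transverse {c : ℝ → ℂ} (hc : Continuous c) {m : ℂ} {a b : ℝ}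
    (hm : StrictMonoOn (fun s => (c s * conj m).re) (Icc a b)) {s t : ℝ} (hs : s ∈ Ioo a b) :
    IsLocalHomeomorphOn (fun q : ℝ × ℝ => c q.1 + q.2 * (m * I)) {(s, t)} := by
  have hab : a ≤ b := (hs.1.trans hs.2).le
  have hm0 : m ≠ 0 := by
    rintro rfl
    have := hm (left_mem_Icc.2 hab) (right_mem_Icc.2 hab) (hs.1.trans hs.2)
    simp at this
  have hmn : 0 < normSq m := normSq_pos.2 hm0
  set P : ℝ → ℝ := fun s => max a (min b s) with hP
  have hPI : ∀ s, P s ∈ Icc a b := fun s => ⟨le_max_left _ _, max_le hab (min_le_left _ _)⟩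
  have hPm : Monotone P := fun x y hxy => max_le_max le_rfl (min_le_min le_rfl hxy)
  have hPs : Monotone fun s => s - P s := by
    intro x y hxy
    simp only [hP]
    rcases max_cases a (min b x) with h | h <;> rcases max_cases a (min b y) with h' | h' <;>
      rcases min_cases b x with h3 | h3 <;> rcases min_cases b y with h4 | h4 <;> linarith
  set c' : ℝ → ℂ := fun s => c (P s) + ((s - P s : ℝ) : ℂ) * m with hc'
  have hPc : Continuous P := by fun_prop
  have hcc : Continuous c' := by fun_prop
  set g : ℝ → ℝ := fun s => (c' s / m).re with hg
  have hgc : Continuous g := by fun_prop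
  have hgval : ∀ s, g s = (c (P s) * conj m).re / normSq m + (s - P s) := by
    intro s
    simp only [hg, hc']
    rw [add_div, mul_div_cancel_right₀ _ hm0, add_re, ofReal_re, div_re, mul_re, conj_re, conj_im]
    ring
  have hgm : StrictMono g := by
    intro x y hxy
    rw [hgval, hgval]
    rcases (hPm hxy.le).eq_or_lt with h | h
    · rw [h]; linarith
    · have h1 := hm (hPI x) (hPI y) h
      have h2 := hPs hxy.le
      simp only at h1 h2
      have h3 := div_lt_div_of_pos_right h1 hmn
      linarith
  have hbd : ∀ s, (c a * conj m).re / normSq m ≤ (c (P s) * conj m).re / normSq m ∧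
      (c (P s) * conj m).re / normSq m ≤ (c b * conj m).re / normSq m := fun s =>
    ⟨div_le_div_of_nonneg_right (hm.monotoneOn (left_mem_Icc.2 hab) (hPI s) (hPI s).1) hmn.le,
      div_le_div_of_nonneg_right (hm.monotoneOn (hPI s) (right_mem_Icc.2 hab) (hPI s).2) hmn.le⟩
  have htop : Tendsto g atTop atTop := by
    refine tendsto_atTop_mono (f := fun s => s + ((c a * conj m).re / normSq m - b))
      (fun s => ?_) (tendsto_atTop_add_const_right _ _ tendsto_id)
    rw [hgval]
    linarith [(hbd s).1, (hPI s).2]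
  have hbot : Tendsto g atBot atBot := by
    refine tendsto_atBot_mono (f := fun s => s + ((c b * conj m).re / normSq m - a))
      (fun s => ?_) (tendsto_atBot_add_const_right _ _ tendsto_id)
    rw [hgval]
    linarith [(hbd s).2, (hPI s).1]
  set e : ℝ ≃ₜ ℝ := (hgm.orderIsoOfSurjective g (hgc.surjective htop hbot)).toHomeomorph with he
  have hea : ∀ s, e s = g s := fun s => rfl
  set f : ℝ → ℝ := fun s => (c' s / m).im with hf
  have hfc : Continuous f := by fun_prop
  let S : ℝ × ℝ ≃ₜ ℝ × ℝ :=
    { toFun := fun q => (e q.1, q.2 + f q.1)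
      invFun := fun q => (e.symm q.1, q.2 - f (e.symm q.1))
      left_inv := fun q => by simp
      right_inv := fun q => by simp
      continuous_toFun := by fun_prop
      continuous_invFun := by fun_prop }
  let K : ℝ × ℝ ≃ₜ ℂ := (S.trans equivRealProdCLM.symm.toHomeomorph).trans (Homeomorph.mulLeft₀ m hm0)
  have hK : ∀ q, K q = c' q.1 + q.2 * (m * I) := by
    intro q
    change m * equivRealProdCLM.symm (g q.1, q.2 + f q.1) = _
    rw [equivRealProdCLM_symm_apply]
    have := re_add_im (c' q.1 / m)
    have h2 : c' q.1 = m * (c' q.1 / m) := by field_simp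
    rw [h2, ← this]
    simp only [hg, hf]
    push_cast
    ring
  refine ((K.isLocalHomeomorph.isLocalHomeomorphOn).mono (subset_univ _)).congr_nhds ?_
  have : ∀ᶠ q : ℝ × ℝ in 𝓝 (s, t), q.1 ∈ Ioo a b :=
    continuous_fst.continuousAt.eventually (isOpen_Ioo.mem_nhds hs)
  filter_upwards [this] with q hq
  have hPq : P q.1 = q.1 := by
    simp only [hP]
    rw [min_eq_right hq.2.le, max_eq_right hq.1.le]
  rw [hK]
  simp [hc', hPq]

open ComplexConjugate in
lemma isLocalHomeomorphOn_of_partialDeriv {f : ℝ × ℝ → ℂ} {s t : ℝ} {u v : ℂ}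
    (hf : ContDiffAt ℝ 1 f (s, t)) (hu : HasDerivAt (fun σ => f (σ, t)) u s)
    (hv : HasDerivAt (fun τ => f (s, τ)) v t) (huv : 0 < (conj u * v).im) :
    IsLocalHomeomorphOn f {(s, t)} := by
  have hd : HasFDerivAt f (fderiv ℝ f (s, t)) (s, t) :=
    (hf.differentiableAt one_ne_zero).hasFDerivAt
  set L := fderiv ℝ f (s, t) with hL
  have h1 : L (1, 0) = u := by
    refine HasDerivAt.unique ?_ hu
    exact hd.comp_hasDerivAt s ((hasDerivAt_id s).prodMk (hasDerivAt_const s t))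
  have h2 : L (0, 1) = v := by
    refine HasDerivAt.unique ?_ hv
    exact hd.comp_hasDerivAt t ((hasDerivAt_const t s).prodMk (hasDerivAt_id t))
  have hLq : ∀ q : ℝ × ℝ, L q = q.1 * u + q.2 * v := by
    intro q
    have : q = q.1 • ((1, 0) : ℝ × ℝ) + q.2 • ((0, 1) : ℝ × ℝ) := by ext <;> simp
    conv_lhs => rw [this]
    rw [map_add, map_smul, map_smul, h1, h2, real_smul, real_smul]
  have hinj : Function.Injective L.toLinearMap := by
    rw [← LinearMap.ker_eq_bot, LinearMap.ker_eq_bot']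
    intro q hq
    change L q = 0 at hq
    rw [hLq] at hq
    have h3 : (conj u * (q.1 * u + q.2 * v)).im = q.2 * (conj u * v).im := by
      simp only [mul_im, mul_re, add_im, add_re, conj_re, conj_im, ofReal_re, ofReal_im]
      ring
    rw [hq, mul_zero, zero_im, eq_comm] at h3
    have h4 : q.2 = 0 := (mul_eq_zero.1 h3).resolve_right huv.ne'
    have hu0 : u ≠ 0 := by rintro rfl; simp at huv
    rw [h4, ofReal_zero, zero_mul, add_zero] at hq
    have h5 : q.1 = 0 := ofReal_eq_zero.1 ((mul_eq_zero.1 hq).resolve_right hu0)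
    ext <;> simp [h4, h5]
  set E : (ℝ × ℝ) ≃L[ℝ] ℂ := (LinearEquiv.ofInjectiveOfFinrankEq L.toLinearMap hinj
    (by simp [finrank_real_complex])).toContinuousLinearEquiv with hE
  have hEL : (E : (ℝ × ℝ) →L[ℝ] ℂ) = L := by ext <;> rfl
  have hs : HasStrictFDerivAt f (E : (ℝ × ℝ) →L[ℝ] ℂ) (s, t) := by
    rw [hEL]
    exact hf.hasStrictFDerivAt one_ne_zero
  intro q hq
  obtain rfl : q = (s, t) := hq
  exact ⟨hs.toOpenPartialHomeomorph f, hs.mem_toOpenPartialHomeomorph_source, rfl⟩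

end Complex

namespace Complex

/-- The broken line from `p` to `0` to `y`. -/
noncomputable def bentArc (p y : ℂ) (s : ℝ) : ℂ :=
  (max 0 (1 - 2 * s) : ℝ) * p + (max 0 (2 * s - 1) : ℝ) * y

lemma continuous_bentArc (p y : ℂ) : Continuous (bentArc p y) := by
  unfold bentArc; fun_prop

lemma bentArc_of_le {p y : ℂ} {s : ℝ} (hs : s ≤ 1 / 2) : bentArc p y s = (1 - 2 * s : ℝ) * p := by
  unfold bentArc
  rw [max_eq_right (by linarith), max_eq_left (by linarith)]
  simp

lemma bentArc_of_ge {p y : ℂ} {s : ℝ} (hs : 1 / 2 ≤ s) : bentArc p y s = (2 * s - 1 : ℝ) * y := by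
  unfold bentArc
  rw [max_eq_left (by linarith), max_eq_right (by linarith)]
  simp

open ComplexConjugate in
lemma strictMono_bentArc {p y m : ℂ} (hp : 0 < (-p * conj m).re) (hy : 0 < (y * conj m).re) :
    StrictMono fun s => (bentArc p y s * conj m).re := by
  have hp' : (p * conj m).re < 0 := by
    rw [neg_mul, neg_re] at hp; linarith
  have e : ∀ s, (bentArc p y s * conj m).re =
      max 0 (1 - 2 * s) * (p * conj m).re + max 0 (2 * s - 1) * (y * conj m).re := by
    intro s
    unfold bentArc
    rw [add_mul, mul_assoc, mul_assoc, add_re, re_ofReal_mul, re_ofReal_mul]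
  intro s t hst
  simp only [e]
  rcases max_cases 0 (1 - 2 * s) with ⟨h1, h1'⟩ | ⟨h1, h1'⟩ <;>
    rcases max_cases 0 (1 - 2 * t) with ⟨h2, h2'⟩ | ⟨h2, h2'⟩ <;>
    rcases max_cases 0 (2 * s - 1) with ⟨h3, h3'⟩ | ⟨h3, h3'⟩ <;>
    rcases max_cases 0 (2 * t - 1) with ⟨h4, h4'⟩ | ⟨h4, h4'⟩ <;>
    rw [h1, h2, h3, h4] <;> nlinarith

open ComplexConjugate in
lemma isLocalHomeomorphOn_bentArc_blend {p y m₀ m₁ : ℂ} (h0 : 0 < (y * conj m₀).re)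
    (h1 : 0 < (y * conj m₁).re) {χ : ℝ → ℝ} (hχ : ContDiff ℝ 1 χ) (hχI : ∀ s, χ s ∈ Icc (0:ℝ) 1)
    {s : ℝ} (hs : 1 / 2 < s) :
    IsLocalHomeomorphOn (fun q : ℝ × ℝ => bentArc p y q.1 +
      q.2 * (((1 - χ q.1 : ℝ) * m₀ + (χ q.1 : ℝ) * m₁) * I)) {(s, 0)} := by
  have hev : ∀ᶠ q : ℝ × ℝ in 𝓝 (s, 0), 1 / 2 < q.1 :=
    continuous_fst.continuousAt.eventually (lt_mem_nhds hs)
  refine IsLocalHomeomorphOn.congr_nhds (g := fun q : ℝ × ℝ => (2 * q.1 - 1 : ℝ) * y +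
      q.2 * (((1 - χ q.1 : ℝ) * m₀ + (χ q.1 : ℝ) * m₁) * I)) ?_ ?_
  · have hof : ContDiff ℝ 1 (fun x : ℝ => (x : ℂ)) := ofRealCLM.contDiff
    refine isLocalHomeomorphOn_of_partialDeriv (u := 2 * y)
      (v := (((1 - χ s : ℝ) * m₀ + (χ s : ℝ) * m₁) * I)) ?_ ?_ ?_ ?_
    · have c1 : ContDiff ℝ 1 fun q : ℝ × ℝ => ((2 * q.1 - 1 : ℝ) : ℂ) := hof.comp (by fun_prop)
      have c2 : ContDiff ℝ 1 fun q : ℝ × ℝ => (q.2 : ℂ) := hof.comp contDiff_snd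
      have c3 : ContDiff ℝ 1 fun q : ℝ × ℝ => ((1 - χ q.1 : ℝ) : ℂ) :=
        hof.comp (contDiff_const.sub (hχ.comp contDiff_fst))
      have c4 : ContDiff ℝ 1 fun q : ℝ × ℝ => (χ q.1 : ℂ) := hof.comp (hχ.comp contDiff_fst)
      exact ((c1.mul contDiff_const).add (c2.mul (((c3.mul contDiff_const).add
        (c4.mul contDiff_const)).mul contDiff_const))).contDiffAt
    · simp only [ofReal_zero, zero_mul, add_zero]
      have h2 : HasDerivAt (fun σ : ℝ => ((2 * σ - 1 : ℝ) : ℂ)) ((2 * 1 : ℝ) : ℂ) s :=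
        (((hasDerivAt_id s).const_mul 2).sub_const 1).ofReal_comp
      exact (h2.mul_const y).congr_deriv (by norm_num)
    · have h2 : HasDerivAt (fun τ : ℝ => (τ : ℂ)) ((1 : ℝ) : ℂ) 0 := (hasDerivAt_id 0).ofReal_comp
      exact ((h2.mul_const (((1 - χ s : ℝ) * m₀ + (χ s : ℝ) * m₁) * I)).const_add
        ((2 * s - 1 : ℝ) * y)).congr_deriv (by norm_num)
    · have e : (conj (2 * y) * (((1 - χ s : ℝ) * m₀ + (χ s : ℝ) * m₁) * I)).im =
          2 * ((1 - χ s) * (y * conj m₀).re + χ s * (y * conj m₁).re) := by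
        simp only [mul_im, mul_re, add_im, add_re, conj_re, conj_im, ofReal_re, ofReal_im, I_re,
          I_im, map_mul, re_ofNat, im_ofNat]
        ring
      rw [e]
      have h3 := hχI s
      rcases eq_or_lt_of_le h3.1 with h4 | h4
      · rw [← h4]; linarith
      · nlinarith [mul_nonneg (sub_nonneg.2 h3.2) h0.le, mul_pos h4 h1]
  · filter_upwards [hev] with q hq
    rw [bentArc_of_ge hq.le]

open ComplexConjugate in
lemma isLocalHomeomorphOn_conformal_blend {h : ℂ → ℂ} {p m₀ m₁ : ℂ} {χ : ℝ → ℝ}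
    (hχ : ContDiff ℝ 1 χ) (hχI : ∀ s, χ s ∈ Icc (0:ℝ) 1) {s : ℝ}
    (hd : AnalyticAt ℂ h ((1 - 2 * (s - 1) : ℝ) * p)) (h0 : 0 < (-p * conj m₀).re)
    (h1 : 0 < (-(deriv h ((1 - 2 * (s - 1) : ℝ) * p) * p) * conj m₁).re) :
    IsLocalHomeomorphOn (fun q : ℝ × ℝ =>
      (1 - χ q.1 : ℝ) * (h ((1 - 2 * (q.1 - 1) : ℝ) * p) + q.2 * (m₁ * I)) +
      (χ q.1 : ℝ) * h ((1 - 2 * (q.1 - 1) : ℝ) * p + q.2 * (m₀ * I))) {(s, 0)} := by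
  have hof : ContDiff ℝ 1 (fun x : ℝ => (x : ℂ)) := ofRealCLM.contDiff
  set D := deriv h ((1 - 2 * (s - 1) : ℝ) * p) with hD
  have hder : HasDerivAt h D ((1 - 2 * (s - 1) : ℝ) * p) := hd.differentiableAt.hasDerivAt
  refine isLocalHomeomorphOn_of_partialDeriv (u := D * (-2 * p))
    (v := (1 - χ s : ℝ) * (m₁ * I) + (χ s : ℝ) * (D * (m₀ * I))) ?_ ?_ ?_ ?_
  · have c1 : ContDiff ℝ 1 fun q : ℝ × ℝ => ((1 - 2 * (q.1 - 1) : ℝ) : ℂ) := hof.comp (by fun_prop)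
    have c2 : ContDiff ℝ 1 fun q : ℝ × ℝ => (q.2 : ℂ) := hof.comp contDiff_snd
    have c3 : ContDiff ℝ 1 fun q : ℝ × ℝ => ((1 - χ q.1 : ℝ) : ℂ) :=
      hof.comp (contDiff_const.sub (hχ.comp contDiff_fst))
    have c4 : ContDiff ℝ 1 fun q : ℝ × ℝ => (χ q.1 : ℂ) := hof.comp (hχ.comp contDiff_fst)
    have hR : ContDiffAt ℝ 1 h ((1 - 2 * (s - 1) : ℝ) * p) := hd.contDiffAt.restrict_scalars ℝ
    have c5 : ContDiffAt ℝ 1 (fun q : ℝ × ℝ => h ((1 - 2 * (q.1 - 1) : ℝ) * p)) (s, 0) :=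
      ContDiffAt.comp (g := h) (s, (0:ℝ)) hR (c1.mul contDiff_const).contDiffAt
    have c6 : ContDiffAt ℝ 1 (fun q : ℝ × ℝ => h ((1 - 2 * (q.1 - 1) : ℝ) * p + q.2 * (m₀ * I)))
        (s, 0) := by
      refine ContDiffAt.comp (g := h) (s, (0:ℝ)) ?_
        ((c1.mul contDiff_const).add (c2.mul contDiff_const)).contDiffAt
      simpa using hR
    exact (c3.contDiffAt.mul (c5.add (c2.mul contDiff_const).contDiffAt)).add
      (c4.contDiffAt.mul c6)
  · have h2 : HasDerivAt (fun σ : ℝ => ((1 - 2 * (σ - 1) : ℝ) : ℂ) * p) (((-(2 * 1) : ℝ) : ℂ) * p) s :=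
      (((((hasDerivAt_id s).sub_const 1).const_mul 2).const_sub 1).ofReal_comp).mul_const p
    have h3 := hder.comp s h2
    refine (h3.congr_deriv (by push_cast; ring)).congr_of_eventuallyEq
      (Eventually.of_forall fun σ => ?_)
    simp only [ofReal_zero, zero_mul, add_zero, ← add_mul, ← ofReal_add, sub_add_cancel,
      ofReal_one, one_mul, Function.comp_apply]
  · have h2 : ∀ n : ℂ, HasDerivAt (fun τ : ℝ => (τ : ℂ) * n) (((1 : ℝ) : ℂ) * n) 0 :=
      fun n => ((hasDerivAt_id 0).ofReal_comp).mul_const n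
    have h3 : HasDerivAt (fun τ : ℝ => ((1 - 2 * (s - 1) : ℝ) : ℂ) * p + (τ : ℂ) * (m₀ * I))
        (((1 : ℝ) : ℂ) * (m₀ * I)) 0 := (h2 _).const_add _
    have h4 := HasDerivAt.comp (h₂ := h) (h₂' := D) 0 (by simpa using hder) h3
    exact ((((h2 (m₁ * I)).const_add (h ((1 - 2 * (s - 1) : ℝ) * p))).const_mul
      ((1 - χ s : ℝ) : ℂ)).add (h4.const_mul (χ s : ℂ))).congr_deriv (by simp)
  · have e : (conj (D * (-2 * p)) * ((1 - χ s : ℝ) * (m₁ * I) + (χ s : ℝ) * (D * (m₀ * I)))).im =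
        2 * ((1 - χ s) * (-(D * p) * conj m₁).re + χ s * (normSq D * (-p * conj m₀).re)) := by
      simp only [mul_im, mul_re, add_im, add_re, conj_re, conj_im, ofReal_re, ofReal_im, I_re,
        I_im, map_mul, neg_re, neg_im, normSq_apply, map_neg, re_ofNat, im_ofNat]
      ring
    rw [e]
    have hD0 : 0 < normSq D := by
      refine normSq_pos.2 ?_
      intro h
      rw [h] at h1
      simp at h1
    have h3 := hχI s
    have h5 := mul_pos hD0 h0
    rcases eq_or_lt_of_le h3.1 with h4 | h4
    · rw [← h4]; linarith
    · nlinarith [mul_nonneg (sub_nonneg.2 h3.2) h1.le, mul_pos h4 h5]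

end Complex

namespace Complex

open ComplexConjugate in
lemma strictMonoOn_of_analyticAt {h : ℂ → ℂ} {p m : ℂ} {δ : ℝ}
    (hη : ∀ r : ℝ, 0 ≤ r → r ≤ δ → AnalyticAt ℂ h ((1 - 2 * r : ℝ) * p) ∧
      0 < (-(deriv h ((1 - 2 * r : ℝ) * p) * p) * conj m).re) :
    StrictMonoOn (fun s : ℝ => (h ((1 - 2 * (s - 1) : ℝ) * p) * conj m).re) (Icc 1 (1 + δ)) := by
  have hder : ∀ s ∈ Icc (1:ℝ) (1 + δ), HasDerivAt
      (fun s : ℝ => (h ((1 - 2 * (s - 1) : ℝ) * p) * conj m).re)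
      (2 * (-(deriv h ((1 - 2 * (s - 1) : ℝ) * p) * p) * conj m).re) s := by
    intro s hs
    have h1 := (hη (s - 1) (by linarith [hs.1]) (by linarith [hs.2])).1
    have h2 : HasDerivAt (fun σ : ℝ => ((1 - 2 * (σ - 1) : ℝ) : ℂ) * p) (((-(2 * 1) : ℝ) : ℂ) * p) s :=
      (((((hasDerivAt_id s).sub_const 1).const_mul 2).const_sub 1).ofReal_comp).mul_const p
    have h3 := (h1.differentiableAt.hasDerivAt.comp s h2).mul_const (conj m)
    have h4 := reCLM.hasFDerivAt.comp_hasDerivAt s h3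
    refine h4.congr_deriv ?_
    change (deriv h ((1 - 2 * (s - 1) : ℝ) * p) * (((-(2 * 1) : ℝ) : ℂ) * p) * conj m).re = _
    rw [← re_ofReal_mul]
    congr 1
    push_cast
    ring
  refine strictMonoOn_of_deriv_pos (convex_Icc _ _)
    (fun s hs => (hder s hs).continuousAt.continuousWithinAt) fun s hs => ?_
  have hs' := interior_subset hs
  rw [(hder s hs').deriv]
  have := (hη (s - 1) (by linarith [hs'.1]) (by linarith [hs'.2])).2
  linarith

open ComplexConjugate in
/-- A bent translation arc starting at a point of conformality lies in a translation strip. -/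
theorem IsotopicToIdMap.exists_strip_of_bentArc {h : ℂ ≃ₜ ℂ} (hh : IsotopicToIdMap h)
    (hf : ∀ z, h z ≠ z) {p m₀ m₁ : ℂ} (hd : AnalyticAt ℂ h p) (h0p : 0 < (-p * conj m₀).re)
    (h0y : 0 < (h p * conj m₀).re) (h1y : 0 < (h p * conj m₁).re)
    (h1d : 0 < (-(deriv h p * p) * conj m₁).re)
    (hfree : ∀ r s, 0 < r → r ≤ s → s < 1 → bentArc p (h p) s ≠ h (bentArc p (h p) r)) :
    ∃ Θ : ℝ × ℝ → ℂ, IsOpenEmbedding Θ ∧ (∀ s t, Θ (s + 1, t) = h (Θ (s, t))) ∧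
      0 ∈ range Θ := by
  set A := bentArc p (h p) with hA
  have hAc : Continuous A := continuous_bentArc _ _
  have hA0 : A 0 = p := by rw [hA, bentArc_of_le (by norm_num)]; norm_num
  have hA1 : A 1 = h p := by rw [hA, bentArc_of_ge (by norm_num)]; norm_num
  have hmono₀ : StrictMono fun s => (A s * conj m₀).re := strictMono_bentArc h0p h0y
  obtain ⟨l, -, hle, hlA, hli⟩ := h.exists_translation_curve hh hf hAc (by rw [hA0, hA1])
    (fun s _ t _ hst => hmono₀.injective (by simp only [hst])) hfree
  obtain ⟨η, hη, hηP⟩ : ∃ η > 0, ∀ r : ℝ, |r| < η → AnalyticAt ℂ h ((1 - 2 * r : ℝ) * p) ∧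
      0 < (-(deriv h ((1 - 2 * r : ℝ) * p) * p) * conj m₁).re := by
    have hc : Continuous fun r : ℝ => ((1 - 2 * r : ℝ) : ℂ) * p := by fun_prop
    have ht : Tendsto (fun r : ℝ => ((1 - 2 * r : ℝ) : ℂ) * p) (𝓝 0) (𝓝 p) := by
      simpa using hc.tendsto 0
    have h1 := ht.eventually hd.eventually_analyticAt
    have h2 : ContinuousAt (fun z => (-(deriv h z * p) * conj m₁).re) p := by
      have := hd.deriv.continuousAt
      fun_prop
    have h3 := ht.eventually (h2.eventually (lt_mem_nhds h1d))
    obtain ⟨η, hη, hb⟩ := Metric.eventually_nhds_iff.1 (h1.and h3)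
    exact ⟨η, hη, fun r hr => hb (by simpa using hr)⟩
  set δ := min (η / 4) (1 / 16) with hδ
  have hδ0 : 0 < δ := by positivity
  have hδη : 4 * δ ≤ η := by linarith [min_le_left (η / 4) (1 / 16)]
  have hδ1 : 16 * δ ≤ 1 := by linarith [min_le_right (η / 4) (1 / 16)]
  set χ₁ : ℝ → ℝ := fun s => Real.smoothTransition (8 * s - 6) with hχ₁
  set χ₂ : ℝ → ℝ := fun s => Real.smoothTransition ((s - 1 - δ) / δ) with hχ₂
  have c₁ : ContDiff ℝ 1 χ₁ := Real.smoothTransition.contDiff.comp (by fun_prop)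
  have c₂ : ContDiff ℝ 1 χ₂ := Real.smoothTransition.contDiff.comp (by fun_prop)
  have i₁ : ∀ s, χ₁ s ∈ Icc (0:ℝ) 1 := fun s =>
    ⟨Real.smoothTransition.nonneg _, Real.smoothTransition.le_one _⟩
  have i₂ : ∀ s, χ₂ s ∈ Icc (0:ℝ) 1 := fun s =>
    ⟨Real.smoothTransition.nonneg _, Real.smoothTransition.le_one _⟩
  have z₁ : ∀ s ≤ 3 / 4, χ₁ s = 0 := fun s hs =>
    Real.smoothTransition.zero_of_nonpos (by linarith)
  have o₁ : ∀ s, 7 / 8 ≤ s → χ₁ s = 1 := fun s hs =>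
    Real.smoothTransition.one_of_one_le (by linarith)
  have z₂ : ∀ s ≤ 1 + δ, χ₂ s = 0 := fun s hs =>
    Real.smoothTransition.zero_of_nonpos (div_nonpos_of_nonpos_of_nonneg (by linarith) hδ0.le)
  have o₂ : ∀ s, 1 + 2 * δ ≤ s → χ₂ s = 1 := fun s hs =>
    Real.smoothTransition.one_of_one_le (by rw [one_le_div hδ0]; linarith)
  set F : ℝ × ℝ → ℂ := fun q => if q.1 ≤ 1 then
      A q.1 + q.2 * (((1 - χ₁ q.1 : ℝ) * m₀ + (χ₁ q.1 : ℝ) * m₁) * I) else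
      (1 - χ₂ q.1 : ℝ) * (h (A (q.1 - 1)) + q.2 * (m₁ * I)) +
      (χ₂ q.1 : ℝ) * h (A (q.1 - 1) + q.2 * (m₀ * I)) with hF
  have hF₁ : ∀ q : ℝ × ℝ, q.1 ≤ 1 → F q =
      A q.1 + q.2 * (((1 - χ₁ q.1 : ℝ) * m₀ + (χ₁ q.1 : ℝ) * m₁) * I) := fun q hq => if_pos hq
  have hF₂ : ∀ q : ℝ × ℝ, 1 < q.1 → F q =
      (1 - χ₂ q.1 : ℝ) * (h (A (q.1 - 1)) + q.2 * (m₁ * I)) +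
      (χ₂ q.1 : ℝ) * h (A (q.1 - 1) + q.2 * (m₀ * I)) := fun q hq => if_neg hq.not_ge
  have hF₀ : ∀ q : ℝ × ℝ, q.1 ≤ 3 / 4 → F q = A q.1 + q.2 * (m₀ * I) := by
    intro q hq
    rw [hF₁ q (by linarith), z₁ _ hq]
    simp
  have hF₃ : ∀ q : ℝ × ℝ, 1 + 2 * δ ≤ q.1 → F q = h (A (q.1 - 1) + q.2 * (m₀ * I)) := by
    intro q hq
    rw [hF₂ q (by linarith), o₂ _ hq]
    simp
  have hχc₁ := c₁.continuous
  have hχc₂ := c₂.continuous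
  have hFc : Continuous F := by
    refine Continuous.if_le (by fun_prop) (by fun_prop) continuous_fst continuous_const ?_
    rintro ⟨s, t⟩ hs
    obtain rfl : s = 1 := hs
    simp only [z₂ 1 (by linarith), o₁ 1 (by norm_num), sub_self, hA0, hA1]
    simp
  have hFl : ∀ s, 4 * δ ≤ s → s ≤ 1 + 4 * δ → F (s, 0) = l s := by
    intro s hs1 hs2
    rcases le_or_gt s 1 with h1 | h1
    · rw [hF₁ _ h1, hlA ⟨by linarith, h1⟩]
      simp
    · have h2 := hle (s - 1)
      have h3 := hlA (show s - 1 ∈ Icc (0:ℝ) 1 from ⟨by linarith, by linarith⟩)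
      rw [sub_add_cancel, h3] at h2
      rw [hF₂ _ h1, h2]
      simp only [ofReal_zero, zero_mul, add_zero]
      push_cast
      ring
  obtain ⟨Ψ₀, hΨc, hΨe, hΨF⟩ := h.exists_equivariant_extension (F := fun s t => F (s + 4 * δ, t))
    (δ := δ) (hFc.comp (by fun_prop)) hδ0 (by linarith) (by
      intro s t hs
      rw [abs_lt] at hs
      rw [hF₃ _ (by change _ ≤ s + 1 + 4 * δ; linarith),
        hF₀ _ (by change s + 4 * δ ≤ _; linarith)]
      simp only
      rw [show s + 1 + 4 * δ - 1 = s + 4 * δ by ring])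
  set Ψ : ℝ × ℝ → ℂ := fun q => Ψ₀ (q.1 - 4 * δ) q.2 with hΨ
  have hΨc' : Continuous Ψ := hΨc.comp (f := fun q : ℝ × ℝ => (q.1 - 4 * δ, q.2)) (by fun_prop)
  have hΨe' : ∀ s t, Ψ (s + 1, t) = h (Ψ (s, t)) := by
    intro s t
    simp only [hΨ]
    rw [← hΨe]
    congr 1
    ring
  have hΨF' : ∀ q : ℝ × ℝ, 3 * δ < q.1 → q.1 < 1 + 5 * δ → Ψ q = F q := by
    intro q h1 h2
    simp only [hΨ]
    rw [hΨF _ _ (by linarith) (by linarith), sub_add_cancel]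
  have hΨl : ∀ s, Ψ (s, 0) = l s := by
    intro s
    have h1 := h.map_add_intCast_of_equivariant (f := fun s => Ψ (s, 0)) (fun s => hΨe' s 0)
      ⌊s - 4 * δ⌋ (s - ⌊s - 4 * δ⌋)
    have h2 := h.map_add_intCast_of_equivariant hle ⌊s - 4 * δ⌋ (s - ⌊s - 4 * δ⌋)
    have h3 := Int.floor_le (s - 4 * δ)
    have h4 := Int.lt_floor_add_one (s - 4 * δ)
    rw [sub_add_cancel] at h1 h2
    rw [h1, h2, hΨF' _ (by change _ < s - _; linarith) (by change s - _ < _; linarith),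
      hFl _ (by linarith) (by linarith)]
  have hev : ∀ {a b s : ℝ}, a < s → s < b → ∀ᶠ q : ℝ × ℝ in 𝓝 (s, 0), a < q.1 ∧ q.1 < b := by
    intro a b s h1 h2
    exact continuous_fst.continuousAt.eventually (isOpen_Ioo.mem_nhds ⟨h1, h2⟩)
  have hFloc : ∀ s, 4 * δ ≤ s → s ≤ 1 + 4 * δ → IsLocalHomeomorphOn F {(s, 0)} := by
    intro s hs1 hs2
    rcases lt_or_ge s (3 / 4) with h1 | h1
    · refine (isLocalHomeomorphOn_add_transverse hAc (m := m₀) (a := 0) (b := 1)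
        (hmono₀.strictMonoOn _) ⟨by linarith, by linarith⟩).congr_nhds ?_
      filter_upwards [hev (show s - 1 < s by linarith) h1] with q hq
      exact hF₀ q hq.2.le
    rcases lt_trichotomy s 1 with h2 | h2 | h2
    · refine (isLocalHomeomorphOn_bentArc_blend h0y h1y c₁ i₁ (p := p)
        (show 1 / 2 < s by linarith)).congr_nhds ?_
      filter_upwards [hev (show s - 1 < s by linarith) h2] with q hq
      exact hF₁ q hq.2.le
    · subst h2
      set c : ℝ → ℂ := fun s => if s ≤ 1 then A s else h (A (s - 1)) with hc
      have hcc : Continuous c := by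
        refine Continuous.if_le hAc (by fun_prop) continuous_id continuous_const ?_
        rintro x rfl
        rw [sub_self, hA0, hA1]
      have hc2 : ∀ s ∈ Icc (1:ℝ) (1 + δ), c s = h ((1 - 2 * (s - 1) : ℝ) * p) := by
        intro s hs
        have e : A (s - 1) = (1 - 2 * (s - 1) : ℝ) * p := bentArc_of_le (by linarith [hs.2])
        rcases hs.1.eq_or_lt with h3 | h3
        · subst h3
          simp [hc, hA1]
        · simp only [hc, if_neg h3.not_ge, e]
      have hcm : StrictMonoOn (fun s => (c s * conj m₁).re) (Icc (3 / 4) (1 + δ)) := by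
        rw [← Icc_union_Icc_eq_Icc (show (3 / 4 : ℝ) ≤ 1 by norm_num) (by linarith)]
        refine StrictMonoOn.union (c := 1) ?_ ?_ (isGreatest_Icc (by norm_num))
          (isLeast_Icc (by linarith))
        · have h3 : StrictMonoOn (fun s : ℝ => (2 * s - 1) * (h p * conj m₁).re)
              (Icc (3 / 4) 1) := fun x _ y _ hxy => by
            simp only
            nlinarith
          refine h3.congr fun s hs => ?_
          simp only [hc, if_pos hs.2]
          rw [hA, bentArc_of_ge (by linarith [hs.1]), mul_assoc, re_ofReal_mul]
        · refine (strictMonoOn_of_analyticAt (h := h) (p := p) (m := m₁) fun r h3 h4 =>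
            hηP r (by rw [abs_of_nonneg h3]; linarith)).congr fun s hs => ?_
          simp only [hc2 s hs]
      refine (isLocalHomeomorphOn_add_transverse hcc hcm (s := 1) (t := 0)
        ⟨by norm_num, by linarith⟩).congr_nhds ?_
      filter_upwards [hev (show (7 / 8 : ℝ) < 1 by norm_num) (show 1 < 1 + δ by linarith)] with q hq
      rcases le_or_gt q.1 1 with h3 | h3
      · rw [hF₁ q h3, o₁ _ hq.1.le]
        simp [hc, h3]
      · rw [hF₂ q h3, z₂ _ hq.2.le]
        simp [hc, h3.not_ge]
    · rcases lt_or_ge s (1 + 3 * δ) with h3 | h3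
      · obtain ⟨h4, h5⟩ := hηP (s - 1) (by rw [abs_lt]; constructor <;> linarith)
        refine (isLocalHomeomorphOn_conformal_blend c₂ i₂ h4 h0p h5).congr_nhds ?_
        filter_upwards [hev h2 h3] with q hq
        have e : A (q.1 - 1) = (1 - 2 * (q.1 - 1) : ℝ) * p := bentArc_of_le (by linarith [hq.2])
        rw [hF₂ q hq.1, e]
      · have h4 : IsLocalHomeomorphOn (fun q : ℝ × ℝ => A q.1 + q.2 * (m₀ * I)) {(s - 1, 0)} :=
          isLocalHomeomorphOn_add_transverse hAc (m := m₀) (a := 0) (b := 1)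
            (hmono₀.strictMonoOn _) ⟨by linarith, by linarith⟩
        have h5 : IsLocalHomeomorphOn (fun q : ℝ × ℝ => (q.1 + (-1), q.2)) {(s, (0:ℝ))} :=
          (((Homeomorph.addRight (-1 : ℝ)).prodCongr
            (Homeomorph.refl ℝ)).isLocalHomeomorph.isLocalHomeomorphOn).mono (subset_univ _)
        have h6 := h.isLocalHomeomorph.isLocalHomeomorphOn.comp (h4.comp h5 (by
          rintro _ rfl
          simp [sub_eq_add_neg])) (mapsTo_univ _ _)
        refine h6.congr_nhds ?_
        filter_upwards [hev (show 1 + 2 * δ < s by linarith) (show s < s + 1 by linarith)]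
          with q hq
        rw [hF₃ q hq.1.le, sub_eq_add_neg]
        rfl
  have hΨloc : ∀ s, IsLocalHomeomorphOn Ψ {(s, 0)} := by
    intro s
    have h3 := Int.floor_le (s - 4 * δ)
    have h4 := Int.lt_floor_add_one (s - 4 * δ)
    have h5 : IsLocalHomeomorphOn Ψ {(s - ⌊s - 4 * δ⌋, 0)} := by
      refine (hFloc _ (by linarith) (by linarith)).congr_nhds ?_
      filter_upwards [hev (show 3 * δ < s - ⌊s - 4 * δ⌋ by linarith)
        (show s - ⌊s - 4 * δ⌋ < 1 + 5 * δ by linarith)] with q hq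
      exact hΨF' q hq.1 hq.2
    simpa using h5.add_intCast_of_equivariant h hΨe' ⌊s - 4 * δ⌋
  obtain ⟨Θ, h1, h2, h3⟩ := hh.exists_isOpenEmbedding_strip hf hΨc' hΨe'
    (by simpa only [hΨl] using hli) hΨloc
  refine ⟨Θ, h1, h2, (1 / 2, 0), ?_⟩
  rw [h3, hΨl, hlA ⟨by norm_num, by norm_num⟩, hA, bentArc_of_le le_rfl]
  norm_num

end Complex

lemma Continuous.exists_forall_le_of_isLeast_Icc {f : ℝ → ℝ} (hf : Continuous f)
    (h : ∀ t ∈ Ico (0:ℝ) 1, f 1 < f t) {P : ℝ → Prop} (hP : ∀ᶠ t in 𝓝 1, P t) :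
    ∃ p ∈ Ioo (0:ℝ) 1, P p ∧ ∀ q ∈ Icc 0 p, f p ≤ f q := by
  obtain ⟨η, hη, hb⟩ := Metric.eventually_nhds_iff.1 hP
  set ε := min η (1 / 2) with hε
  have hε0 : 0 < ε := by positivity
  have hε1 : ε ≤ 1 / 2 := min_le_right _ _
  obtain ⟨c, hc, hcm⟩ := (isCompact_Icc (a := (0:ℝ)) (b := 1 - ε)).exists_isMinOn
    ⟨0, le_rfl, by linarith⟩ hf.continuousOn
  have h1 : ∀ᶠ t in 𝓝[<] (1:ℝ), f t < f c := nhdsWithin_le_nhds <|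
    hf.continuousAt.eventually (gt_mem_nhds (h c ⟨hc.1, by linarith [hc.2]⟩))
  have h2 : ∀ᶠ t in 𝓝[<] (1:ℝ), t ∈ Ioo (1 - ε) 1 := Ioo_mem_nhdsLT (by linarith)
  obtain ⟨τ, hτ, hτ0, hτ1⟩ := (h1.and h2).exists
  obtain ⟨p, hp, hpm⟩ := (isCompact_Icc (a := (0:ℝ)) (b := τ)).exists_isMinOn
    ⟨0, le_rfl, by linarith⟩ hf.continuousOn
  have hpε : 1 - ε < p := by
    by_contra! hle
    have h3 := hcm (show p ∈ Icc 0 (1 - ε) from ⟨hp.1, hle⟩)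
    have h4 := hpm (show τ ∈ Icc 0 τ from ⟨by linarith, le_rfl⟩)
    simp only [mem_ofPred_eq] at h3 h4
    linarith
  refine ⟨p, ⟨by linarith, hp.2.trans_lt hτ1⟩, hb ?_, fun q hq => hpm ⟨hq.1, hq.2.trans hp.2⟩⟩
  rw [Real.dist_eq, abs_lt]
  have := min_le_left η (1 / 2)
  constructor <;> linarith [hp.2]

namespace Complex

open ComplexConjugate in
lemma re_mul_conj_self (z : ℂ) : (z * conj z).re = ‖z‖ ^ 2 := by
  rw [mul_conj, ofReal_re, normSq_eq_norm_sq]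

open ComplexConjugate in
lemma re_mul_conj_comm (z w : ℂ) : (z * conj w).re = (w * conj z).re := by
  simp only [mul_re, conj_re, conj_im]; ring

open ComplexConjugate in
lemma re_mul_conj_nonneg_of_forall_norm_le {h : ℂ → ℂ} {p : ℂ} (hd : DifferentiableAt ℂ h p)
    (hm : ∀ q ∈ segment ℝ p 0, ‖h p‖ ≤ ‖h q‖) : 0 ≤ (-(deriv h p * p) * conj (h p)).re := by
  have h1 := ((hd.hasDerivAt.hasFDerivAt.restrictScalars ℝ).norm_sq).hasFDerivWithinAt
    (s := segment ℝ p 0)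
  have h2 : IsLocalMinOn (fun z => ‖h z‖ ^ 2) (segment ℝ p 0) p :=
    IsMinOn.localize fun q hq => by
      simp only [mem_ofPred_eq]
      gcongr
      exact hm q hq
  have h3 := h2.hasFDerivWithinAt_nonneg h1
    (sub_mem_posTangentConeAt_of_segment_subset subset_rfl)
  simp [Complex.inner] at h3
  simp only [neg_mul, neg_re, mul_re, mul_im, conj_re, conj_im]
  linarith

open ComplexConjugate in
/-- If the unit disc is free, touches its image at `h 1` and `h` is conformal on the horodisc at
`1`, then the origin lies in a translation strip. -/
lemma IsotopicToIdMap.exists_strip_of_conformal {h : ℂ ≃ₜ ℂ} (hh : IsotopicToIdMap h)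
    (hf : ∀ z, h z ≠ z) (hd : DifferentiableOn ℂ h (Metric.ball (1 / 2 : ℂ) (1 / 2)))
    (hd0 : ∀ w ∈ Metric.ball (1 / 2 : ℂ) (1 / 2), deriv h w ≠ 0)
    (hlt : ∀ q, ‖q‖ < 1 → 1 < ‖h q‖) (hle : ∀ q, ‖q‖ ≤ 1 → 1 ≤ ‖h q‖) (h1 : ‖h 1‖ = 1) :
    ∃ Θ : ℝ × ℝ → ℂ, IsOpenEmbedding Θ ∧ (∀ s t, Θ (s + 1, t) = h (Θ (s, t))) ∧
      0 ∈ range Θ := by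
  have hc : Continuous fun t : ℝ => h t := by fun_prop
  have e1 : ∀ᶠ t : ℝ in 𝓝 1, (h t).re < ‖h t‖ := by
    refine (isOpen_lt (by fun_prop) (by fun_prop)).mem_nhds (lt_of_le_of_ne (re_le_norm _) ?_)
    intro he
    refine hf 1 (Complex.ext ?_ ?_)
    · rw [ofReal_one] at he
      simp [he, h1]
    · have := (re_eq_norm.1 he).2
      simpa using this.symm
  have e2 : ∀ᶠ t : ℝ in 𝓝 1, ∀ q ∈ Icc (0:ℝ) 1 ×ˢ Icc (0:ℝ) 1,
      (q.2 : ℂ) * h t ≠ h ((q.1 : ℂ) * h t) := by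
    refine (isCompact_Icc.prod isCompact_Icc).eventually_forall_of_forall_eventually ?_
    rintro ⟨r, s⟩ ⟨hr, hs⟩
    refine (isOpen_ne_fun (by fun_prop) (by fun_prop)).mem_nhds ?_
    simp only [mem_ofPred_eq, ofReal_one]
    intro he
    have hn : ‖(s : ℂ) * h 1‖ = s := by rw [norm_mul, h1, norm_real, mul_one, Real.norm_of_nonneg hs.1]
    have hn' : ‖(r : ℂ) * h 1‖ = r := by rw [norm_mul, h1, norm_real, mul_one, Real.norm_of_nonneg hr.1]
    rcases hr.2.lt_or_eq with h2 | h2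
    · have := hlt _ (hn'.trans_lt h2)
      rw [← he, hn] at this
      exact this.not_ge hs.2
    · subst h2
      have := hle _ hn'.le
      rw [← he, hn] at this
      obtain rfl : s = 1 := le_antisymm hs.2 this
      simp only [ofReal_one, one_mul] at he
      exact hf _ he.symm
  obtain ⟨p, hp, ⟨hp1, hp2⟩, hpm⟩ := hc.norm.exists_forall_le_of_isLeast_Icc (fun t ht => by
    simp only [ofReal_one, h1]
    exact hlt _ (by rw [norm_real, Real.norm_of_nonneg ht.1]; exact ht.2)) (e1.and e2)
  have hpb : (p : ℂ) ∈ Metric.ball (1 / 2 : ℂ) (1 / 2) := by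
    rw [mem_ball_iff_norm, show (p : ℂ) - 1 / 2 = ((p - 1 / 2 : ℝ) : ℂ) by push_cast; ring,
      norm_real, Real.norm_eq_abs, abs_lt]
    constructor <;> linarith [hp.1, hp.2]
  have hpd := hd.analyticAt (Metric.isOpen_ball.mem_nhds hpb)
  set v := -(deriv h p * p) with hv
  set y := h p with hy
  have hy0 : 0 < ‖y‖ := one_pos.trans_le
    (hle _ (by rw [norm_real, Real.norm_of_nonneg hp.1.le]; exact hp.2.le))
  have hv0 : 0 < ‖v‖ := norm_pos_iff.2 <| neg_ne_zero.2 <|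
    mul_ne_zero (hd0 _ hpb) (ofReal_ne_zero.2 hp.1.ne')
  have hvy : 0 ≤ (v * conj y).re := by
    refine re_mul_conj_nonneg_of_forall_norm_le hpd.differentiableAt fun q hq => ?_
    obtain ⟨a, b, ha, hb, hab, rfl⟩ := hq
    have := hpm (a * p) ⟨by have := hp.1; positivity, by nlinarith [hp.1]⟩
    simpa using this
  refine hh.exists_strip_of_bentArc hf (p := p) (m₀ := y - ‖y‖)
    (m₁ := ‖v‖ * y + ‖y‖ * v) hpd ?_ ?_ ?_ ?_ ?_
  · simp only [mul_re, neg_re, neg_im, conj_re, conj_im, sub_re, sub_im, ofReal_re, ofReal_im]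
    nlinarith [hp.1]
  · rw [← hy, map_sub, mul_sub, sub_re, re_mul_conj_self, conj_ofReal, mul_comm, re_ofReal_mul]
    nlinarith
  · rw [← hy, map_add, map_mul, map_mul, conj_ofReal, conj_ofReal, mul_add, mul_left_comm,
      mul_left_comm y, add_re, re_ofReal_mul, re_ofReal_mul, re_mul_conj_self, re_mul_conj_comm y v]
    positivity
  · rw [← hv, map_add, map_mul, map_mul, conj_ofReal, conj_ofReal, mul_add, mul_left_comm,
      mul_left_comm v, add_re, re_ofReal_mul, re_ofReal_mul, re_mul_conj_self]
    positivity
  · intro r s hr hrs hs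
    rw [← hy]
    rcases lt_or_ge r (1 / 2) with h2 | h2
    · rw [bentArc_of_le h2.le]
      have hb : ((1 - 2 * r : ℝ) : ℂ) * p = ((1 - 2 * r) * p : ℝ) := by push_cast; ring
      have h0 : 0 ≤ (1 - 2 * r) * p := mul_nonneg (by linarith) hp.1.le
      have h0' : (1 - 2 * r) * p ≤ p := by nlinarith [hp.1]
      have h3 := hlt (((1 - 2 * r) * p : ℝ) : ℂ)
        (by rw [norm_real, Real.norm_of_nonneg h0]; linarith [hp.2])
      have h4 := hpm ((1 - 2 * r) * p) ⟨h0, h0'⟩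
      rw [hb]
      intro he
      rw [← he] at h3 h4
      rcases le_or_gt s (1 / 2) with h5 | h5
      · rw [bentArc_of_le h5, norm_mul, norm_real, norm_real, Real.norm_of_nonneg hp.1.le,
          Real.norm_of_nonneg (by linarith)] at h3
        nlinarith [hp.1, hp.2]
      · rw [bentArc_of_ge h5.le, norm_mul, norm_real, Real.norm_of_nonneg (by linarith)] at h4
        nlinarith
    · rw [bentArc_of_ge h2, bentArc_of_ge (h2.trans hrs)]
      exact hp2 (2 * r - 1, 2 * s - 1) ⟨⟨by linarith, by linarith⟩, ⟨by linarith, by linarith⟩⟩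

lemma IsotopicToIdMap.conj {h : ℂ → ℂ} (hh : IsotopicToIdMap h) (G : ℂ ≃ₜ ℂ) :
    IsotopicToIdMap fun z => G (h (G.symm z)) := by
  obtain ⟨H, hc, hi, h0, h1⟩ := hh
  refine ⟨fun u z => G (H u (G.symm z)), ?_, fun u => G.injective.comp ((hi u).comp
    G.symm.injective), ?_, ?_⟩
  · exact G.continuous.comp
      (hc.comp (f := fun q : ℝ × ℂ => (q.1, G.symm q.2)) (by fun_prop))
  · ext z; simp [h0]
  · ext z; simp [h1]

/-- If the unit disc is free and touches its image at `h 1`, then the origin lies in a translation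
strip. -/
lemma IsotopicToIdMap.exists_strip_of_critical {h : ℂ ≃ₜ ℂ} (hh : IsotopicToIdMap h)
    (hf : ∀ z, h z ≠ z)
    (hlt : ∀ q, ‖q‖ < 1 → 1 < ‖h q‖) (hle : ∀ q, ‖q‖ ≤ 1 → 1 ≤ ‖h q‖) (h1 : ‖h 1‖ = 1) :
    ∃ Θ : ℝ × ℝ → ℂ, IsOpenEmbedding Θ ∧ (∀ s t, Θ (s + 1, t) = h (Θ (s, t))) ∧
      0 ∈ range Θ := by
  obtain ⟨k, hk, hkd, hkd0⟩ := h.exists_conformal_on_horodisc hh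
  have hkb : ∀ q, ‖q‖ < 1 → 1 < ‖k q‖ := by
    intro q hq
    obtain ⟨q', hq'⟩ := h.surjective (k q)
    rcases lt_or_ge ‖q'‖ 1 with h2 | h2
    · rw [← hq']
      exact hlt _ h2
    · rw [← hk q' (by simpa using h2)] at hq'
      rw [k.injective hq'] at h2
      exact absurd hq h2.not_gt
  have hkb' : ∀ q, ‖q‖ ≤ 1 → 1 ≤ ‖k q‖ := by
    intro q hq
    rcases hq.lt_or_eq with h2 | h2
    · exact (hkb q h2).le
    · rw [hk q (by simp [h2])]
      exact hle q hq
  set G : ℂ ≃ₜ ℂ := h.symm.trans k with hG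
  have hGid : ∀ w, ‖w‖ ≤ 1 → G w = w := by
    intro w hw
    rw [hG, Homeomorph.trans_apply, hk, h.apply_symm_apply]
    intro hm
    have := hlt (h.symm w) (by simpa using hm)
    rw [h.apply_symm_apply] at this
    exact this.not_ge hw
  have hGid' : ∀ w, ‖w‖ ≤ 1 → G.symm w = w := by
    intro w hw
    rw [Homeomorph.symm_apply_eq, hGid w hw]
  set h' : ℂ ≃ₜ ℂ := (G.symm.trans h).trans G with hh'
  have hk' : ∀ w, ‖w‖ ≤ 1 → h' w = k w := by
    intro w hw
    change k (h.symm (h (G.symm w))) = k w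
    rw [h.symm_apply_apply, hGid' w hw]
  have hball : ∀ w ∈ Metric.ball (1 / 2 : ℂ) (1 / 2), ‖w‖ < 1 := by
    intro w hw
    have := norm_sub_norm_le w (1 / 2)
    rw [mem_ball_iff_norm] at hw
    norm_num at this
    linarith
  obtain ⟨Θ, hΘ, hΘe, q, hq⟩ := IsotopicToIdMap.exists_strip_of_conformal (h := h') (hh.conj G)
    (fun z hz => hf (G.symm z) (by
      rw [Homeomorph.eq_symm_apply]
      exact hz))
    (hkd.congr fun w hw => hk' w (hball w hw).le)
    (fun w hw => by
      have : h' =ᶠ[𝓝 w] k := by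
        filter_upwards [Metric.isOpen_ball.mem_nhds hw] with z hz
        exact hk' z (hball z hz).le
      rw [this.deriv_eq]
      exact hkd0 w hw)
    (fun q hq => by rw [hk' q hq.le]; exact hkb q hq)
    (fun q hq => by rw [hk' q hq]; exact hkb' q hq)
    (by rw [hk' 1 (by simp), hk 1 (by simp), h1])
  refine ⟨fun q => G.symm (Θ q), G.symm.isOpenEmbedding.comp hΘ, fun s t => ?_, q, ?_⟩
  · simp [hΘe, hh']
  · simp only [hq]
    exact hGid' 0 (by simp)

/-- **Brouwer's plane translation theorem**: every point lies in a translation strip. -/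
theorem IsotopicToIdMap.exists_strip {h : ℂ ≃ₜ ℂ} (hh : IsotopicToIdMap h)
    (hf : ∀ z, h z ≠ z) (x : ℂ) :
    ∃ Θ : ℝ × ℝ → ℂ, IsOpenEmbedding Θ ∧ (∀ s t, Θ (s + 1, t) = h (Θ (s, t))) ∧
      x ∈ range Θ := by
  obtain ⟨r, hr, ⟨z, hz, hhz⟩, hlt, hle⟩ := h.exists_critical_disc hf x
  have hzx : z - x ≠ 0 := by
    rw [← norm_pos_iff, hz]
    exact hr
  set A : ℂ ≃ₜ ℂ := (Homeomorph.mulLeft₀ (z - x) hzx).trans (Homeomorph.addRight x) with hA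
  have hAx : ∀ w, A w = (z - x) * w + x := fun w => rfl
  have hAs : ∀ w, ‖A.symm w‖ * r = ‖w - x‖ := by
    intro w
    have := hAx (A.symm w)
    rw [A.apply_symm_apply] at this
    conv_rhs => rw [this]
    rw [add_sub_cancel_right, norm_mul, hz, mul_comm]
  have hAn : ∀ w, ‖A w - x‖ = ‖w‖ * r := fun w => by rw [← hAs, A.symm_apply_apply]
  set h' : ℂ ≃ₜ ℂ := (A.trans h).trans A.symm with hh'
  have hn : ∀ w, ‖h' w‖ * r = ‖h (A w) - x‖ := fun w => hAs _
  obtain ⟨Θ, hΘ, hΘe, q, hq⟩ := IsotopicToIdMap.exists_strip_of_critical (h := h')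
    (hh.conj A.symm)
    (fun w hw => hf (A w) (by
      rw [← Homeomorph.symm_apply_eq]
      exact hw))
    (fun q hq => by
      have := hlt (A q) (by rw [hAn]; nlinarith)
      rw [← hn] at this
      nlinarith)
    (fun q hq => by
      have := hle (A q) (by rw [hAn]; nlinarith)
      rw [← hn] at this
      nlinarith)
    (by
      have := hn 1
      rw [hAx, mul_one, sub_add_cancel, hhz] at this
      nlinarith)
  refine ⟨fun q => A (Θ q), A.isOpenEmbedding.comp hΘ, fun s t => ?_, q, ?_⟩
  · simp [hΘe, hh']
  · simp [hq, hAx]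

end Complex

namespace BrouwerHomeo

variable (h : BrouwerHomeo)

lemma isTranslationDomain_range {Θ : Plane → Plane} (hΘ : IsOpenEmbedding Θ)
    (he : ∀ s t, Θ (s + 1, t) = h.toHomeomorph (Θ (s, t))) : IsTranslationDomain h (range Θ) := by
  have hc : ContractibleSpace (range Θ) :=
    hΘ.isEmbedding.toHomeomorph.symm.contractibleSpace
  refine ⟨hΘ.isOpen_range, isConnected_range hΘ.continuous, inferInstance, ?_,
    hΘ.isEmbedding.toHomeomorph.symm, ?_⟩
  · refine Subset.antisymm ?_ ?_
    · rintro _ ⟨_, ⟨⟨s, t⟩, rfl⟩, rfl⟩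
      exact ⟨(s + 1, t), he s t⟩
    · rintro _ ⟨⟨s, t⟩, rfl⟩
      exact ⟨Θ (s - 1, t), mem_range_self _, by rw [← he, sub_add_cancel]⟩
  · rintro _ ⟨⟨s, t⟩, rfl⟩ hx'
    have e : ∀ q hq, hΘ.isEmbedding.toHomeomorph.symm ⟨Θ q, hq⟩ = q := fun q hq =>
      (Homeomorph.symm_apply_eq _).2 rfl
    simp only [← he]
    exact (e _ _).trans (congrArg (fun q : Plane => (q.1 + 1, q.2)) (e (s, t) _).symm)

lemma exists_isTranslationDomain (x : Plane) : ∃ O, IsTranslationDomain h O ∧ x ∈ O := by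
  set e : ℂ ≃ₜ Plane := Complex.equivRealProdCLM.toHomeomorph with he
  set k : ℂ ≃ₜ ℂ := (e.trans h.toHomeomorph).trans e.symm with hk
  have hi : Complex.IsotopicToIdMap k := by
    obtain ⟨H, hc, h0, h1⟩ := h.orientationPreserving
    refine ⟨fun u z => e.symm (H u (e z)), ?_, fun u => e.symm.injective.comp
      ((H u).injective.comp e.injective), ?_, ?_⟩
    · exact e.symm.continuous.comp
        (hc.comp (f := fun q : ℝ × ℂ => (q.1, e q.2)) (by fun_prop))
    · ext1 z; simp [h0]
    · ext1 z; simp [h1, hk]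
  obtain ⟨Θ, hΘ, hΘe, q, hq⟩ := hi.exists_strip (fun z hz => h.fixedPointFree (e z) (by
    rw [← Homeomorph.symm_apply_eq]
    exact hz)) (e.symm x)
  refine ⟨range fun q => e (Θ q), h.isTranslationDomain_range (e.isOpenEmbedding.comp hΘ) ?_,
    q, ?_⟩
  · intro s t
    simp [hΘe, hk]
  · simp [hq]

end BrouwerHomeo

namespace ConnectsBy

variable {h : BrouwerHomeo} {x y z : Plane} {k m : ℕ}

lemma of_mem {O : Set Plane} (hO : IsTranslationDomain h O) (hx : x ∈ O) (hy : y ∈ O) :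
    ConnectsBy h x y 1 :=
  ⟨fun _ => O, fun _ => hO, by rw [iUnion_const]; exact hO.2.1, mem_iUnion.2 ⟨0, hx⟩,
    mem_iUnion.2 ⟨0, hy⟩⟩

lemma symm (hk : ConnectsBy h x y k) : ConnectsBy h y x k := by
  obtain ⟨O, h1, h2, h3, h4⟩ := hk
  exact ⟨O, h1, h2, h4, h3⟩

lemma ne_zero (hk : ConnectsBy h x y k) : k ≠ 0 := by
  rintro rfl
  obtain ⟨O, -, -, h3, -⟩ := hk
  obtain ⟨i, -⟩ := mem_iUnion.1 h3
  exact i.elim0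

lemma trans (hk : ConnectsBy h x y k) (hm : ConnectsBy h y z m) : ConnectsBy h x z (k + m) := by
  obtain ⟨O, h1, h2, h3, h4⟩ := hk
  obtain ⟨U, g1, g2, g3, g4⟩ := hm
  have hu : ⋃ i, Fin.append O U i = (⋃ i, O i) ∪ ⋃ i, U i := by
    ext w
    simp only [mem_iUnion, mem_union]
    constructor
    · rintro ⟨i, hi⟩
      induction i using Fin.addCases with
      | left i => exact Or.inl ⟨i, by simpa using hi⟩
      | right i => exact Or.inr ⟨i, by simpa using hi⟩
    · rintro (⟨i, hi⟩ | ⟨i, hi⟩)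
      · exact ⟨Fin.castAdd m i, by simpa using hi⟩
      · exact ⟨Fin.natAdd k i, by simpa using hi⟩
  refine ⟨Fin.append O U, fun i => ?_, ?_, ?_, ?_⟩
  · induction i using Fin.addCases with
    | left i => simpa using h1 i
    | right i => simpa using g1 i
  · rw [hu]
    exact h2.union ⟨y, h4, g3⟩ g2
  · rw [hu]
    exact Or.inl h3
  · rw [hu]
    exact Or.inr g4

lemma exists_connectsBy (h : BrouwerHomeo) (x y : Plane) : ∃ k, ConnectsBy h x y k := by
  refine PreconnectedSpace.induction₂' (fun x y => ∃ k, ConnectsBy h x y k) (fun x => ?_)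
    ⟨fun a b c ⟨k, hk⟩ ⟨m, hm⟩ => ⟨k + m, hk.trans hm⟩⟩ x y
  obtain ⟨O, hO, hx⟩ := h.exists_isTranslationDomain x
  filter_upwards [hO.1.mem_nhds hx] with y hy
  exact ⟨⟨1, of_mem hO hx hy⟩, ⟨1, of_mem hO hy hx⟩⟩

lemma transDist_le (hk : ConnectsBy h x y k) : transDist h x y ≤ k := by
  unfold transDist
  split_ifs
  · exact Nat.zero_le _
  · exact Nat.sInf_le hk

lemma transDist_of_ne (h : BrouwerHomeo) (hxy : x ≠ y) : ConnectsBy h x y (transDist h x y) := by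
  rw [transDist, if_neg hxy]
  exact Nat.sInf_mem (exists_connectsBy h x y)

end ConnectsBy

lemma transDist_self (h : BrouwerHomeo) (x : Plane) : transDist h x x = 0 := if_pos rfl

lemma transDist_comm (h : BrouwerHomeo) (x y : Plane) : transDist h x y = transDist h y x := by
  rcases eq_or_ne x y with rfl | hxy
  · rfl
  · exact le_antisymm (ConnectsBy.transDist_of_ne h hxy.symm).symm.transDist_le
      (ConnectsBy.transDist_of_ne h hxy).symm.transDist_le

/-- The translation distance `d_h` is a metric on the plane:
it vanishes exactly on the diagonal, is symmetric, and satisfies the triangle inequality. -/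
theorem transDist_is_metric (h : BrouwerHomeo) :
    ∀ x y z : Plane,
      (transDist h x y = 0 ↔ x = y) ∧
      transDist h x y = transDist h y x ∧
      transDist h x z ≤ transDist h x y + transDist h y z := by
  intro x y z
  refine ⟨⟨fun h0 => ?_, ?_⟩, transDist_comm h x y, ?_⟩
  · by_contra hxy
    exact (ConnectsBy.transDist_of_ne h hxy).ne_zero h0
  · rintro rfl
    exact transDist_self h x
  · rcases eq_or_ne x y with rfl | hxy
    · exact Nat.le_add_left _ _
    rcases eq_or_ne y z with rfl | hyz
    · exact Nat.le_add_right _ _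
    exact ((ConnectsBy.transDist_of_ne h hxy).trans
      (ConnectsBy.transDist_of_ne h hyz)).transDist_le
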